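/- For every real x ≥ 10, one has π(x) ≤ M(x) ≤ (1 + C·(log log x)^5/log x)·π(x) for some absolute constant C > 0; equivalently, M(x) = (1 + O((log log x)^5/log x))·x/log x. -/

import Mathlib

open scoped BigOperators

/-- `M A` is the largest cardinality of a subset of `A` on which the Euler totient
function is nondecreasing. -/
noncomputable def M (A : Set ℕ) : ℕ :=
  sSup {k : ℕ | ∃ B : Finset ℕ, ↑B ⊆ A ∧
    (∀ m ∈ B, ∀ n ∈ B, m ≤ n → Nat.totient m ≤ Nat.totient n) ∧ B.card = k}

/-- `Mx x = M([x])` where `[x] = {n : ℕ | 1 ≤ n ≤ x}`. -/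
noncomputable def Mx (x : ℝ) : ℕ := M {n : ℕ | 1 ≤ n ∧ (n : ℝ) ≤ x}

/-- The number of primes up to the real number `x`. -/
noncomputable def primePi (x : ℝ) : ℕ := {p : ℕ | p.Prime ∧ (p : ℝ) ≤ x}.ncard

/-- The difference between `a⁻ˢ` and the integral of `u⁻ˢ` over `[a, a + 1]`, for `a = n + 1`. -/
noncomputable def zetaDefect (n : ℕ) (s : ℂ) : ℂ :=
  (n + 1 : ℂ) ^ (-s) - ((n + 2 : ℂ) ^ (1 - s) - (n + 1 : ℂ) ^ (1 - s)) / (1 - s)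

lemma norm_cpow_neg_sub_cpow_neg_le {a u : ℝ} (ha : 0 < a) (hu : a ≤ u) {s : ℂ} (hs : 0 ≤ s.re) :
    ‖(a : ℂ) ^ (-s) - (u : ℂ) ^ (-s)‖ ≤ ‖s‖ * a ^ (-s.re - 1) * (u - a) := by
  have hd : ∀ x ∈ Set.Icc a u, HasDerivWithinAt (fun y : ℝ => (y : ℂ) ^ (-s))
      (-s * (x : ℂ) ^ (-s - 1)) (Set.Icc a u) x := by
    intro x hx
    by_cases h0 : s = 0
    · subst h0
      simpa using (hasDerivAt_const x (1 : ℂ)).hasDerivWithinAt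
    · have hx0 : x ≠ 0 := (ha.trans_le hx.1).ne'
      exact (hasDerivAt_ofReal_cpow_const hx0 (neg_ne_zero.2 h0)).hasDerivWithinAt
  have hb : ∀ x ∈ Set.Icc a u, ‖-s * (x : ℂ) ^ (-s - 1)‖ ≤ ‖s‖ * a ^ (-s.re - 1) := by
    intro x hx
    rw [norm_mul, norm_neg, Complex.norm_cpow_eq_rpow_re_of_pos (ha.trans_le hx.1)]
    gcongr
    simp only [Complex.sub_re, Complex.neg_re, Complex.one_re]
    exact Real.rpow_le_rpow_of_nonpos ha hx.1 (by linarith)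
  have := (convex_Icc a u).norm_image_sub_le_of_norm_hasDerivWithin_le hd hb
    (Set.right_mem_Icc.2 hu) (Set.left_mem_Icc.2 hu)
  rw [Real.norm_eq_abs, abs_sub_comm, abs_of_nonneg (sub_nonneg.2 hu)] at this
  exact this

lemma norm_zetaDefect_le (n : ℕ) {s : ℂ} (hs : 0 ≤ s.re) (hs1 : s ≠ 1) :
    ‖zetaDefect n s‖ ≤ ‖s‖ * (n + 1 : ℝ) ^ (-s.re - 1) := by
  have hn : (0 : ℝ) < n + 1 := by positivity
  have hnot : (0 : ℝ) ∉ Set.uIcc ((n : ℝ) + 1) (n + 2) := by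
    rw [Set.uIcc_of_le (by linarith)]
    intro h
    linarith [h.1]
  have hint : ∫ u in ((n : ℝ) + 1)..(n + 2), (u : ℂ) ^ (-s)
      = ((n + 2 : ℂ) ^ (1 - s) - (n + 1 : ℂ) ^ (1 - s)) / (1 - s) := by
    rw [integral_cpow (Or.inr ⟨by intro h; apply hs1; linear_combination -h, hnot⟩)]
    push_cast
    rw [show -s + 1 = 1 - s by ring]
  have hii : IntervalIntegrable (fun u : ℝ => (u : ℂ) ^ (-s)) MeasureTheory.volume
      ((n : ℝ) + 1) (n + 2) :=
    intervalIntegral.intervalIntegrable_cpow (Or.inr hnot)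
  have hEq : zetaDefect n s = ∫ u in ((n : ℝ) + 1)..(n + 2),
      ((((n : ℝ) + 1 : ℝ) : ℂ) ^ (-s) - (u : ℂ) ^ (-s)) := by
    rw [intervalIntegral.integral_sub (by simp) hii, hint, zetaDefect]
    simp only [intervalIntegral.integral_const]
    norm_num
  rw [hEq]
  have := intervalIntegral.norm_integral_le_of_norm_le_const (a := (n : ℝ) + 1) (b := n + 2)
    (f := fun u : ℝ => ((((n : ℝ) + 1 : ℝ) : ℂ) ^ (-s) - (u : ℂ) ^ (-s)))
    (C := ‖s‖ * (n + 1 : ℝ) ^ (-s.re - 1)) (by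
      intro u hu
      rw [Set.uIoc_of_le (by linarith)] at hu
      refine (norm_cpow_neg_sub_cpow_neg_le hn hu.1.le hs).trans ?_
      have : u - (n + 1) ≤ 1 := by linarith [hu.2]
      exact mul_le_of_le_one_right (by positivity) this)
  refine this.trans (le_of_eq ?_)
  norm_num

lemma summable_add_one_rpow {r : ℝ} (hr : r < -1) : Summable fun n : ℕ => (n + 1 : ℝ) ^ r := by
  have := (summable_nat_add_iff 1).2 (Real.summable_nat_rpow.2 hr)
  simpa using this

lemma tsum_zetaDefect_of_one_lt_re {s : ℂ} (hs : 1 < s.re) :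
    ∑' n, zetaDefect n s = riemannZeta s - 1 / (s - 1) := by
  have hs1 : s ≠ 1 := by rintro rfl; simp at hs
  have hsum : Summable fun n => zetaDefect n s :=
    Summable.of_norm_bounded ((summable_add_one_rpow (r := -s.re - 1) (by linarith)).mul_left ‖s‖)
      fun n => norm_zetaDefect_le n (by linarith) hs1
  have hz : Summable fun n : ℕ => (n + 1 : ℂ) ^ (-s) := by
    refine Summable.of_norm_bounded (summable_add_one_rpow (r := -s.re) (by linarith)) fun n => ?_
    have := Complex.norm_cpow_eq_rpow_re_of_pos (x := (n : ℝ) + 1) (by positivity) (-s)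
    push_cast at this
    rw [this]; simp
  have hzeta : riemannZeta s = ∑' n : ℕ, (n + 1 : ℂ) ^ (-s) := by
    rw [zeta_eq_tsum_one_div_nat_add_one_cpow hs]
    simp [Complex.cpow_neg]
  have htel : Filter.Tendsto (fun N : ℕ => ∑ n ∈ Finset.range N,
      ((n + 2 : ℂ) ^ (1 - s) - (n + 1 : ℂ) ^ (1 - s)) / (1 - s)) Filter.atTop
      (nhds ((0 - 1) / (1 - s))) := by
    have h1 : ∀ N : ℕ, ∑ n ∈ Finset.range N,
        ((n + 2 : ℂ) ^ (1 - s) - (n + 1 : ℂ) ^ (1 - s)) / (1 - s)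
        = ((N + 1 : ℂ) ^ (1 - s) - 1) / (1 - s) := by
      intro N
      rw [← Finset.sum_div]
      congr 1
      have := Finset.sum_range_sub (fun n : ℕ => (n + 1 : ℂ) ^ (1 - s)) N
      simp only [Nat.cast_add, Nat.cast_one, add_assoc] at this
      rw [show (1 + 1 : ℂ) = 2 by norm_num] at this
      rw [this]
      simp
    simp_rw [h1]
    refine Filter.Tendsto.div_const (Filter.Tendsto.sub_const ?_ _) _
    rw [tendsto_zero_iff_norm_tendsto_zero]
    have h2 : ∀ N : ℕ, ‖(N + 1 : ℂ) ^ (1 - s)‖ = ((N + 1 : ℕ) : ℝ) ^ (-(s.re - 1)) := by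
      intro N
      have := Complex.norm_cpow_eq_rpow_re_of_pos (x := (N : ℝ) + 1) (by positivity) (1 - s)
      push_cast at this ⊢
      rw [this]; simp
    simp_rw [h2]
    exact ((tendsto_rpow_neg_atTop (by linarith)).comp tendsto_natCast_atTop_atTop).comp
      (Filter.tendsto_add_atTop_nat 1)
  have hdiff := hz.sub hsum
  have heq : ∀ n : ℕ, (n + 1 : ℂ) ^ (-s) - zetaDefect n s
      = ((n + 2 : ℂ) ^ (1 - s) - (n + 1 : ℂ) ^ (1 - s)) / (1 - s) := by
    intro n; simp [zetaDefect]
  have h3 := hdiff.hasSum.tendsto_sum_nat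
  simp_rw [heq] at h3
  have h4 := tendsto_nhds_unique h3 htel
  have h5 : ∑' n : ℕ, ((n + 1 : ℂ) ^ (-s) - zetaDefect n s)
     = riemannZeta s - ∑' n, zetaDefect n s := by rw [hzeta, hz.tsum_sub hsum]
  simp_rw [heq] at h5
  rw [h4] at h5
  have h6 : s - 1 ≠ 0 := sub_ne_zero.2 hs1
  have h7 : 1 - s ≠ 0 := sub_ne_zero.2 hs1.symm
  have : (0 - 1) / (1 - s) = 1 / (s - 1) := by field_simp; ring
  rw [this] at h5
  linear_combination h5

lemma differentiableAt_zetaDefect (n : ℕ) {s : ℂ} (hs1 : s ≠ 1) :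
    DifferentiableAt ℂ (zetaDefect n) s := by
  unfold zetaDefect
  have h7 : 1 - s ≠ 0 := sub_ne_zero.2 hs1.symm
  have a1 : (n + 1 : ℂ) ≠ 0 := by exact_mod_cast Nat.succ_ne_zero n
  have a2 : (n + 2 : ℂ) ≠ 0 := by exact_mod_cast Nat.succ_ne_zero (n + 1)
  refine DifferentiableAt.sub ?_ (DifferentiableAt.div (DifferentiableAt.sub ?_ ?_) ?_ h7)
  · exact (differentiableAt_id.neg).const_cpow (Or.inl a1)
  · exact ((differentiableAt_const _).sub differentiableAt_id).const_cpow (Or.inl a2)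
  · exact ((differentiableAt_const _).sub differentiableAt_id).const_cpow (Or.inl a1)
  · fun_prop

lemma tsum_zetaDefect_of_im_pos {s : ℂ} (hs : 0 < s.re) (ht : 0 < s.im) :
    ∑' n, zetaDefect n s = riemannZeta s - 1 / (s - 1) := by
  set U : Set ℂ := {z | 0 < z.re} ∩ {z | 0 < z.im} with hU
  have hUo : IsOpen U :=
    (isOpen_lt continuous_const Complex.continuous_re).inter
      (isOpen_lt continuous_const Complex.continuous_im)
  have hUc : Convex ℝ U := (convex_halfSpace_re_gt 0).inter (convex_halfSpace_im_gt 0)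
  have hne : ∀ z ∈ U, z ≠ 1 := by
    rintro z hz rfl
    simpa using hz.2
  have hd1 : DifferentiableOn ℂ (fun z => ∑' n, zetaDefect n z) U := by
    intro z hz
    -- work on a smaller open set on which the series converges uniformly
    set V : Set ℂ := U ∩ ({w | z.re / 2 < w.re} ∩ Metric.ball 0 (‖z‖ + 1)) with hV
    have hVo : IsOpen V := hUo.inter
      ((isOpen_lt continuous_const Complex.continuous_re).inter Metric.isOpen_ball)
    have hzV : z ∈ V := by
      refine ⟨hz, ?_, ?_⟩
      · have := hz.1
        simp only [Set.mem_ofPred_eq] at this ⊢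
        linarith
      · simp
    have hzre : 0 < z.re := hz.1
    have hdV : DifferentiableOn ℂ (fun z => ∑' n, zetaDefect n z) V := by
      refine Complex.differentiableOn_tsum_of_summable_norm
        (u := fun n : ℕ => (‖z‖ + 1) * (n + 1 : ℝ) ^ (-(z.re / 2) - 1))
        ((summable_add_one_rpow (by linarith)).mul_left _)
        (fun n w hw => (differentiableAt_zetaDefect n (hne w hw.1)).differentiableWithinAt)
        hVo ?_
      intro n w hw
      refine (norm_zetaDefect_le n hw.1.1.le (hne w hw.1)).trans ?_
      have h1 : ‖w‖ ≤ ‖z‖ + 1 := by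
        have := hw.2.2
        simp at this
        exact this.le
      have h2 : z.re / 2 < w.re := hw.2.1
      gcongr
      · linarith [Nat.cast_nonneg (α := ℝ) n]
    exact (hdV.differentiableAt (hVo.mem_nhds hzV)).differentiableWithinAt
  have hd2 : DifferentiableOn ℂ (fun z => riemannZeta z - 1 / (z - 1)) U := by
    intro z hz
    have h6 : z - 1 ≠ 0 := sub_ne_zero.2 (hne z hz)
    refine ((differentiableAt_riemannZeta (hne z hz)).sub
      (DifferentiableAt.div (by fun_prop) (by fun_prop) h6)).differentiableWithinAt
  have hA1 := hd1.analyticOnNhd hUo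
  have hA2 := hd2.analyticOnNhd hUo
  have h0 : (⟨2, 1⟩ : ℂ) ∈ U := by simp [hU]
  have := hA1.eqOn_of_preconnected_of_eventuallyEq hA2 hUc.isPreconnected h0 (by
    have hO : IsOpen {z : ℂ | 1 < z.re} := isOpen_lt continuous_const Complex.continuous_re
    filter_upwards [hO.mem_nhds (show (⟨2, 1⟩ : ℂ) ∈ {z : ℂ | 1 < z.re} by simp)] with w hw
    exact tsum_zetaDefect_of_one_lt_re hw)
  exact this ⟨hs, ht⟩

lemma sum_zetaDefect (N : ℕ) (s : ℂ) :
    ∑ n ∈ Finset.range N, zetaDefect n s = ∑ n ∈ Finset.range N, (n + 1 : ℂ) ^ (-s)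
      - ((N + 1 : ℂ) ^ (1 - s) - 1) / (1 - s) := by
  simp only [zetaDefect, Finset.sum_sub_distrib, ← Finset.sum_div]
  congr 2
  rw [← Finset.sum_sub_distrib]
  have := Finset.sum_range_sub (fun n : ℕ => (n + 1 : ℂ) ^ (1 - s)) N
  simp only [Nat.cast_add, Nat.cast_one, add_assoc] at this
  rw [show (1 + 1 : ℂ) = 2 by norm_num] at this
  rw [this]
  simp

lemma norm_natCast_add_one_cpow (n : ℕ) (s : ℂ) :
    ‖(n + 1 : ℂ) ^ s‖ = (n + 1 : ℝ) ^ s.re := by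
  have := Complex.norm_cpow_eq_rpow_re_of_pos (x := (n : ℝ) + 1) (by positivity) s
  push_cast at this
  exact this

lemma two_le_log_eight : 2 ≤ Real.log 8 := by
  have : Real.log 8 = 3 * Real.log 2 := by
    rw [show (8 : ℝ) = 2 ^ 3 by norm_num, Real.log_pow]; norm_num
  linarith [Real.log_two_gt_d9]

lemma exists_norm_riemannZeta_le_of_im_pos : ∃ C : ℝ, 0 < C ∧ ∀ s : ℂ, 8 ≤ s.im →
    1 - 1 / Real.log s.im ≤ s.re → s.re ≤ 4 → ‖riemannZeta s‖ ≤ C * Real.log s.im := by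
  have hsumm := summable_add_one_rpow (r := -5 / 4) (by norm_num)
  set S : ℝ := ∑' n : ℕ, (n + 1 : ℝ) ^ (-5 / 4 : ℝ) with hS
  have hS0 : 0 ≤ S := tsum_nonneg fun n => by positivity
  refine ⟨1 + (Real.exp 5 + 1) + 6 * Real.exp 5 + 2 * S, by positivity, fun s ht hσ hσ4 => ?_⟩
  set t := s.im with htdef
  set σ := s.re with hσdef
  have ht0 : 0 < t := by linarith
  have hlog2 : 2 ≤ Real.log t := two_le_log_eight.trans (Real.log_le_log (by norm_num) ht)
  have hlog0 : 0 < Real.log t := by linarith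
  have hinv : 1 / Real.log t ≤ 1 / 2 := one_div_le_one_div_of_le (by norm_num) hlog2
  have hσhalf : 1 / 2 ≤ σ := by linarith
  have hs1 : s ≠ 1 := by
    intro h
    have : t = 0 := by rw [htdef, h]; simp
    linarith
  have hns : t ≤ ‖s - 1‖ := by
    have := Complex.abs_im_le_norm (s - 1)
    simp only [Complex.sub_im, Complex.one_im, sub_zero] at this
    exact (le_abs_self _).trans this
  have hns' : t ≤ ‖1 - s‖ := by rwa [norm_sub_rev]
  have hnorm : ‖s‖ ≤ 2 * t := by
    have := Complex.norm_le_abs_re_add_abs_im s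
    rw [abs_of_pos (show 0 < s.re by linarith), abs_of_pos (show 0 < s.im by linarith)] at this
    linarith
  set N : ℕ := ⌈t ^ 4⌉₊ with hN
  have hNge : t ^ 4 ≤ N := Nat.le_ceil _
  have hNlt : (N : ℝ) + 1 ≤ t ^ 5 := by
    have h1 := (Nat.ceil_lt_add_one (show 0 ≤ t ^ 4 by positivity)).le
    have h2 : 8 * t ^ 4 ≤ t * t ^ 4 := by gcongr
    have h3 : (1 : ℝ) ≤ t ^ 4 := one_le_pow₀ (by linarith)
    calc (N : ℝ) + 1 ≤ t ^ 4 + 1 + 1 := by linarith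
      _ ≤ t * t ^ 4 := by linarith
      _ = t ^ 5 := by ring
  have hpow : ∀ y : ℝ, 1 ≤ y → y ≤ t ^ 5 → y ^ (1 - σ) ≤ Real.exp 5 := by
    intro y hy1 hy
    calc y ^ (1 - σ) ≤ y ^ (1 / Real.log t) := Real.rpow_le_rpow_of_exponent_le hy1 (by linarith)
      _ ≤ (t ^ 5) ^ (1 / Real.log t) := Real.rpow_le_rpow (by linarith) hy (by positivity)
      _ = Real.exp 5 := by
          rw [Real.rpow_def_of_pos (by positivity), Real.log_pow]
          congr 1
          field_simp
          norm_num
  have hsum : Summable fun n => zetaDefect n s :=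
    Summable.of_norm_bounded ((summable_add_one_rpow (r := -σ - 1) (by linarith)).mul_left ‖s‖)
      fun n => norm_zetaDefect_le n (by linarith) hs1
  have hid := tsum_zetaDefect_of_im_pos (s := s) (by linarith) (by linarith)
  rw [← hsum.sum_add_tsum_nat_add N, sum_zetaDefect] at hid
  have hz : riemannZeta s = 1 / (s - 1) + (∑ n ∈ Finset.range N, (n + 1 : ℂ) ^ (-s)
      - ((N + 1 : ℂ) ^ (1 - s) - 1) / (1 - s)) + ∑' n, zetaDefect (n + N) s := by
    linear_combination -hid
  have b1 : ‖1 / (s - 1)‖ ≤ 1 := by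
    rw [norm_div, norm_one, div_le_one (by linarith)]
    linarith
  have b2 : ‖∑ n ∈ Finset.range N, (n + 1 : ℂ) ^ (-s)‖ ≤ Real.exp 5 * (6 * Real.log t) := by
    refine (norm_sum_le _ _).trans ?_
    have : ∀ n ∈ Finset.range N, ‖(n + 1 : ℂ) ^ (-s)‖ ≤ Real.exp 5 * ((n : ℝ) + 1)⁻¹ := by
      intro n hn
      have hn1 : (n : ℝ) + 1 ≤ t ^ 5 := by
        have : (n : ℝ) + 1 ≤ N := by exact_mod_cast Finset.mem_range.1 hn
        linarith
      rw [norm_natCast_add_one_cpow]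
      have h1 : ((n : ℝ) + 1) ^ (-s).re = ((n : ℝ) + 1) ^ (1 - σ) * ((n : ℝ) + 1)⁻¹ := by
        rw [← Real.rpow_neg_one, ← Real.rpow_add (by positivity)]
        congr 1
        simp only [Complex.neg_re]; ring
      rw [h1]
      gcongr
      exact hpow _ (by linarith [Nat.cast_nonneg (α := ℝ) n]) hn1
    refine (Finset.sum_le_sum this).trans ?_
    rw [← Finset.mul_sum]
    gcongr
    have hh := harmonic_le_one_add_log N
    have heq : ((harmonic N : ℚ) : ℝ) = ∑ n ∈ Finset.range N, ((n : ℝ) + 1)⁻¹ := by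
      simp [harmonic]
    rw [← heq]
    have hlN : Real.log N ≤ 5 * Real.log t := by
      rw [show 5 * Real.log t = Real.log (t ^ 5) by rw [Real.log_pow]; norm_num]
      refine Real.log_le_log ?_ (by linarith)
      have : 0 < t ^ 4 := by positivity
      linarith
    linarith
  have b3 : ‖((N + 1 : ℂ) ^ (1 - s) - 1) / (1 - s)‖ ≤ Real.exp 5 + 1 := by
    rw [norm_div]
    refine div_le_of_le_mul₀ (norm_nonneg _) (by positivity) ?_
    refine (norm_sub_le _ _).trans ?_
    rw [norm_natCast_add_one_cpow, norm_one]
    have h1 := hpow ((N : ℝ) + 1) (by linarith [Nat.cast_nonneg (α := ℝ) N]) hNlt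
    simp only [Complex.sub_re, Complex.one_re]
    have h2 : Real.exp 5 + 1 ≤ (Real.exp 5 + 1) * ‖1 - s‖ :=
      le_mul_of_one_le_right (by positivity) (by linarith)
    linarith
  have b4 : ‖∑' n, zetaDefect (n + N) s‖ ≤ 2 * S := by
    have hb : ∀ n : ℕ, ‖zetaDefect (n + N) s‖ ≤ 2 * ((n : ℝ) + 1) ^ (-5 / 4 : ℝ) := by
      intro n
      refine (norm_zetaDefect_le (n + N) (by linarith) hs1).trans ?_
      have hy : (0 : ℝ) < ((n + N : ℕ) : ℝ) + 1 := by positivity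
      have hy1 : t ^ 4 ≤ ((n + N : ℕ) : ℝ) + 1 := by
        push_cast; linarith [Nat.cast_nonneg (α := ℝ) n]
      have hy2 : (n : ℝ) + 1 ≤ ((n + N : ℕ) : ℝ) + 1 := by
        push_cast; linarith [Nat.cast_nonneg (α := ℝ) N]
      have h1 : (((n + N : ℕ) : ℝ) + 1) ^ (-s.re - 1) ≤
          (((n + N : ℕ) : ℝ) + 1) ^ (-1 / 4 : ℝ) * (((n + N : ℕ) : ℝ) + 1) ^ (-5 / 4 : ℝ) := by
        rw [← Real.rpow_add hy]
        refine Real.rpow_le_rpow_of_exponent_le (by linarith [Nat.cast_nonneg (α := ℝ) n]) ?_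
        linarith
      have h2 : (((n + N : ℕ) : ℝ) + 1) ^ (-1 / 4 : ℝ) ≤ t⁻¹ := by
        calc _ ≤ (t ^ 4) ^ (-1 / 4 : ℝ) :=
              Real.rpow_le_rpow_of_nonpos (by positivity) hy1 (by norm_num)
          _ = t⁻¹ := by
              rw [← Real.rpow_natCast, ← Real.rpow_mul ht0.le, ← Real.rpow_neg_one]
              norm_num
      have h3 : (((n + N : ℕ) : ℝ) + 1) ^ (-5 / 4 : ℝ) ≤ ((n : ℝ) + 1) ^ (-5 / 4 : ℝ) :=
        Real.rpow_le_rpow_of_nonpos (by positivity) hy2 (by norm_num)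
      calc ‖s‖ * (((n + N : ℕ) : ℝ) + 1) ^ (-s.re - 1)
          ≤ (2 * t) * (t⁻¹ * ((n : ℝ) + 1) ^ (-5 / 4 : ℝ)) := by
            gcongr
            exact h1.trans (by gcongr)
        _ = 2 * ((n : ℝ) + 1) ^ (-5 / 4 : ℝ) := by field_simp
    exact tsum_of_norm_bounded (hsumm.hasSum.mul_left 2) hb
  rw [hz]
  have h1 : 1 ≤ Real.log t := by linarith
  calc _ ≤ 1 + (Real.exp 5 * (6 * Real.log t) + (Real.exp 5 + 1)) + 2 * S :=
        (norm_add_le _ _).trans (add_le_add ((norm_add_le _ _).trans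
          (add_le_add b1 ((norm_sub_le _ _).trans (add_le_add b2 b3)))) b4)
    _ ≤ _ := by
        have e5 := Real.exp_pos 5
        nlinarith [mul_le_mul_of_nonneg_left h1 hS0, mul_le_mul_of_nonneg_left h1 e5.le]

lemma exists_norm_riemannZeta_le : ∃ C : ℝ, 0 < C ∧ ∀ s : ℂ, 8 ≤ |s.im| →
    1 - 1 / Real.log |s.im| ≤ s.re → s.re ≤ 4 → ‖riemannZeta s‖ ≤ C * Real.log |s.im| := by
  obtain ⟨C, hC, h⟩ := exists_norm_riemannZeta_le_of_im_pos
  refine ⟨C, hC, fun s ht hσ hσ4 => ?_⟩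
  rcases abs_cases s.im with ⟨h1, -⟩ | ⟨h1, -⟩
  · rw [h1] at ht hσ ⊢
    exact h s ht hσ hσ4
  · rw [h1] at ht hσ ⊢
    have := h ((starRingEnd ℂ) s) (by simpa using ht) (by simpa using hσ) (by simpa using hσ4)
    rw [riemannZeta_conj, RCLike.norm_conj] at this
    simpa using this

/-- Bounds for the derivatives of `ζ` to the right of the line `Re s = 1`, by Cauchy's estimates. -/
lemma exists_norm_iteratedDeriv_riemannZeta_le (k : ℕ) : ∃ C : ℝ, 0 < C ∧ ∀ s : ℂ, 10 ≤ |s.im| →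
    1 ≤ s.re → s.re ≤ 2 → ‖iteratedDeriv k riemannZeta s‖ ≤ C * Real.log |s.im| ^ (k + 1) := by
  obtain ⟨C, hC, h⟩ := exists_norm_riemannZeta_le
  refine ⟨k.factorial * (2 * C) * 2 ^ k, by positivity, fun s ht hσ hσ2 => ?_⟩
  set t := |s.im| with htdef
  have ht0 : 0 < t := by linarith
  have hlog2 : 2 ≤ Real.log t :=
    two_le_log_eight.trans (Real.log_le_log (by norm_num) (by linarith))
  have hlog0 : 0 < Real.log t := by linarith
  set R : ℝ := 1 / (2 * Real.log t) with hR
  have hR0 : 0 < R := by positivity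
  have hR1 : R ≤ 1 / 4 := one_div_le_one_div_of_le (by norm_num) (by linarith)
  have hball : ∀ z ∈ Metric.closedBall s R, ‖riemannZeta z‖ ≤ 2 * C * Real.log t := by
    intro z hz
    rw [Metric.mem_closedBall, Complex.dist_eq] at hz
    have hre := (Complex.abs_re_le_norm (z - s)).trans hz
    have him := (Complex.abs_im_le_norm (z - s)).trans hz
    simp only [Complex.sub_re, Complex.sub_im] at hre him
    have hdiff := (abs_abs_sub_abs_le z.im s.im).trans him
    rw [abs_le] at hre hdiff
    have hz8 : 8 ≤ |z.im| := by linarith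
    have hzu : |z.im| ≤ t ^ 2 := by nlinarith
    have hlz : Real.log |z.im| ≤ 2 * Real.log t := by
      rw [show 2 * Real.log t = Real.log (t ^ 2) by rw [Real.log_pow]; norm_num]
      exact Real.log_le_log (by linarith) hzu
    have hlz0 : 0 < Real.log |z.im| := Real.log_pos (by linarith)
    have : 1 / (2 * Real.log t) ≤ 1 / Real.log |z.im| := one_div_le_one_div_of_le hlz0 hlz
    refine (h z hz8 (by linarith) (by linarith)).trans ?_
    nlinarith
  have hd : DiffContOnCl ℂ riemannZeta (Metric.ball s R) := by
    refine DifferentiableOn.diffContOnCl fun z hz => ?_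
    refine (differentiableAt_riemannZeta ?_).differentiableWithinAt
    rintro rfl
    have hz' := Metric.closure_ball_subset_closedBall hz
    rw [Metric.mem_closedBall, Complex.dist_eq] at hz'
    have him := (Complex.abs_im_le_norm (1 - s)).trans hz'
    simp only [Complex.sub_im, Complex.one_im, zero_sub, abs_neg] at him
    linarith
  refine (Complex.norm_iteratedDeriv_le_of_forall_mem_sphere_norm_le k hR0 hd
    fun z hz => hball z (Metric.sphere_subset_closedBall hz)).trans (le_of_eq ?_)
  rw [hR, pow_succ, one_div, inv_pow, div_inv_eq_mul, mul_pow]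
  ring

lemma exists_norm_riemannZeta_one_add_le : ∃ C : ℝ, 1 ≤ C ∧ ∀ x : ℝ, 0 < x → x ≤ 1 →
    ‖riemannZeta (1 + x)‖ ≤ C / x := by
  have hc : ContinuousOn (fun x : ℝ => ‖riemannZeta₁ (1 + x)‖) (Set.Icc 0 1) := by
    have := differentiable_riemannZeta₁.continuous
    fun_prop
  obtain ⟨C, hC⟩ := isCompact_Icc.bddAbove_image hc
  refine ⟨max C 1, le_max_right _ _, fun x hx hx1 => ?_⟩
  have hne : (1 + x : ℂ) ≠ 1 := by simpa using hx.ne'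
  rw [riemannZeta_eq_inv_sub_mul hne, norm_mul, div_eq_inv_mul]
  have h1 : ‖((1 + x : ℂ) - 1)⁻¹‖ = x⁻¹ := by simp [abs_of_pos hx]
  rw [h1]
  gcongr
  exact (hC ⟨x, ⟨hx.le, hx1⟩, rfl⟩).trans (le_max_left _ _)

lemma one_le_norm_riemannZeta_product {x : ℝ} (hx : 0 < x) (y : ℝ) :
    1 ≤ ‖riemannZeta (1 + x)‖ ^ 3 * ‖riemannZeta (1 + x + Complex.I * y)‖ ^ 4 *
      ‖riemannZeta (1 + x + 2 * Complex.I * y)‖ := by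
  have := DirichletCharacter.norm_LFunction_product_ge_one (1 : DirichletCharacter ℂ 1) hx y
  simpa only [DirichletCharacter.LFunctionTrivChar, DirichletCharacter.LFunction_modOne_eq,
    norm_mul, norm_pow] using this

/-- The classical lower bound for `ζ` near the line `Re s = 1`. -/
lemma exists_le_norm_riemannZeta : ∃ c : ℝ, 0 < c ∧ ∀ s : ℂ, 10 ≤ |s.im| → 1 < s.re →
    s.re ≤ 2 → c ≤ ‖riemannZeta s‖ * Real.log |s.im| ^ 7 := by
  obtain ⟨C₁, hC₁, h₁⟩ := exists_norm_riemannZeta_one_add_le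
  obtain ⟨C₂, hC₂, h₂⟩ := exists_norm_riemannZeta_le
  obtain ⟨C₃, hC₃, h₃⟩ := exists_norm_iteratedDeriv_riemannZeta_le 1
  set c : ℝ := 1 / (1 + C₁ ^ 3 * (2 * C₂)) with hc
  have hA : 0 < C₁ ^ 3 * (2 * C₂) := by positivity
  have hc0 : 0 < c := by positivity
  have hc1 : c ≤ 1 := by
    rw [hc, div_le_one (by positivity)]; linarith
  have hcA : c ^ 4 * (C₁ ^ 3 * (2 * C₂)) ≤ 1 := by
    have : c ^ 4 ≤ c := by simpa using pow_le_pow_of_le_one hc0.le hc1 (show 1 ≤ 4 by norm_num)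
    have h' : c * (1 + C₁ ^ 3 * (2 * C₂)) = 1 := by rw [hc]; field_simp
    nlinarith
  have key : ∀ t : ℝ, 10 ≤ |t| → ∀ r κ : ℝ, 0 < r → r ≤ 1 → 0 < κ →
      κ ^ 4 ≤ r * Real.log |t| ^ 9 →
      c * κ ^ 3 ≤ ‖riemannZeta (1 + r + Complex.I * t)‖ * Real.log |t| ^ 7 := by
    intro t ht r κ hr hr1 hκ hκr
    have hT2 : 2 ≤ Real.log |t| :=
      two_le_log_eight.trans (Real.log_le_log (by norm_num) (by linarith))
    set T := Real.log |t| with hT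
    have hp := one_le_norm_riemannZeta_product hr t
    have e1 := h₁ r hr hr1
    have e2 : ‖riemannZeta (1 + r + 2 * Complex.I * t)‖ ≤ 2 * C₂ * T := by
      have him : (1 + r + 2 * Complex.I * t : ℂ).im = 2 * t := by simp
      have hre : (1 + r + 2 * Complex.I * t : ℂ).re = 1 + r := by simp
      have h2t : |2 * t| = 2 * |t| := by rw [abs_mul]; norm_num
      have hlog : Real.log (2 * |t|) ≤ 2 * T := by
        rw [show 2 * T = Real.log (|t| ^ 2) by rw [Real.log_pow, Nat.cast_ofNat]]
        exact Real.log_le_log (by linarith) (by nlinarith)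
      have hlog0 : 0 < Real.log (2 * |t|) := Real.log_pos (by linarith)
      have := h₂ (1 + r + 2 * Complex.I * t) (by rw [him, h2t]; linarith)
        (by
          rw [him, hre, h2t]
          have : 0 < 1 / Real.log (2 * |t|) := by positivity
          linarith)
        (by rw [hre]; linarith)
      rw [him, h2t] at this
      refine this.trans ?_
      nlinarith
    set z := ‖riemannZeta (1 + r + Complex.I * t)‖ with hz
    have hz0 : 0 ≤ z := norm_nonneg _
    have hT0 : 0 < T := by linarith
    have h3 : 1 ≤ (C₁ / r) ^ 3 * z ^ 4 * (2 * C₂ * T) := hp.trans (by gcongr)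
    have h4 : r ^ 3 ≤ C₁ ^ 3 * (2 * C₂) * (T * z ^ 4) := by
      have : (C₁ / r) ^ 3 * z ^ 4 * (2 * C₂ * T) * r ^ 3
          = C₁ ^ 3 * (2 * C₂) * (T * z ^ 4) := by field_simp
      rw [← this]
      exact le_mul_of_one_le_left (by positivity) h3
    have h5 : (c * κ ^ 3) ^ 4 ≤ (z * T ^ 7) ^ 4 := by
      calc (c * κ ^ 3) ^ 4 = c ^ 4 * (κ ^ 4) ^ 3 := by ring
        _ ≤ c ^ 4 * (r * T ^ 9) ^ 3 := by gcongr
        _ = c ^ 4 * r ^ 3 * T ^ 27 := by ring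
        _ ≤ c ^ 4 * (C₁ ^ 3 * (2 * C₂) * (T * z ^ 4)) * T ^ 27 := by gcongr
        _ = (c ^ 4 * (C₁ ^ 3 * (2 * C₂))) * (z * T ^ 7) ^ 4 := by ring
        _ ≤ 1 * (z * T ^ 7) ^ 4 := by gcongr
        _ = _ := one_mul _
    exact le_of_pow_le_pow_left₀ (by norm_num) (by positivity) h5
  set κ : ℝ := min 1 (c / (2 * C₃)) with hκ
  have hκ0 : 0 < κ := lt_min one_pos (by positivity)
  have hκ1 : κ ≤ 1 := min_le_left _ _
  have hκc : C₃ * κ ≤ c / 2 := by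
    have : κ ≤ c / (2 * C₃) := min_le_right _ _
    calc C₃ * κ ≤ C₃ * (c / (2 * C₃)) := by gcongr
      _ = c / 2 := by field_simp
  refine ⟨c * κ ^ 3 / 2, by positivity, fun s ht hσ hσ2 => ?_⟩
  have hT2 : 2 ≤ Real.log |s.im| :=
    two_le_log_eight.trans (Real.log_le_log (by norm_num) (by linarith))
  set T := Real.log |s.im| with hT
  have hT0 : 0 < T := by linarith
  have hT1 : 1 ≤ T := by linarith
  have hcκ : 0 < c * κ ^ 3 := by positivity
  by_cases hcase : κ ^ 4 ≤ (s.re - 1) * T ^ 9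
  · have := key s.im ht (s.re - 1) κ (by linarith) (by linarith) hκ0 hcase
    have hs : (1 + (s.re - 1 : ℝ) + Complex.I * s.im : ℂ) = s := by
      push_cast
      rw [mul_comm]
      simp [Complex.re_add_im]
    rw [hs] at this
    linarith
  · push Not at hcase
    set η : ℝ := κ ^ 4 / T ^ 9 with hη
    have hη0 : 0 < η := by positivity
    have hη1 : η ≤ 1 := by
      rw [hη, div_le_one (by positivity)]
      exact (pow_le_one₀ hκ0.le hκ1).trans (one_le_pow₀ hT1)
    have hk := key s.im ht η κ hη0 hη1 hκ0 (by rw [hη, div_mul_cancel₀ _ (by positivity)])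
    have hsη : s.re - 1 < η := by rw [hη, lt_div_iff₀ (by positivity)]; exact hcase
    set w : ℂ := 1 + η + Complex.I * s.im with hw
    have hwre : w.re = 1 + η := by simp [hw]
    have hwim : w.im = s.im := by simp [hw]
    have hdiff : ‖riemannZeta w - riemannZeta s‖ ≤ C₃ * T ^ 2 * ‖w - s‖ := by
      refine Convex.norm_image_sub_le_of_norm_deriv_le (s := {z : ℂ | z.im = s.im} ∩
        {z : ℂ | 1 ≤ z.re} ∩ {z : ℂ | z.re ≤ 2}) ?_ ?_ ?_ ?_ ?_
      · rintro z ⟨⟨hz, hz1⟩, hz2⟩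
        refine differentiableAt_riemannZeta ?_
        rintro rfl
        simp only [Set.mem_ofPred_eq, Complex.one_im] at hz
        rw [← hz] at ht
        norm_num at ht
      · rintro z ⟨⟨hz, hz1⟩, hz2⟩
        simp only [Set.mem_ofPred_eq] at hz hz1 hz2
        have := h₃ z (by rw [hz]; exact ht) hz1 hz2
        rwa [iteratedDeriv_one, hz] at this
      · exact ((convex_hyperplane ⟨Complex.add_im, fun a z => by simp⟩ s.im).inter
          (convex_halfSpace_re_ge 1)).inter (convex_halfSpace_re_le 2)
      · simp [hσ2, hσ.le]
      · simp only [Set.mem_inter_iff, Set.mem_ofPred_eq, hwre, hwim]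
        refine ⟨⟨trivial, by linarith⟩, by linarith⟩
    have hws : ‖w - s‖ ≤ η := by
      have : w - s = ((1 + η - s.re : ℝ) : ℂ) := by
        apply Complex.ext <;> simp [hw]
      rw [this, Complex.norm_real, Real.norm_eq_abs, abs_le]
      constructor <;> linarith
    have hz : ‖riemannZeta w‖ ≤ ‖riemannZeta s‖ + C₃ * T ^ 2 * η := by
      have h' := norm_sub_norm_le (riemannZeta w) (riemannZeta s)
      have : C₃ * T ^ 2 * ‖w - s‖ ≤ C₃ * T ^ 2 * η := by gcongr
      linarith
    have hηT : C₃ * T ^ 2 * η * T ^ 7 ≤ c * κ ^ 3 / 2 := by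
      have : C₃ * T ^ 2 * η * T ^ 7 = C₃ * κ * κ ^ 3 := by rw [hη]; field_simp
      rw [this]
      have : C₃ * κ * κ ^ 3 ≤ c / 2 * κ ^ 3 := by gcongr
      linarith
    have : ‖riemannZeta w‖ * T ^ 7 ≤ (‖riemannZeta s‖ + C₃ * T ^ 2 * η) * T ^ 7 := by gcongr
    linarith

/-- The part of the strip `1 < Re s < 2` lying away from the pole of `ζ`. -/
def farStrip : Set ℂ := {s | 1 < s.re ∧ s.re < 2 ∧ 10 < |s.im|}

lemma isOpen_farStrip : IsOpen farStrip :=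
  (isOpen_lt continuous_const Complex.continuous_re).inter
    ((isOpen_lt Complex.continuous_re continuous_const).inter
      (isOpen_lt continuous_const (Complex.continuous_im.abs)))

lemma two_le_log_of_mem_farStrip {s : ℂ} (hs : s ∈ farStrip) : 2 ≤ Real.log |s.im| :=
  two_le_log_eight.trans (Real.log_le_log (by norm_num) (by linarith [hs.2.2]))

/-- Growth at most a power of `log |Im s|` in `farStrip`. -/
def LogPowBounded (f : ℂ → ℂ) : Prop :=
  ∃ (C : ℝ) (N : ℕ), 0 ≤ C ∧ ∀ s ∈ farStrip, ‖f s‖ ≤ C * Real.log |s.im| ^ N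

lemma LogPowBounded.add {f g : ℂ → ℂ} (hf : LogPowBounded f) (hg : LogPowBounded g) :
    LogPowBounded (fun s => f s + g s) := by
  obtain ⟨C, N, hC, h⟩ := hf
  obtain ⟨C', N', hC', h'⟩ := hg
  refine ⟨C + C', N + N', by positivity, fun s hs => ?_⟩
  have hT : 1 ≤ Real.log |s.im| := by linarith [two_le_log_of_mem_farStrip hs]
  calc ‖f s + g s‖ ≤ ‖f s‖ + ‖g s‖ := norm_add_le _ _
    _ ≤ C * Real.log |s.im| ^ N + C' * Real.log |s.im| ^ N' := add_le_add (h s hs) (h' s hs)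
    _ ≤ C * Real.log |s.im| ^ (N + N') + C' * Real.log |s.im| ^ (N + N') := by
        gcongr <;> first | exact hT | omega
    _ = _ := by ring

lemma LogPowBounded.mul {f g : ℂ → ℂ} (hf : LogPowBounded f) (hg : LogPowBounded g) :
    LogPowBounded (fun s => f s * g s) := by
  obtain ⟨C, N, hC, h⟩ := hf
  obtain ⟨C', N', hC', h'⟩ := hg
  refine ⟨C * C', N + N', by positivity, fun s hs => ?_⟩
  have hT : 0 ≤ Real.log |s.im| := by linarith [two_le_log_of_mem_farStrip hs]
  calc ‖f s * g s‖ = ‖f s‖ * ‖g s‖ := norm_mul _ _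
    _ ≤ (C * Real.log |s.im| ^ N) * (C' * Real.log |s.im| ^ N') :=
        mul_le_mul (h s hs) (h' s hs) (norm_nonneg _) (by positivity)
    _ = _ := by ring

/-- `f` and its derivatives up to order `k` grow at most like powers of `log |Im s|`. -/
def LogPowBoundedDeriv : ℕ → (ℂ → ℂ) → Prop
  | 0, f => DifferentiableOn ℂ f farStrip ∧ LogPowBounded f
  | k + 1, f => DifferentiableOn ℂ f farStrip ∧ LogPowBounded f ∧ LogPowBoundedDeriv k (deriv f)

lemma LogPowBoundedDeriv.differentiableOn {k : ℕ} {f : ℂ → ℂ} (hf : LogPowBoundedDeriv k f) :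
    DifferentiableOn ℂ f farStrip := by
  cases k <;> exact hf.1

lemma LogPowBoundedDeriv.differentiableAt {k : ℕ} {f : ℂ → ℂ} (hf : LogPowBoundedDeriv k f)
    {s : ℂ} (hs : s ∈ farStrip) : DifferentiableAt ℂ f s :=
  hf.differentiableOn.differentiableAt (isOpen_farStrip.mem_nhds hs)

lemma LogPowBoundedDeriv.of_succ {k : ℕ} {f : ℂ → ℂ} (hf : LogPowBoundedDeriv (k + 1) f) :
    LogPowBoundedDeriv k f := by
  induction k generalizing f with
  | zero => exact ⟨hf.1, hf.2.1⟩
  | succ k ih => exact ⟨hf.1, hf.2.1, ih hf.2.2⟩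

lemma LogPowBoundedDeriv.congr {k : ℕ} {f g : ℂ → ℂ} (hf : LogPowBoundedDeriv k f)
    (h : Set.EqOn f g farStrip) : LogPowBoundedDeriv k g := by
  have hb : LogPowBounded f → LogPowBounded g := fun ⟨C, N, hC, hfb⟩ =>
    ⟨C, N, hC, fun s hs => h hs ▸ hfb s hs⟩
  induction k generalizing f g with
  | zero => exact ⟨hf.1.congr fun s hs => (h hs).symm, hb hf.2⟩
  | succ k ih =>
    have h' := h.deriv isOpen_farStrip
    exact ⟨hf.1.congr fun s hs => (h hs).symm, hb hf.2.1, ih hf.2.2 h' fun ⟨C, N, hC, hfb⟩ =>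
      ⟨C, N, hC, fun s hs => h' hs ▸ hfb s hs⟩⟩

lemma LogPowBoundedDeriv.add {k : ℕ} {f g : ℂ → ℂ} (hf : LogPowBoundedDeriv k f)
    (hg : LogPowBoundedDeriv k g) : LogPowBoundedDeriv k (fun s => f s + g s) := by
  induction k generalizing f g with
  | zero => exact ⟨hf.1.fun_add hg.1, hf.2.add hg.2⟩
  | succ k ih =>
    refine ⟨hf.1.fun_add hg.1, hf.2.1.add hg.2.1, (ih hf.2.2 hg.2.2).congr fun s hs => ?_⟩
    rw [deriv_fun_add (hf.differentiableAt hs) (hg.differentiableAt hs)]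

lemma LogPowBoundedDeriv.mul {k : ℕ} {f g : ℂ → ℂ} (hf : LogPowBoundedDeriv k f)
    (hg : LogPowBoundedDeriv k g) : LogPowBoundedDeriv k (fun s => f s * g s) := by
  induction k generalizing f g with
  | zero => exact ⟨hf.1.fun_mul hg.1, hf.2.mul hg.2⟩
  | succ k ih =>
    refine ⟨hf.1.fun_mul hg.1, hf.2.1.mul hg.2.1,
      ((ih hf.2.2 hg.of_succ).add (ih hf.of_succ hg.2.2)).congr fun s hs => ?_⟩
    rw [deriv_fun_mul (hf.differentiableAt hs) (hg.differentiableAt hs)]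

lemma logPowBoundedDeriv_const (k : ℕ) (c : ℂ) : LogPowBoundedDeriv k (fun _ => c) := by
  have h : ∀ c : ℂ, LogPowBounded fun _ => c := fun c => ⟨‖c‖, 0, norm_nonneg _, by simp⟩
  induction k generalizing c with
  | zero => exact ⟨differentiableOn_const _, h c⟩
  | succ k ih => exact ⟨differentiableOn_const _, h c, by simpa using ih 0⟩

lemma LogPowBoundedDeriv.neg {k : ℕ} {f : ℂ → ℂ} (hf : LogPowBoundedDeriv k f) :
    LogPowBoundedDeriv k (fun s => -f s) :=
  ((logPowBoundedDeriv_const k (-1)).mul hf).congr fun s _ => by simp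

lemma LogPowBoundedDeriv.inv {k : ℕ} {f : ℂ → ℂ} (hf : LogPowBoundedDeriv k f)
    (h0 : ∀ s ∈ farStrip, f s ≠ 0) (hi : LogPowBounded fun s => (f s)⁻¹) :
    LogPowBoundedDeriv k (fun s => (f s)⁻¹) := by
  induction k with
  | zero => exact ⟨hf.1.fun_inv h0, hi⟩
  | succ k ih =>
    have := ih hf.of_succ
    refine ⟨hf.1.fun_inv h0, hi, ((hf.2.2.mul (this.mul this)).neg).congr fun s hs => ?_⟩
    rw [deriv_fun_inv'' (hf.differentiableAt hs) (h0 s hs)]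
    have := h0 s hs
    field_simp

lemma LogPowBoundedDeriv.iteratedDeriv {k : ℕ} {f : ℂ → ℂ} (hf : LogPowBoundedDeriv k f) :
    LogPowBounded (iteratedDeriv k f) := by
  induction k generalizing f with
  | zero => simpa using hf.2
  | succ k ih => rw [iteratedDeriv_succ']; exact ih hf.2.2

lemma ne_one_of_mem_farStrip {s : ℂ} (hs : s ∈ farStrip) : s ≠ 1 := by
  rintro rfl
  have := hs.2.2
  norm_num at this

lemma logPowBoundedDeriv_iteratedDeriv_riemannZeta (k m : ℕ) :
    LogPowBoundedDeriv k (iteratedDeriv m riemannZeta) := by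
  have hd (m : ℕ) : DifferentiableOn ℂ (iteratedDeriv m riemannZeta) farStrip := by
    have h : AnalyticOnNhd ℂ riemannZeta farStrip :=
      DifferentiableOn.analyticOnNhd (fun s hs =>
        (differentiableAt_riemannZeta (ne_one_of_mem_farStrip hs)).differentiableWithinAt)
        isOpen_farStrip
    rw [iteratedDeriv_eq_iterate]
    exact (h.iterated_deriv m).differentiableOn
  have hb (m : ℕ) : LogPowBounded (iteratedDeriv m riemannZeta) := by
    obtain ⟨C, hC, h⟩ := exists_norm_iteratedDeriv_riemannZeta_le m
    exact ⟨C, m + 1, hC.le, fun s hs => h s hs.2.2.le hs.1.le hs.2.1.le⟩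
  induction k generalizing m with
  | zero => exact ⟨hd m, hb m⟩
  | succ k ih => exact ⟨hd m, hb m, by rw [← iteratedDeriv_succ]; exact ih _⟩

lemma logPowBounded_inv_riemannZeta : LogPowBounded fun s => (riemannZeta s)⁻¹ := by
  obtain ⟨c, hc, h⟩ := exists_le_norm_riemannZeta
  refine ⟨c⁻¹, 7, by positivity, fun s hs => ?_⟩
  have h1 := h s hs.2.2.le hs.1 hs.2.1.le
  have h0 : 0 < ‖riemannZeta s‖ :=
    norm_pos_iff.mpr (riemannZeta_ne_zero_of_one_le_re hs.1.le)
  rw [norm_inv, inv_mul_eq_div, le_div_iff₀ hc, inv_mul_le_iff₀ h0]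
  exact h1

lemma logPowBoundedDeriv_logDeriv_riemannZeta (k : ℕ) :
    LogPowBoundedDeriv k fun s => -deriv riemannZeta s / riemannZeta s - riemannZeta s := by
  have h0 : LogPowBoundedDeriv k riemannZeta := by
    simpa using logPowBoundedDeriv_iteratedDeriv_riemannZeta k 0
  have h1 : LogPowBoundedDeriv k (deriv riemannZeta) := by
    simpa using logPowBoundedDeriv_iteratedDeriv_riemannZeta k 1
  refine ((h1.neg.mul (h0.inv (fun s hs => riemannZeta_ne_zero_of_one_le_re hs.1.le)
    logPowBounded_inv_riemannZeta)).add h0.neg).congr fun s _ => ?_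
  simp only [div_eq_mul_inv, sub_eq_add_neg]

lemma log_pow_le_sqrt (N : ℕ) : ∃ C : ℝ, 0 ≤ C ∧ ∀ t : ℝ, 1 ≤ t → Real.log t ^ N ≤ C * √t := by
  rcases N.eq_zero_or_pos with rfl | hN
  · exact ⟨1, zero_le_one, fun t ht => by simpa using Real.one_le_sqrt.mpr ht⟩
  refine ⟨(2 * N) ^ N, by positivity, fun t ht => ?_⟩
  have hN' : (0 : ℝ) < N := by exact_mod_cast hN
  have h := Real.log_le_rpow_div (x := t) (ε := 1 / (2 * N)) (by linarith) (by positivity)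
  have h0 := Real.log_nonneg ht
  calc Real.log t ^ N ≤ (t ^ (1 / (2 * N) : ℝ) / (1 / (2 * N))) ^ N := by gcongr
    _ = (2 * N) ^ N * (t ^ (1 / (2 * N) : ℝ)) ^ N := by
        rw [div_pow, one_div, inv_pow, div_inv_eq_mul, mul_comm]
    _ = (2 * N) ^ N * √t := by
        rw [← Real.rpow_natCast (t ^ _), ← Real.rpow_mul (by linarith), Real.sqrt_eq_rpow]
        congr 2
        field_simp

lemma riemannZeta₁_ne_zero_of_one_le_re {s : ℂ} (hs : 1 ≤ s.re) : riemannZeta₁ s ≠ 0 := by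
  by_cases h : s = 1
  · simp [h]
  · have := riemannZeta_ne_zero_of_one_le_re hs
    rw [riemannZeta_eq_inv_sub_mul h] at this
    exact right_ne_zero_of_mul this

lemma exists_norm_iteratedDeriv_logDeriv_riemannZeta_le_of_near (k : ℕ) : ∃ C : ℝ, ∀ s : ℂ,
    1 < s.re → s.re ≤ 2 → |s.im| ≤ 10 →
    ‖iteratedDeriv k (fun s => -deriv riemannZeta s / riemannZeta s - riemannZeta s) s‖ ≤ C := by
  set G : ℂ → ℂ := fun s => -deriv riemannZeta₁ s / riemannZeta₁ s - riemannZeta₀ s with hG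
  set K : Set ℂ := Set.Icc 1 2 ×ℂ Set.Icc (-10) 10 with hK
  have h0 := differentiable_riemannZeta₀
  have h1 := differentiable_riemannZeta₁
  have hGa : AnalyticOnNhd ℂ G K := fun s hs =>
    (((h1.analyticAt s).deriv.neg).div (h1.analyticAt s)
      (riemannZeta₁_ne_zero_of_one_le_re hs.1.1)).sub (h0.analyticAt s)
  have hc : ContinuousOn (fun s => ‖iteratedDeriv k G s‖) K := by
    rw [iteratedDeriv_eq_iterate]
    exact (hGa.iterated_deriv k).continuousOn.norm
  obtain ⟨C, hC⟩ := (isCompact_Icc.reProdIm isCompact_Icc).bddAbove_image hc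
  refine ⟨C, fun s hs hs2 ht => ?_⟩
  have hev : (fun s => -deriv riemannZeta s / riemannZeta s - riemannZeta s) =ᶠ[nhds s] G := by
    filter_upwards [(isOpen_lt continuous_const Complex.continuous_re).mem_nhds hs] with z hz
    have hz1 : z ≠ 1 := by rintro rfl; simp at hz
    have hz0 := riemannZeta₁_ne_zero_of_one_le_re (le_of_lt hz)
    have hz' := sub_ne_zero_of_ne hz1
    rw [deriv_riemannZeta_eq_neg_inv_sub_sq_mul_add hz1, hG]
    nth_rw 2 [riemannZeta_eq_inv_sub_add hz1]
    rw [riemannZeta_eq_inv_sub_mul hz1]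
    field_simp
    ring
  rw [hev.iteratedDeriv_eq k]
  exact hC ⟨s, ⟨⟨hs.le, hs2⟩, abs_le.mp ht⟩, rfl⟩

lemma exists_norm_iteratedDeriv_logDeriv_riemannZeta_le (k : ℕ) : ∃ C : ℝ, 0 ≤ C ∧ ∀ s : ℂ,
    1 < s.re → s.re < 2 →
    ‖iteratedDeriv k (fun s => -deriv riemannZeta s / riemannZeta s - riemannZeta s) s‖
      ≤ C * √(1 + |s.im|) := by
  obtain ⟨C₁, h₁⟩ := exists_norm_iteratedDeriv_logDeriv_riemannZeta_le_of_near k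
  obtain ⟨C₂, N, hC₂, h₂⟩ := (logPowBoundedDeriv_logDeriv_riemannZeta k).iteratedDeriv
  obtain ⟨C₃, hC₃, h₃⟩ := log_pow_le_sqrt N
  refine ⟨|C₁| + C₂ * C₃, by positivity, fun s hs hs2 => ?_⟩
  have hsq : 1 ≤ √(1 + |s.im|) := Real.one_le_sqrt.mpr (by linarith [abs_nonneg s.im])
  rcases le_or_gt |s.im| 10 with ht | ht
  · refine ((h₁ s hs hs2.le ht).trans (le_abs_self _)).trans ?_
    have : 0 ≤ C₂ * C₃ * √(1 + |s.im|) := by positivity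
    nlinarith [abs_nonneg C₁]
  · have h4 : √|s.im| ≤ √(1 + |s.im|) := Real.sqrt_le_sqrt (by linarith)
    calc _ ≤ C₂ * Real.log |s.im| ^ N := h₂ s ⟨hs, hs2, ht⟩
      _ ≤ C₂ * (C₃ * √|s.im|) := by gcongr; exact h₃ _ (by linarith)
      _ ≤ C₂ * (C₃ * √(1 + |s.im|)) := by gcongr
      _ = C₂ * C₃ * √(1 + |s.im|) := by ring
      _ ≤ _ := by gcongr; linarith [abs_nonneg C₁]

/-- The coefficients of `-ζ'/ζ - ζ`. -/
noncomputable def vonMangoldtSubOne : ℕ → ℂ :=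
  (fun n => (ArithmeticFunction.vonMangoldt n : ℂ)) - 1

lemma LSeriesSummable_vonMangoldtSubOne {s : ℂ} (hs : 1 < s.re) :
    LSeriesSummable vonMangoldtSubOne s :=
  (ArithmeticFunction.LSeriesSummable_vonMangoldt hs).sub (LSeriesSummable_one_iff.mpr hs)

lemma abscissaOfAbsConv_vonMangoldtSubOne_lt {s : ℂ} (hs : 1 < s.re) :
    LSeries.abscissaOfAbsConv vonMangoldtSubOne < s.re :=
  (LSeries.abscissaOfAbsConv_le_of_forall_lt_LSeriesSummable (x := 1) fun y hy =>
    LSeriesSummable_vonMangoldtSubOne (by simpa using hy)).trans_lt (by exact_mod_cast hs)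

lemma LSeries_vonMangoldtSubOne {s : ℂ} (hs : 1 < s.re) :
    LSeries vonMangoldtSubOne s = -deriv riemannZeta s / riemannZeta s - riemannZeta s := by
  rw [vonMangoldtSubOne, LSeries_sub (ArithmeticFunction.LSeriesSummable_vonMangoldt hs)
    (LSeriesSummable_one_iff.mpr hs), LSeries_one_eq_riemannZeta hs,
    ArithmeticFunction.LSeries_vonMangoldt_eq_deriv_riemannZeta_div hs]

lemma exists_norm_LSeries_logMul_vonMangoldtSubOne_le (k : ℕ) : ∃ C : ℝ, 0 ≤ C ∧ ∀ s : ℂ,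
    1 < s.re → s.re < 2 →
    ‖LSeries (LSeries.logMul^[k] vonMangoldtSubOne) s‖ ≤ C * √(1 + |s.im|) := by
  obtain ⟨C, hC, h⟩ := exists_norm_iteratedDeriv_logDeriv_riemannZeta_le k
  refine ⟨C, hC, fun s hs hs2 => ?_⟩
  have hev : LSeries vonMangoldtSubOne =ᶠ[nhds s]
      fun s => -deriv riemannZeta s / riemannZeta s - riemannZeta s := by
    filter_upwards [(isOpen_lt continuous_const Complex.continuous_re).mem_nhds hs] with z hz
    exact LSeries_vonMangoldtSubOne hz
  have h1 := LSeries_iteratedDeriv k (abscissaOfAbsConv_vonMangoldtSubOne_lt hs)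
  have h2 := h s hs hs2
  rw [← hev.iteratedDeriv_eq k, h1] at h2
  simpa using h2

/-- The Cesàro weight `u ↦ max (1 - u) 0` on the positive reals. -/
noncomputable def cesaroWeight (u : ℝ) : ℂ :=
  (Set.Ioc (0 : ℝ) 1).indicator (fun _ => (1 : ℂ)) u
    - (Set.Ioc (0 : ℝ) 1).indicator (fun t => (t : ℂ) ^ (1 : ℂ)) u

lemma cesaroWeight_of_pos {u : ℝ} (hu : 0 < u) : cesaroWeight u = ((max (1 - u) 0 : ℝ) : ℂ) := by
  by_cases h : u ≤ 1
  · have : u ∈ Set.Ioc (0 : ℝ) 1 := ⟨hu, h⟩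
    rw [cesaroWeight, Set.indicator_of_mem this, Set.indicator_of_mem this,
      max_eq_left (by linarith)]
    simp
  · have : u ∉ Set.Ioc (0 : ℝ) 1 := fun h' => h h'.2
    rw [cesaroWeight, Set.indicator_of_notMem this, Set.indicator_of_notMem this,
      max_eq_right (by linarith)]
    simp

lemma continuousAt_cesaroWeight {u : ℝ} (hu : 0 < u) : ContinuousAt cesaroWeight u := by
  have hc : ContinuousAt (fun u : ℝ => ((max (1 - u) 0 : ℝ) : ℂ)) u := by fun_prop
  refine hc.congr ?_
  filter_upwards [lt_mem_nhds hu] with v hv using (cesaroWeight_of_pos hv).symm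

lemma hasMellin_cesaroWeight {s : ℂ} (hs : 0 < s.re) :
    HasMellin cesaroWeight s (1 / s - 1 / (s + 1)) := by
  have h1 := hasMellin_one_Ioc hs
  have h2 := hasMellin_cpow_Ioc 1 (s := s) (by simp; linarith)
  have := hasMellin_sub h1.1 h2.1
  rw [h1.2, h2.2] at this
  exact this

/-- The Mellin transform of `cesaroWeight` on the line `Re s = σ`. -/
noncomputable def cesaroKernel (σ y : ℝ) : ℂ :=
  1 / (σ + y * Complex.I) - 1 / (σ + y * Complex.I + 1)

lemma sqrt_mul_norm_cesaroKernel_le {σ : ℝ} (hσ : 1 ≤ σ) (y : ℝ) :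
    √(1 + |y|) * ‖cesaroKernel σ y‖ ≤ 2 * (1 + ‖y‖) ^ (-(3 / 2) : ℝ) := by
  have hn1 : ‖(σ + y * Complex.I : ℂ)‖ ^ 2 = σ ^ 2 + y ^ 2 := by
    rw [← Complex.normSq_eq_norm_sq, Complex.normSq_add_mul_I]
  have hn2 : ‖(σ + y * Complex.I + 1 : ℂ)‖ ^ 2 = (σ + 1) ^ 2 + y ^ 2 := by
    rw [← Complex.normSq_eq_norm_sq, show (σ + y * Complex.I + 1 : ℂ)
      = ((σ + 1 : ℝ) : ℂ) + y * Complex.I by push_cast; ring, Complex.normSq_add_mul_I]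
  set a := ‖(σ + y * Complex.I : ℂ)‖ with ha
  set b := ‖(σ + y * Complex.I + 1 : ℂ)‖ with hb
  have ha0 : 0 ≤ a := norm_nonneg _
  have hb0 : 0 ≤ b := norm_nonneg _
  have hab : a ≤ b := by
    refine le_of_pow_le_pow_left₀ two_ne_zero hb0 ?_
    nlinarith
  have haa : 0 < a := by nlinarith [sq_nonneg y]
  have hlow : 1 + y ^ 2 ≤ a * b := by nlinarith
  have hs1 : (σ + y * Complex.I : ℂ) ≠ 0 := norm_pos_iff.mp haa
  have hs2 : (σ + y * Complex.I + 1 : ℂ) ≠ 0 := norm_pos_iff.mp (haa.trans_le hab)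
  have hK : ‖cesaroKernel σ y‖ = 1 / (a * b) := by
    rw [cesaroKernel, div_sub_div _ _ hs1 hs2, norm_div, norm_mul]
    congr 1
    simp
  have hy : (1 + |y|) ^ 2 ≤ 2 * (a * b) := by
    nlinarith [sq_abs y, sq_nonneg (|y| - 1)]
  have hpos : 0 < 1 + |y| := by positivity
  rw [hK, Real.norm_eq_abs, Real.sqrt_eq_rpow, Real.rpow_neg hpos.le, mul_one_div,
    div_le_iff₀ (by positivity), mul_assoc, ← div_eq_inv_mul, ← mul_div_assoc,
    le_div_iff₀ (by positivity), ← Real.rpow_add hpos]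
  norm_num
  exact hy

lemma continuous_cesaroKernel {σ : ℝ} (hσ : 1 ≤ σ) : Continuous (cesaroKernel σ) := by
  have h1 : ∀ y : ℝ, (σ + y * Complex.I : ℂ) ≠ 0 := fun y h => by
    have := congrArg Complex.re h
    simp at this
    linarith
  have h2 : ∀ y : ℝ, (σ + y * Complex.I + 1 : ℂ) ≠ 0 := fun y h => by
    have := congrArg Complex.re h
    simp at this
    linarith
  unfold cesaroKernel
  exact (continuous_const.div (by fun_prop) h1).sub (continuous_const.div (by fun_prop) h2)

lemma integrable_one_add_norm_rpow :
    MeasureTheory.Integrable (fun y : ℝ => (1 + ‖y‖) ^ (-(3 / 2) : ℝ)) :=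
  integrable_one_add_norm (by norm_num)

lemma integrable_cesaroKernel {σ : ℝ} (hσ : 1 ≤ σ) :
    MeasureTheory.Integrable (cesaroKernel σ) := by
  refine (integrable_one_add_norm_rpow.const_mul 2).mono'
    (continuous_cesaroKernel hσ).aestronglyMeasurable (.of_forall fun y => ?_)
  refine le_trans ?_ (sqrt_mul_norm_cesaroKernel_le hσ y)
  exact le_mul_of_one_le_left (norm_nonneg _) (Real.one_le_sqrt.mpr (by linarith [abs_nonneg y]))

lemma integral_cpow_mul_cesaroKernel {σ u : ℝ} (hσ : 1 ≤ σ) (hu : 0 < u) :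
    ∫ y : ℝ, (u : ℂ) ^ (-(σ + y * Complex.I)) * cesaroKernel σ y
      = 2 * Real.pi * cesaroWeight u := by
  have hre : ∀ y : ℝ, 0 < (σ + y * Complex.I : ℂ).re := fun y => by simp; linarith
  have hm : ∀ y : ℝ, mellin cesaroWeight (σ + y * Complex.I) = cesaroKernel σ y := fun y =>
    (hasMellin_cesaroWeight (hre y)).2
  have h := mellinInv_mellin_eq σ cesaroWeight hu
    (by simpa using (hasMellin_cesaroWeight (hre 0)).1)
    (by
      unfold Complex.VerticalIntegrable
      simp only [hm]
      exact integrable_cesaroKernel hσ) (continuousAt_cesaroWeight hu)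
  rw [mellinInv] at h
  simp only [hm, smul_eq_mul] at h
  rw [← h, Complex.real_smul]
  push_cast
  have hpi : (2 * Real.pi : ℂ) ≠ 0 := by exact_mod_cast Real.two_pi_pos.ne'
  rw [← mul_assoc, mul_one_div_cancel hpi, one_mul]

/-- A quantitative Perron formula with Cesàro weights. -/
lemma exists_norm_sum_cesaro_le {a : ℕ → ℂ} {C : ℝ} (hC : 0 ≤ C)
    (hsum : ∀ s : ℂ, 1 < s.re → LSeriesSummable a s)
    (hb : ∀ s : ℂ, 1 < s.re → s.re < 2 → ‖LSeries a s‖ ≤ C * √(1 + |s.im|)) :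
    ∃ C' : ℝ, 0 ≤ C' ∧ ∀ N : ℕ, 3 ≤ N →
      ‖∑ n ∈ Finset.Ico 1 N, a n * (1 - n / N)‖ ≤ C' * N := by
  set J : ℝ := ∫ y : ℝ, (1 + ‖y‖) ^ (-(3 / 2) : ℝ) with hJ
  have hJ0 : 0 ≤ J := MeasureTheory.integral_nonneg fun y => by positivity
  refine ⟨C * Real.exp 1 * (2 * J), by positivity, fun N hN => ?_⟩
  have hN0 : (0 : ℝ) < N := by positivity
  have hlog : 1 < Real.log N := by
    rw [Real.lt_log_iff_exp_lt hN0]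
    have : (3 : ℝ) ≤ N := by exact_mod_cast hN
    linarith [Real.exp_one_lt_d9]
  set σ : ℝ := 1 + 1 / Real.log N with hσ
  have hσ1 : 1 < σ := by rw [hσ]; have : 0 < 1 / Real.log N := by positivity
                         linarith
  have hσ2 : σ < 2 := by
    have : 1 / Real.log N < 1 := by rw [div_lt_one (by linarith)]; exact hlog
    linarith
  have hNσ : (N : ℝ) ^ σ = N * Real.exp 1 := by
    rw [hσ, Real.rpow_add hN0, Real.rpow_one, Real.rpow_def_of_pos hN0,
      mul_one_div_cancel (by linarith)]
  set F : ℕ → ℝ → ℂ := fun n y =>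
    LSeries.term a (σ + y * Complex.I) n * ((N : ℂ) ^ (σ + y * Complex.I) * cesaroKernel σ y)
    with hF
  have hre : ∀ y : ℝ, (σ + y * Complex.I : ℂ).re = σ := fun y => by simp
  have hNn : ∀ y : ℝ, ‖(N : ℂ) ^ (σ + y * Complex.I : ℂ)‖ = N * Real.exp 1 := fun y => by
    rw [Complex.norm_natCast_cpow_of_pos (by omega), hre, hNσ]
  have hterm : ∀ (n : ℕ) (y : ℝ), ‖LSeries.term a (σ + y * Complex.I) n‖ = ‖LSeries.term a σ n‖ :=
    fun n y => by rw [LSeries.norm_term_eq, LSeries.norm_term_eq, hre]; simp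
  have hFn : ∀ n y, ‖F n y‖ = ‖LSeries.term a σ n‖ * (N * Real.exp 1) * ‖cesaroKernel σ y‖ :=
    fun n y => by simp only [hF, norm_mul, hterm, hNn]; ring
  have hline : Continuous fun y : ℝ => (σ + y * Complex.I : ℂ) := by fun_prop
  have hcN : ∀ n : ℕ, n ≠ 0 → Continuous fun y : ℝ => (n : ℂ) ^ (σ + y * Complex.I : ℂ) :=
    fun n hn => hline.const_cpow (.inl (by exact_mod_cast hn))
  have hFc : ∀ n, Continuous (F n) := by
    intro n
    refine Continuous.mul ?_ ((hcN N (by omega)).mul (continuous_cesaroKernel hσ1.le))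
    rcases eq_or_ne n 0 with rfl | hn
    · simpa using continuous_const
    · simp only [LSeries.term_of_ne_zero hn]
      refine continuous_const.div (hcN n hn) fun y => ?_
      rw [Complex.cpow_ne_zero_iff]
      exact .inl (by exact_mod_cast hn)
  have hFi : ∀ n, MeasureTheory.Integrable (F n) := fun n =>
    ((integrable_cesaroKernel hσ1.le).norm.const_mul
      (‖LSeries.term a σ n‖ * (N * Real.exp 1))).mono' (hFc n).aestronglyMeasurable
      (.of_forall fun y => (hFn n y).le)
  have hsm : Summable fun n => ‖LSeries.term a σ n‖ := (hsum σ (by simpa using hσ1)).norm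
  have hHS := MeasureTheory.hasSum_integral_of_summable_integral_norm hFi (by
    simp only [hFn, MeasureTheory.integral_const_mul]
    exact (hsm.mul_right _).mul_right _)
  have hval : ∀ n, ∫ y, F n y = if n ∈ Finset.Ico 1 N then
      2 * Real.pi * (a n * (1 - n / N)) else 0 := by
    intro n
    rcases eq_or_ne n 0 with rfl | hn
    · simp [hF]
    have hn0 : (0 : ℝ) < n := by positivity
    have h1 : ∀ y : ℝ, F n y
        = a n * ((((n : ℝ) / N : ℝ) : ℂ) ^ (-(σ + y * Complex.I)) * cesaroKernel σ y) := by
      intro y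
      have : (((n : ℝ) / N : ℝ) : ℂ) ^ (-(σ + y * Complex.I))
          = (N : ℂ) ^ (σ + y * Complex.I) / (n : ℂ) ^ (σ + y * Complex.I) := by
        rw [div_eq_mul_inv, Complex.ofReal_mul, Complex.mul_cpow_ofReal_nonneg hn0.le
          (by positivity), Complex.ofReal_inv, Complex.inv_cpow _ _ (by
            rw [Complex.arg_ofReal_of_nonneg hN0.le]; exact Real.pi_pos.ne),
          Complex.cpow_neg, Complex.cpow_neg, inv_inv]
        simp only [Complex.ofReal_natCast]
        rw [div_eq_mul_inv, mul_comm]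
      simp only [hF, LSeries.term_of_ne_zero hn]
      rw [this]
      ring
    simp only [h1, MeasureTheory.integral_const_mul]
    rw [integral_cpow_mul_cesaroKernel hσ1.le (by positivity), cesaroWeight_of_pos (by positivity)]
    split_ifs with hmem
    · have : (n : ℝ) / N ≤ 1 := by
        rw [div_le_one hN0]; exact_mod_cast (Finset.mem_Ico.mp hmem).2.le
      rw [max_eq_left (by linarith)]
      push_cast
      ring
    · have : 1 ≤ (n : ℝ) / N := by
        rw [le_div_iff₀ hN0, one_mul]
        have : N ≤ n := by
          by_contra h
          exact hmem (Finset.mem_Ico.mpr ⟨by omega, by omega⟩)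
        exact_mod_cast this
      rw [max_eq_right (by linarith)]
      simp
  have hsumeq : ∫ y, ∑' n, F n y
      = 2 * Real.pi * ∑ n ∈ Finset.Ico 1 N, a n * (1 - n / N) := by
    rw [← hHS.tsum_eq]
    simp only [hval]
    rw [tsum_eq_sum (s := Finset.Ico 1 N) (fun n hn => if_neg hn), Finset.mul_sum]
    exact Finset.sum_congr rfl fun n hn => if_pos hn
  have hbound : ‖∫ y, ∑' n, F n y‖ ≤ C * Real.exp 1 * (2 * J) * N := by
    have : ∀ y, ‖∑' n, F n y‖ ≤ C * Real.exp 1 * N * (2 * (1 + ‖y‖) ^ (-(3 / 2) : ℝ)) := by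
      intro y
      simp only [hF]
      rw [tsum_mul_right, norm_mul, norm_mul, hNn]
      have h1 := hb (σ + y * Complex.I) (by rw [hre]; exact hσ1) (by rw [hre]; exact hσ2)
      have him : (σ + y * Complex.I : ℂ).im = y := by simp
      rw [him, LSeries] at h1
      calc _ ≤ C * √(1 + |y|) * (N * Real.exp 1 * ‖cesaroKernel σ y‖) := by gcongr
        _ = C * Real.exp 1 * N * (√(1 + |y|) * ‖cesaroKernel σ y‖) := by ring
        _ ≤ _ := mul_le_mul_of_nonneg_left (sqrt_mul_norm_cesaroKernel_le hσ1.le y)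
            (by positivity)
    refine (MeasureTheory.norm_integral_le_of_norm_le
      ((integrable_one_add_norm_rpow.const_mul 2).const_mul (C * Real.exp 1 * N))
      (.of_forall this)).trans (le_of_eq ?_)
    rw [MeasureTheory.integral_const_mul, MeasureTheory.integral_const_mul, ← hJ]
    ring
  rw [hsumeq, norm_mul] at hbound
  have h2π : 1 ≤ ‖(2 * Real.pi : ℂ)‖ := by
    rw [norm_mul, Complex.norm_real, Real.norm_eq_abs, abs_of_pos Real.pi_pos]
    norm_num
    linarith [Real.pi_gt_three]
  exact (le_mul_of_one_le_left (norm_nonneg _) h2π).trans hbound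

/-- If the twice-summed sequence is `O(N ^ 2)` and the terms are bounded below, then the
partial sums are controlled. -/
lemma abs_sum_Ico_le_of_abs_sum_cesaro_le {r : ℕ → ℝ} {C g : ℝ} {N H : ℕ}
    (hS : ∀ n, 3 ≤ n → |∑ i ∈ Finset.Ico 1 n, r i * ((n : ℝ) - i)| ≤ C * (n : ℝ) ^ 2)
    (hN : 6 ≤ N) (hH : 2 * H ≤ N) (hC : 0 ≤ C) (hg : 0 ≤ g) (hr : ∀ i < 2 * N, -g ≤ r i) :
    H * |∑ i ∈ Finset.Ico 1 N, r i| ≤ 5 * C * (N : ℝ) ^ 2 + (H : ℝ) ^ 2 * g := by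
  set S : ℕ → ℝ := fun n => ∑ i ∈ Finset.Ico 1 n, r i * ((n : ℝ) - i) with hSdef
  set T : ℕ → ℝ := fun n => ∑ i ∈ Finset.Ico 1 n, r i with hTdef
  have hT : ∀ n, 1 ≤ n → T (n + 1) = T n + r n := fun n hn => by
    simp only [hTdef]; rw [Finset.sum_Ico_succ_top hn]
  have hstep : ∀ n, 1 ≤ n → S (n + 1) = S n + T (n + 1) := by
    intro n hn
    simp only [hSdef, hTdef]
    rw [Finset.sum_Ico_succ_top hn, Finset.sum_Ico_succ_top hn, ← add_assoc,
      ← Finset.sum_add_distrib]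
    congr 1
    · refine Finset.sum_congr rfl fun i _ => ?_
      push_cast; ring
    · push_cast; ring
  have hmono : ∀ n j, 1 ≤ n → n + j ≤ 2 * N → T n - j * g ≤ T (n + j) := by
    intro n j hn hj
    induction j with
    | zero => simp
    | succ j ih =>
      have h1 := ih (by omega)
      have h2 := hr (n + j) (by omega)
      rw [← add_assoc, hT _ (by omega)]
      push_cast
      linarith
  have hup : ∀ j, j ≤ H → S N + j * (T N - H * g) ≤ S (N + j) := by
    intro j hj
    induction j with
    | zero => simp
    | succ j ih =>
      have h1 := ih (by omega)
      have h2 := hmono N (j + 1) (by omega) (by omega)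
      have h3 : ((j + 1 : ℕ) : ℝ) * g ≤ H * g := by gcongr
      rw [← add_assoc, hstep _ (by omega)]
      rw [← add_assoc] at h2
      push_cast at *
      linarith
  have hdown : ∀ j, j ≤ H → S (N - H + j) ≤ S (N - H) + j * (T N + H * g) := by
    intro j hj
    induction j with
    | zero => simp
    | succ j ih =>
      have h1 := ih (by omega)
      have h2 := hmono (N - H + (j + 1)) (H - (j + 1)) (by omega) (by omega)
      rw [show N - H + (j + 1) + (H - (j + 1)) = N by omega] at h2
      have h3 : ((H - (j + 1) : ℕ) : ℝ) * g ≤ H * g := by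
        gcongr; omega
      rw [← add_assoc, hstep _ (by omega)]
      rw [← add_assoc] at h2
      push_cast at *
      linarith
  have hu := hup H le_rfl
  have hd := hdown H le_rfl
  rw [show N - H + H = N by omega] at hd
  have a1 := abs_le.mp (hS N (by omega))
  have a2 := abs_le.mp (hS (N + H) (by omega))
  have a3 := abs_le.mp (hS (N - H) (by omega))
  have b2 : C * ((N + H : ℕ) : ℝ) ^ 2 ≤ 4 * (C * (N : ℝ) ^ 2) := by
    have : ((N + H : ℕ) : ℝ) ≤ 2 * N := by exact_mod_cast (by omega : N + H ≤ 2 * N)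
    have : C * ((N + H : ℕ) : ℝ) ^ 2 ≤ C * (2 * N) ^ 2 := by gcongr
    linarith
  have b3 : C * ((N - H : ℕ) : ℝ) ^ 2 ≤ C * (N : ℝ) ^ 2 := by
    have : ((N - H : ℕ) : ℝ) ≤ N := by exact_mod_cast (by omega : N - H ≤ N)
    gcongr
  have hCN : 0 ≤ C * (N : ℝ) ^ 2 := by positivity
  rw [← Nat.abs_cast H, ← abs_mul, abs_le, Nat.abs_cast]
  simp only [hSdef, hTdef] at *
  constructor <;> nlinarith

lemma iterate_logMul (f : ℕ → ℂ) (k n : ℕ) :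
    LSeries.logMul^[k] f n = (Real.log n : ℂ) ^ k * f n := by
  induction k with
  | zero => simp
  | succ k ih =>
    rw [Function.iterate_succ_apply', LSeries.logMul, ih, pow_succ, Complex.natCast_log]
    ring

/-- The summatory function of `(Λ n - 1) (log n) ^ k`. -/
noncomputable def logWeightedError (k N : ℕ) : ℝ :=
  ∑ n ∈ Finset.Ico 1 N, (ArithmeticFunction.vonMangoldt n - 1) * Real.log n ^ k

lemma exists_abs_sum_cesaro_vonMangoldt_le (k : ℕ) : ∃ C : ℝ, 0 ≤ C ∧ ∀ N : ℕ, 3 ≤ N →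
    |∑ n ∈ Finset.Ico 1 N, (ArithmeticFunction.vonMangoldt n - 1) * Real.log n ^ k * ((N : ℝ) - n)|
      ≤ C * (N : ℝ) ^ 2 := by
  obtain ⟨C, hC, h⟩ := exists_norm_LSeries_logMul_vonMangoldtSubOne_le k
  obtain ⟨C', hC', h'⟩ := exists_norm_sum_cesaro_le hC (fun s hs =>
    LSeriesSummable_of_abscissaOfAbsConv_lt_re (by
      rw [LSeries.absicssaOfAbsConv_logPowMul]
      exact abscissaOfAbsConv_vonMangoldtSubOne_lt hs)) h
  refine ⟨C', hC', fun N hN => ?_⟩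
  have hN0 : (0 : ℝ) < N := by positivity
  have heq : ∑ n ∈ Finset.Ico 1 N, LSeries.logMul^[k] vonMangoldtSubOne n * (1 - n / N)
      = (((∑ n ∈ Finset.Ico 1 N, (ArithmeticFunction.vonMangoldt n - 1) * Real.log n ^ k *
        ((N : ℝ) - n)) / N : ℝ) : ℂ) := by
    rw [Finset.sum_div, Complex.ofReal_sum]
    refine Finset.sum_congr rfl fun n _ => ?_
    have : (N : ℂ) ≠ 0 := by exact_mod_cast hN0.ne'
    rw [iterate_logMul, vonMangoldtSubOne]
    push_cast
    simp only [Pi.sub_apply, Pi.one_apply]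
    field_simp
  have := h' N hN
  rw [heq, Complex.norm_real, Real.norm_eq_abs, abs_div, Nat.abs_cast, div_le_iff₀ hN0] at this
  linarith

lemma exists_abs_logWeightedError_le (K : ℕ) (hK : 2 ≤ K) : ∃ C : ℝ, 0 ≤ C ∧ ∀ N : ℕ, 6 ≤ N →
    |logWeightedError (2 * K) N| ≤ C * N * Real.log N ^ K := by
  obtain ⟨C, hC, h⟩ := exists_abs_sum_cesaro_vonMangoldt_le (2 * K)
  obtain ⟨c, hc, h'⟩ := log_pow_le_sqrt K
  refine ⟨5 * C + 2 ^ (2 * K) * (1 + c), by positivity, fun N hN => ?_⟩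
  have hN6 : (6 : ℝ) ≤ N := by exact_mod_cast hN
  have hlog : 1.75 ≤ Real.log N := by
    rw [Real.le_log_iff_exp_le (by linarith)]
    have h1 : Real.exp 1.75 ^ 4 = Real.exp 1 ^ 7 := by
      rw [← Real.exp_nat_mul, ← Real.exp_nat_mul]; norm_num
    have h2 : Real.exp 1 ^ 7 ≤ (6 : ℝ) ^ 4 :=
      (pow_le_pow_left₀ (Real.exp_pos 1).le Real.exp_one_lt_d9.le 7).trans (by norm_num)
    have h3 : Real.exp 1.75 ≤ 6 :=
      le_of_pow_le_pow_left₀ (n := 4) (by norm_num) (by norm_num) (h1 ▸ h2)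
    linarith
  set T := Real.log N with hT
  have hT3 : 3 ≤ T ^ K := by
    calc (3 : ℝ) ≤ T ^ 2 := by nlinarith
      _ ≤ T ^ K := pow_le_pow_right₀ (by linarith) hK
  have hT0 : 0 < T := by linarith
  set H : ℕ := ⌈(N : ℝ) / T ^ K⌉₊ with hH
  have hH1 : (N : ℝ) / T ^ K ≤ H := Nat.le_ceil _
  have hH2 : (H : ℝ) < N / T ^ K + 1 := Nat.ceil_lt_add_one (by positivity)
  have hH3 : (N : ℝ) / T ^ K ≤ N / 3 := by gcongr
  have hHN : 2 * H ≤ N := by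
    have : (H : ℝ) < N / 3 + 1 := by linarith
    have h3 : (3 * H : ℝ) < N + 3 := by linarith
    have h4 : 3 * H < N + 3 := by exact_mod_cast h3
    omega
  have hH0 : 0 < (H : ℝ) := lt_of_lt_of_le (by positivity) hH1
  have hr : ∀ i < 2 * N, -(2 ^ (2 * K) * T ^ (2 * K))
      ≤ (ArithmeticFunction.vonMangoldt i - 1) * Real.log i ^ (2 * K) := by
    intro i hi
    have h0 : 0 ≤ Real.log i := Real.log_natCast_nonneg i
    have h1 : Real.log i ≤ 2 * T := by
      rcases i.eq_zero_or_pos with rfl | hi0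
      · simp; linarith
      rw [hT, show 2 * Real.log N = Real.log ((N : ℝ) ^ 2) by rw [Real.log_pow]; norm_num]
      refine Real.log_le_log (by exact_mod_cast hi0) ?_
      have : (i : ℝ) ≤ 2 * N := by exact_mod_cast hi.le
      nlinarith
    have h2 : Real.log i ^ (2 * K) ≤ (2 * T) ^ (2 * K) := by gcongr
    rw [mul_pow] at h2
    have h3 : 0 ≤ ArithmeticFunction.vonMangoldt i := ArithmeticFunction.vonMangoldt_nonneg
    have h4 : 0 ≤ Real.log i ^ (2 * K) := by positivity
    nlinarith
  have key := abs_sum_Ico_le_of_abs_sum_cesaro_le h hN hHN hC (by positivity) hr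
  have hTK : T ^ K ≤ c * N := by
    refine (h' N (by linarith)).trans ?_
    gcongr
    rw [Real.sqrt_le_left (by linarith)]
    nlinarith
  have h1 : (N : ℝ) ^ 2 ≤ H * (N * T ^ K) := by
    have : (N : ℝ) ≤ H * T ^ K := by rwa [div_le_iff₀ (by positivity)] at hH1
    nlinarith
  have h2 : (H : ℝ) * T ^ (2 * K) ≤ (1 + c) * (N * T ^ K) := by
    have e : T ^ (2 * K) = T ^ K * T ^ K := by rw [← pow_add]; congr 1; ring
    have : (H : ℝ) * T ^ K ≤ N + T ^ K := by
      have := mul_le_mul_of_nonneg_right hH2.le (by positivity : 0 ≤ T ^ K)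
      rwa [add_mul, div_mul_cancel₀ _ (by positivity), one_mul] at this
    rw [e, ← mul_assoc]
    have h3 : (H : ℝ) * T ^ K ≤ (1 + c) * N := by linarith
    calc (H : ℝ) * T ^ K * T ^ K ≤ (1 + c) * N * T ^ K := by gcongr
      _ = _ := by ring
  have h5 : (H : ℝ) * |logWeightedError (2 * K) N|
      ≤ H * ((5 * C + 2 ^ (2 * K) * (1 + c)) * N * T ^ K) := by
    have e1 : 5 * C * (N : ℝ) ^ 2 ≤ 5 * C * (H * (N * T ^ K)) := by gcongr
    have e2 : (H : ℝ) ^ 2 * (2 ^ (2 * K) * T ^ (2 * K))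
        ≤ H * 2 ^ (2 * K) * ((1 + c) * (N * T ^ K)) := by
      calc _ = H * 2 ^ (2 * K) * (H * T ^ (2 * K)) := by ring
        _ ≤ _ := by gcongr
    unfold logWeightedError
    linarith
  exact le_of_mul_le_mul_left h5 hH0

/-- The primes in the interval `(u, v]`. -/
noncomputable def primesIoc (u v : ℝ) : Finset ℕ :=
  (Finset.Ioc ⌊u⌋₊ ⌊v⌋₊).filter Nat.Prime

lemma mem_primesIoc {u v : ℝ} (hu : 0 ≤ u) (hv : 0 ≤ v) {p : ℕ} :
    p ∈ primesIoc u v ↔ p.Prime ∧ u < p ∧ (p : ℝ) ≤ v := by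
  rw [primesIoc, Finset.mem_filter, Finset.mem_Ioc, Nat.floor_lt hu, Nat.le_floor_iff hv]
  tauto

lemma one_add_pow_le_of_le_one {z : ℝ} (hz : 0 ≤ z) (hz1 : z ≤ 1) (n : ℕ) :
    (1 + z) ^ n ≤ 1 + 2 ^ n * z := by
  have : (1 + z) ^ n ≤ 1 + (2 ^ n - 1) * z := by
    induction n with
    | zero => simp
    | succ n ih =>
      have h2 : (1 : ℝ) ≤ 2 ^ n := one_le_pow₀ (by norm_num)
      rw [pow_succ]
      calc (1 + z) ^ n * (1 + z) ≤ (1 + (2 ^ n - 1) * z) * (1 + z) := by gcongr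
        _ = 1 + 2 ^ n * z + (2 ^ n - 1) * z * z := by ring
        _ ≤ 1 + 2 ^ n * z + (2 ^ n - 1) * z * 1 := by
            have : 0 ≤ (2 ^ n - 1) * z := mul_nonneg (by linarith) hz
            gcongr
        _ = _ := by ring
  linarith

/-- An upper bound for the number of primes in a short interval, with an error term saving an
arbitrary power of the logarithm. -/
lemma exists_card_primesIoc_mul_log_le (K : ℕ) (hK : 2 ≤ K) : ∃ C : ℝ, 0 < C ∧ ∀ u v : ℝ,
    6 ≤ u → u ≤ v → v ≤ 2 * u → ((primesIoc u v).card : ℝ) * Real.log u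
      ≤ (v - u) * (1 + C * ((v - u) / u)) + C * (u / Real.log u ^ K) := by
  obtain ⟨C, hC, h⟩ := exists_abs_logWeightedError_le K hK
  obtain ⟨c, hc, h'⟩ := log_pow_le_sqrt K
  refine ⟨2 ^ (2 * K) + ((1 + 2 ^ (2 * K)) * c + 6 * 2 ^ K * C), by positivity,
    fun u v hu huv hv => ?_⟩
  set L := Real.log u with hL
  have hu0 : 0 < u := by linarith
  have hL1 : 1 ≤ L := by
    rw [hL, Real.le_log_iff_exp_le hu0]; linarith [Real.exp_one_lt_d9]
  have hL0 : 0 < L := by linarith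
  set z := (v - u) / u with hz
  have hz0 : 0 ≤ z := div_nonneg (by linarith) hu0.le
  have hz1 : z ≤ 1 := by rw [hz, div_le_one hu0]; linarith
  have hvz : v = u * (1 + z) := by rw [hz]; field_simp; ring
  have hlogv : Real.log v ≤ L * (1 + z) := by
    rw [hvz, Real.log_mul hu0.ne' (by linarith)]
    have := Real.log_le_sub_one_of_pos (show 0 < 1 + z by linarith)
    nlinarith
  set a := ⌊u⌋₊ with ha
  set b := ⌊v⌋₊ with hb
  have hau : (a : ℝ) ≤ u := Nat.floor_le hu0.le
  have hau' : u < a + 1 := Nat.lt_floor_add_one u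
  have hbv : (b : ℝ) ≤ v := Nat.floor_le (by linarith)
  have ha6 : 6 ≤ a := Nat.le_floor (by exact_mod_cast hu)
  have hab : a ≤ b := Nat.floor_mono huv
  have hE : ∀ N : ℕ, a ≤ N → N ≤ b + 1 → |logWeightedError (2 * K) N| ≤ 3 * 2 ^ K * C * (u * L ^ K) := by
    intro N hN hNb
    have hN0 : (0 : ℝ) < N := by exact_mod_cast (by omega : 0 < N)
    have hN1 : (N : ℝ) ≤ 3 * u := by
      have : (N : ℝ) ≤ b + 1 := by exact_mod_cast hNb
      linarith
    have hlogN : Real.log N ≤ 2 * L := by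
      rw [hL, show 2 * Real.log u = Real.log (u ^ 2) by rw [Real.log_pow]; norm_num]
      exact Real.log_le_log hN0 (by nlinarith)
    have hlogN0 : 0 ≤ Real.log N := Real.log_natCast_nonneg N
    calc _ ≤ C * N * Real.log N ^ K := h N (by omega)
      _ ≤ C * (3 * u) * (2 * L) ^ K := by gcongr
      _ = _ := by rw [mul_pow]; ring
  have hdiff : logWeightedError (2 * K) (b + 1) - logWeightedError (2 * K) (a + 1)
      = ∑ n ∈ Finset.Ioc a b, (ArithmeticFunction.vonMangoldt n - 1) * Real.log n ^ (2 * K) := by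
    have hI : Finset.Ioc a b = Finset.Ico (a + 1) (b + 1) := by
      ext; simp only [Finset.mem_Ioc, Finset.mem_Ico]; omega
    rw [logWeightedError, logWeightedError, hI,
      ← Finset.sum_Ico_consecutive _ (by omega : 1 ≤ a + 1) (by omega : a + 1 ≤ b + 1)]
    ring
  have hlower : ((primesIoc u v).card : ℝ) * (L * L ^ (2 * K))
      ≤ ∑ n ∈ Finset.Ioc a b, ArithmeticFunction.vonMangoldt n * Real.log n ^ (2 * K) := by
    rw [← nsmul_eq_mul, ← Finset.sum_const]
    refine (Finset.sum_le_sum fun p hp => ?_).trans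
      (Finset.sum_le_sum_of_subset_of_nonneg (Finset.filter_subset _ _) fun n _ _ => ?_)
    · rw [mem_primesIoc hu0.le (by linarith)] at hp
      rw [ArithmeticFunction.vonMangoldt_apply_prime hp.1]
      have : L ≤ Real.log p := Real.log_le_log hu0 hp.2.1.le
      gcongr
    · have := Real.log_natCast_nonneg n
      have := ArithmeticFunction.vonMangoldt_nonneg (n := n)
      positivity
  have hupper : ∑ n ∈ Finset.Ioc a b, Real.log n ^ (2 * K)
      ≤ (v - u + 1) * ((1 + 2 ^ (2 * K) * z) * L ^ (2 * K)) := by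
    have h1 : ∀ n ∈ Finset.Ioc a b, Real.log n ^ (2 * K) ≤ (1 + 2 ^ (2 * K) * z) * L ^ (2 * K) := by
      intro n hn
      rw [Finset.mem_Ioc] at hn
      have hn0 : (0 : ℝ) < n := by exact_mod_cast (by omega : 0 < n)
      have hnv : (n : ℝ) ≤ v := le_trans (by exact_mod_cast hn.2) hbv
      have h0 := Real.log_natCast_nonneg n
      calc Real.log n ^ (2 * K) ≤ (L * (1 + z)) ^ (2 * K) := by
            gcongr; exact (Real.log_le_log hn0 hnv).trans hlogv
        _ = (1 + z) ^ (2 * K) * L ^ (2 * K) := by rw [mul_pow]; ring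
        _ ≤ _ := by gcongr; exact one_add_pow_le_of_le_one hz0 hz1 _
    refine (Finset.sum_le_card_nsmul _ _ _ h1).trans ?_
    rw [nsmul_eq_mul, Nat.card_Ioc, Nat.cast_sub hab]
    gcongr
    linarith
  have hsum : ((primesIoc u v).card : ℝ) * (L * L ^ (2 * K))
      ≤ (v - u + 1) * ((1 + 2 ^ (2 * K) * z) * L ^ (2 * K)) + 6 * 2 ^ K * C * (u * L ^ K) := by
    have e1 := (abs_le.mp (hE (b + 1) (by omega) le_rfl)).2
    have e2 := (abs_le.mp (hE (a + 1) (by omega) (by omega))).1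
    simp only [sub_mul, one_mul, Finset.sum_sub_distrib] at hdiff
    linarith
  have hLK : L ^ K ≤ c * u := by
    refine (h' u (by linarith)).trans ?_
    gcongr
    rw [Real.sqrt_le_left (by linarith)]
    nlinarith
  have h1 : 1 ≤ c * (u / L ^ K) := by
    rw [← mul_div_assoc, le_div_iff₀ (by positivity)]; linarith
  have hmain : ((primesIoc u v).card : ℝ) * L
      ≤ (v - u + 1) * (1 + 2 ^ (2 * K) * z) + 6 * 2 ^ K * C * (u / L ^ K) := by
    have hp : 0 < L ^ (2 * K) := by positivity
    have e : u * L ^ K = u / L ^ K * L ^ (2 * K) := by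
      rw [two_mul, pow_add]; field_simp
    rw [e] at hsum
    refine le_of_mul_le_mul_right ?_ hp
    linarith
  have h2 : 1 + 2 ^ (2 * K) * z ≤ (1 + 2 ^ (2 * K)) * (c * (u / L ^ K)) := by
    have : 1 + (2 : ℝ) ^ (2 * K) * z ≤ 1 + 2 ^ (2 * K) * 1 := by gcongr
    have : (1 + (2 : ℝ) ^ (2 * K)) * 1 ≤ (1 + 2 ^ (2 * K)) * (c * (u / L ^ K)) := by gcongr
    linarith
  have h3 : (v - u) * (1 + 2 ^ (2 * K) * z) ≤ (v - u) *
      (1 + (2 ^ (2 * K) + ((1 + 2 ^ (2 * K)) * c + 6 * 2 ^ K * C)) * z) := by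
    refine mul_le_mul_of_nonneg_left ?_ (by linarith)
    have : 0 ≤ ((1 + 2 ^ (2 * K)) * c + 6 * 2 ^ K * C) * z := by positivity
    linarith
  have h4 : 0 ≤ 2 ^ (2 * K) * (u / L ^ K) := by positivity
  linarith

/-- Lower bound for the prime counting function. -/
lemma exists_le_primeCounting_mul_log : ∃ C : ℝ, 0 < C ∧ ∀ᶠ x : ℝ in Filter.atTop,
    x * (1 - C * (Real.log (Real.log x) / Real.log x)) ≤ Nat.primeCounting ⌊x⌋₊ * Real.log x := by
  obtain ⟨C, hC, h⟩ := exists_abs_logWeightedError_le 2 le_rfl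
  refine ⟨16 * C + 6, by positivity, ?_⟩
  have hlog := Real.tendsto_log_atTop
  have hloglog := hlog.comp hlog
  filter_upwards [Filter.eventually_ge_atTop 6, hloglog.eventually_ge_atTop 1,
    hlog.eventually_ge_atTop 4, (Real.isLittleO_pow_log_id_atTop (n := 1)).bound one_pos]
    with x hx hll hl hlx
  simp only [Function.comp] at hll
  set l := Real.log x with hldef
  set m := Real.log l with hmdef
  have hx0 : 0 < x := by linarith
  have hl0 : 0 < l := by linarith
  have hlx' : l ≤ x := by
    simp only [pow_one, id, one_mul, Real.norm_eq_abs] at hlx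
    exact (le_abs_self _).trans (hlx.trans (le_of_eq (abs_of_pos hx0)))
  have hml : m ≤ l - 1 := Real.log_le_sub_one_of_pos hl0
  set b := ⌊x⌋₊ with hb
  set a := ⌊x / l⌋₊ with ha
  have hbx : (b : ℝ) ≤ x := Nat.floor_le hx0.le
  have hbx' : x < b + 1 := Nat.lt_floor_add_one x
  have hax : (a : ℝ) ≤ x / l := Nat.floor_le (by positivity)
  have hax' : x / l < a + 1 := Nat.lt_floor_add_one _
  have hb6 : 6 ≤ b := Nat.le_floor (by exact_mod_cast hx)
  have hab : a ≤ b := Nat.floor_mono (div_le_self hx0.le (by linarith))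
  have hpsi : ∑ n ∈ Finset.Ico 1 (b + 1), ArithmeticFunction.vonMangoldt n * Real.log n ^ 4
      ≤ Chebyshev.psi x * l ^ 4 := by
    have hI : Finset.Ico 1 (b + 1) = Finset.Ioc 0 b := by
      ext; simp only [Finset.mem_Ioc, Finset.mem_Ico]; omega
    rw [hI, Chebyshev.psi, Finset.sum_mul]
    refine Finset.sum_le_sum fun n hn => ?_
    rw [Finset.mem_Ioc] at hn
    have h0 := Real.log_natCast_nonneg n
    gcongr
    exact Real.log_le_log (by exact_mod_cast hn.1) (le_trans (by exact_mod_cast hn.2) hbx)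
  have hones : (x - x / l - 1) * (l - m) ^ 4 ≤ ∑ n ∈ Finset.Ico 1 (b + 1), Real.log n ^ 4 := by
    have hsub : Finset.Ioc a b ⊆ Finset.Ico 1 (b + 1) := by
      intro n; simp only [Finset.mem_Ioc, Finset.mem_Ico]; omega
    have h1 : ∀ n ∈ Finset.Ioc a b, (l - m) ^ 4 ≤ Real.log n ^ 4 := by
      intro n hn
      rw [Finset.mem_Ioc] at hn
      have h3 : l - m ≤ Real.log n := by
        rw [hmdef, hldef, ← Real.log_div hx0.ne' hl0.ne']
        refine Real.log_le_log (by positivity) ?_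
        have : (a : ℝ) + 1 ≤ n := by exact_mod_cast hn.1
        linarith
      exact pow_le_pow_left₀ (by linarith) h3 4
    have h2 := Finset.card_nsmul_le_sum _ _ _ h1
    rw [nsmul_eq_mul, Nat.card_Ioc, Nat.cast_sub hab] at h2
    refine le_trans ?_ (h2.trans (Finset.sum_le_sum_of_subset_of_nonneg hsub fun n _ _ => ?_))
    · have : 0 ≤ (l - m) ^ 4 := pow_nonneg (by linarith) _
      exact mul_le_mul_of_nonneg_right (by linarith) this
    · exact pow_nonneg (Real.log_natCast_nonneg n) _
  have hE : -(C * (2 * x) * (2 * l) ^ 2) ≤ logWeightedError (2 * 2) (b + 1) := by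
    have h1 := (abs_le.mp (h (b + 1) (by omega))).1
    have h2 : ((b + 1 : ℕ) : ℝ) ≤ 2 * x := by push_cast; linarith
    have h3 : Real.log ((b + 1 : ℕ) : ℝ) ≤ 2 * l := by
      rw [hldef, show 2 * Real.log x = Real.log (x ^ 2) by rw [Real.log_pow]; norm_num]
      exact Real.log_le_log (by positivity) (by nlinarith)
    have h4 := Real.log_natCast_nonneg (b + 1)
    have : C * ((b + 1 : ℕ) : ℝ) * Real.log ((b + 1 : ℕ) : ℝ) ^ 2
        ≤ C * (2 * x) * (2 * l) ^ 2 := by gcongr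
    linarith
  have hmain : (x - x / l - 1) * (l - m) ^ 4 - 8 * C * x * l ^ 2 ≤ Chebyshev.psi x * l ^ 4 := by
    simp only [logWeightedError, sub_mul, one_mul, Finset.sum_sub_distrib] at hE
    norm_num at hE
    linarith
  have hr : 0 ≤ m / l := by positivity
  have hr1 : m / l ≤ 1 := by rw [div_le_one hl0]; linarith
  have hbern : l ^ 4 * (1 - 4 * (m / l)) ≤ (l - m) ^ 4 := by
    have h1 := one_add_mul_le_pow (a := -(m / l)) (by linarith) 4
    have e : (l - m) ^ 4 = l ^ 4 * (1 + -(m / l)) ^ 4 := by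
      rw [← mul_pow]; congr 1; field_simp; ring
    rw [e]
    gcongr
    norm_num at h1
    linarith
  have h1l : 1 / l ≤ m / l := by gcongr
  have h1x : 1 ≤ x / l := by rw [le_div_iff₀ hl0]; linarith
  have hxl : x / l ≤ x * (m / l) := by
    rw [div_eq_mul_one_div]; gcongr
  have hfac : x * (1 - 2 * (m / l)) ≤ x - x / l - 1 := by linarith
  refine le_trans ?_ (Chebyshev.psi_le_primeCounting_mul_log' x)
  have hl4 : 0 < l ^ 4 := by positivity
  refine le_of_mul_le_mul_right (le_trans ?_ hmain) hl4
  have hsq : x * l ^ 2 ≤ x * (m / l) * l ^ 4 := by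
    have : x * (m / l) * l ^ 4 = x * l ^ 2 * (m * l) := by field_simp
    rw [this]
    exact le_mul_of_one_le_right (by positivity) (by nlinarith)
  by_cases hcase : 0 ≤ 1 - 4 * (m / l)
  · have hA : x * (1 - 2 * (m / l)) * (l ^ 4 * (1 - 4 * (m / l)))
        ≤ (x - x / l - 1) * (l - m) ^ 4 := by
      refine mul_le_mul hfac hbern (by positivity) ?_
      have : 0 ≤ x * (1 - 2 * (m / l)) := mul_nonneg hx0.le (by linarith)
      linarith
    have hB : x * (1 - 6 * (m / l)) * l ^ 4
        ≤ x * (1 - 2 * (m / l)) * (l ^ 4 * (1 - 4 * (m / l))) := by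
      have : 0 ≤ x * l ^ 4 * (8 * (m / l) ^ 2) := by positivity
      linarith
    have : 0 ≤ C * (x * (m / l) * l ^ 4) := by positivity
    have : C * (x * l ^ 2) ≤ C * (x * (m / l) * l ^ 4) := by gcongr
    linarith
  · have hneg : x * (1 - (16 * C + 6) * (m / l)) * l ^ 4 ≤ -(16 * C * (x * (m / l) * l ^ 4)) := by
      have : x * l ^ 4 * (1 - 6 * (m / l)) ≤ 0 :=
        mul_nonpos_of_nonneg_of_nonpos (by positivity) (by linarith)
      linarith
    have h1 : C * (x * l ^ 2) ≤ C * (x * (m / l) * l ^ 4) := by gcongr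
    have h0 : 0 ≤ C * (x * (m / l) * l ^ 4) := by positivity
    have h2 : 0 ≤ (x - x / l - 1) * (l - m) ^ 4 := by
      refine mul_nonneg ?_ (pow_nonneg (by linarith) _)
      have : x / l ≤ x / 4 := by gcongr
      linarith
    linarith

/-- If two functions are monotone on a finite set of naturals, then the nonempty cells cut out by
their joint fibres form a chain, which bounds the size of the set by the sizes of the cells. -/
lemma card_le_sum_of_monotone_cells {B : Finset ℕ} {f h : ℕ → ℕ}
    (hf : ∀ m ∈ B, ∀ n ∈ B, m ≤ n → f m ≤ f n) (hh : ∀ m ∈ B, ∀ n ∈ B, m ≤ n → h m ≤ h n)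
    {w : ℕ → ℝ} {W : ℝ} (hw0 : ∀ i, 0 ≤ w i) (hW : ∀ i ∈ B.image f, w i ≤ W)
    (hw : ∀ i j, ((B.filter fun n => f n = i ∧ h n = j).card : ℝ) ≤ w i) :
    (B.card : ℝ) ≤ ∑ i ∈ B.image f, w i + (B.image h).card * W := by
  classical
  set D := B.image fun n => (f n, h n) with hD
  have hchain : ∀ c ∈ D, ∀ c' ∈ D, c.1 < c'.1 → c.2 ≤ c'.2 := by
    simp only [hD, Finset.mem_image]
    rintro _ ⟨m, hm, rfl⟩ _ ⟨n, hn, rfl⟩ hlt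
    rcases le_total m n with hmn | hmn
    · exact hh m hm n hn hmn
    · exact absurd (hf n hn m hm hmn) (by simpa using hlt)
  have hcard : (B.card : ℝ) ≤ ∑ c ∈ D, w c.1 := by
    rw [Finset.card_eq_sum_card_image (fun n => (f n, h n)) B]
    push_cast
    refine Finset.sum_le_sum fun c _ => ?_
    simpa [Prod.ext_iff] using hw c.1 c.2
  set P : ℕ × ℕ → Prop := fun c => ∀ c' ∈ D, c'.1 = c.1 → c.2 ≤ c'.2 with hP
  have hfst : ∀ c ∈ D, c.1 ∈ B.image f := by
    simp only [hD, Finset.mem_image]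
    rintro _ ⟨m, hm, rfl⟩
    exact ⟨m, hm, rfl⟩
  have hsnd : ∀ c ∈ D, c.2 ∈ B.image h := by
    simp only [hD, Finset.mem_image]
    rintro _ ⟨m, hm, rfl⟩
    exact ⟨m, hm, rfl⟩
  refine hcard.trans ?_
  rw [← Finset.sum_filter_add_sum_filter_not D P]
  refine add_le_add ?_ ?_
  · have hinj : Set.InjOn Prod.fst (D.filter P : Set (ℕ × ℕ)) := by
      intro c hc c' hc' heq
      simp only [Finset.coe_filter, Set.mem_ofPred_eq] at hc hc'
      exact Prod.ext heq (le_antisymm (hc.2 c' hc'.1 heq.symm) (hc'.2 c hc.1 heq))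
    rw [← Finset.sum_image (f := w) hinj]
    refine Finset.sum_le_sum_of_subset_of_nonneg ?_ fun i _ _ => hw0 i
    intro i hi
    obtain ⟨c, hc, rfl⟩ := Finset.mem_image.mp hi
    exact hfst c (Finset.mem_filter.mp hc).1
  · have hinj : Set.InjOn Prod.snd (D.filter fun c => ¬P c : Set (ℕ × ℕ)) := by
      have key : ∀ c ∈ D, ∀ c' ∈ D, ¬P c' → c.2 = c'.2 → ¬c.1 < c'.1 := by
        intro c hc c' hc' hPc' heq hlt
        simp only [hP] at hPc'
        push Not at hPc'
        obtain ⟨c'', hc'', h1, h2⟩ := hPc'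
        have := hchain c hc c'' hc'' (by omega)
        omega
      intro c hc c' hc' heq
      simp only [Finset.coe_filter, Set.mem_ofPred_eq] at hc hc'
      have := key c hc.1 c' hc'.1 hc'.2 heq
      have := key c' hc'.1 c hc.1 hc.2 heq.symm
      exact Prod.ext (by omega) heq
    rcases (D.filter fun c => ¬P c).eq_empty_or_nonempty with he | ⟨c₀, hc₀⟩
    · rw [he, Finset.sum_empty]
      rcases B.eq_empty_or_nonempty with hBe | ⟨b, hb⟩
      · simp [hBe]
      · exact mul_nonneg (Nat.cast_nonneg _)
          ((hw0 _).trans (hW _ (Finset.mem_image_of_mem f hb)))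
    · have hW0 : 0 ≤ W := (hw0 _).trans (hW _ (hfst c₀ (Finset.mem_filter.mp hc₀).1))
      refine (Finset.sum_le_card_nsmul _ _ W fun c hc =>
        hW _ (hfst c (Finset.mem_filter.mp hc).1)).trans ?_
      rw [nsmul_eq_mul, ← Finset.card_image_of_injOn hinj]
      refine mul_le_mul_of_nonneg_right ?_ hW0
      refine Nat.cast_le.mpr (Finset.card_le_card fun j hj => ?_)
      obtain ⟨c, hc, rfl⟩ := Finset.mem_image.mp hj
      exact hsnd c (Finset.mem_filter.mp hc).1

/-- The index of the logarithmic cell of width `δ` containing `n`. -/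
noncomputable def logCell (δ : ℝ) (n : ℕ) : ℕ := ⌈Real.log n / δ⌉₊

lemma logCell_mono {δ : ℝ} (hδ : 0 < δ) {m n : ℕ} (hm : 1 ≤ m) (hmn : m ≤ n) :
    logCell δ m ≤ logCell δ n := by
  have : (0 : ℝ) < m := by exact_mod_cast hm
  unfold logCell
  gcongr

lemma log_le_logCell_mul {δ : ℝ} (hδ : 0 < δ) (n : ℕ) : Real.log n ≤ logCell δ n * δ := by
  rw [← div_le_iff₀ hδ]
  exact Nat.le_ceil _

lemma logCell_sub_one_mul_lt {δ : ℝ} (hδ : 0 < δ) (n : ℕ) :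
    (logCell δ n - 1) * δ < Real.log n := by
  rw [← lt_div_iff₀ hδ, sub_lt_iff_lt_add]
  exact Nat.ceil_lt_add_one (div_nonneg (Real.log_natCast_nonneg n) hδ.le)

lemma image_logCell_subset {δ x : ℝ} (hδ : 0 < δ) {B : Finset ℕ} {g : ℕ → ℕ}
    (hB : ∀ n ∈ B, 1 ≤ g n ∧ (g n : ℝ) ≤ x) :
    B.image (fun n => logCell δ (g n)) ⊆ Finset.range (⌈Real.log x / δ⌉₊ + 1) := by
  intro i hi
  obtain ⟨n, hn, rfl⟩ := Finset.mem_image.mp hi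
  have : (0 : ℝ) < g n := by exact_mod_cast (hB n hn).1
  have := (hB n hn).2
  rw [Finset.mem_range, Nat.lt_succ_iff]
  unfold logCell
  gcongr

lemma card_image_logCell_le {δ x : ℝ} (hδ : 0 < δ) (hx : 1 ≤ x) {B : Finset ℕ} {g : ℕ → ℕ}
    (hB : ∀ n ∈ B, 1 ≤ g n ∧ (g n : ℝ) ≤ x) :
    ((B.image fun n => logCell δ (g n)).card : ℝ) ≤ Real.log x / δ + 2 := by
  have h1 := Finset.card_le_card (image_logCell_subset hδ hB)
  rw [Finset.card_range] at h1
  have h2 := Nat.ceil_lt_add_one (div_nonneg (Real.log_nonneg hx) hδ.le)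
  have : ((B.image fun n => logCell δ (g n)).card : ℝ) ≤ ⌈Real.log x / δ⌉₊ + 1 := by
    exact_mod_cast h1
  linarith

lemma card_Ioc_floor_le {u v : ℝ} (hu : 0 ≤ u) (huv : u ≤ v) :
    ((Finset.Ioc ⌊u⌋₊ ⌊v⌋₊).card : ℝ) ≤ v - u + 1 := by
  rw [Nat.card_Ioc, Nat.cast_sub (Nat.floor_mono huv)]
  linarith [Nat.floor_le (hu.trans huv), Nat.lt_floor_add_one u]

lemma neg_log_one_sub_inv_le {q : ℝ} (hq : 2 ≤ q) : -Real.log (1 - q⁻¹) ≤ 2 / q := by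
  have hq0 : 0 < q := by linarith
  have hq' : q⁻¹ ≤ 2⁻¹ := by gcongr
  have h1 : 0 < 1 - q⁻¹ := by linarith
  rw [← Real.log_inv]
  refine (Real.log_le_sub_one_of_pos (inv_pos.mpr h1)).trans ?_
  rw [inv_eq_one_div, sub_le_iff_le_add, div_le_iff₀ h1]
  have : 0 < q⁻¹ := by positivity
  rw [div_eq_mul_inv]
  nlinarith

/-- A set on which the totient function is monotone and all of whose elements are of the form
`a * e * q`, with `q` a large prime and with few `e` for each value of `φ e / e`, is small. -/
lemma card_le_of_card_window_le {B : Finset ℕ}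
    (hB : ∀ m ∈ B, ∀ n ∈ B, m ≤ n → Nat.totient m ≤ Nat.totient n)
    {x δ E T : ℝ} (hx : 1 ≤ Real.log x) (hx1 : 1 ≤ x) (hδ : 0 < δ) (hδ1 : δ ≤ 1) (hE : 0 < E)
    (S : Finset ℕ) (hS : ∀ e ∈ S, E ≤ e)
    (hT : ∀ t : ℝ, ((S.filter fun e => t < Real.log (Nat.totient e / e) ∧
      Real.log (Nat.totient e / e) ≤ t + 3 * δ).card : ℝ) ≤ T)
    (hn : ∀ n ∈ B, 1 ≤ n ∧ (n : ℝ) ≤ x ∧ ∃ a e q : ℕ, n = a * e * q ∧ q.Prime ∧ 2 / δ ≤ q ∧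
      e ∈ S ∧ Nat.totient n = Nat.totient a * Nat.totient e * Nat.totient q) :
    (B.card : ℝ) ≤ 60 * (Real.log x ^ 2 * (x * (T / E))) := by
  classical
  have hx0 : 0 < x := by linarith
  have hT0 : 0 ≤ T := le_trans (Nat.cast_nonneg _) (hT 0)
  have hBx : ∀ n ∈ B, 1 ≤ id n ∧ ((id n : ℕ) : ℝ) ≤ x := fun n h => ⟨(hn n h).1, (hn n h).2.1⟩
  have hBφ : ∀ n ∈ B, 1 ≤ Nat.totient n ∧ (Nat.totient n : ℝ) ≤ x := fun n h =>
    ⟨Nat.totient_pos.mpr (hn n h).1,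
      le_trans (by exact_mod_cast Nat.totient_le n) (hn n h).2.1⟩
  set W : ℝ := 5 * δ * (x * (T / E)) * (1 + Real.log x) with hWdef
  have hlx : 0 ≤ Real.log x := by linarith
  have hW0 : 0 ≤ W := by positivity
  have hcell : ∀ i j, ((B.filter fun n => logCell δ (id n) = i ∧ logCell δ (Nat.totient n) = j).card : ℝ)
      ≤ W := by
    intro i j
    set U : ℝ := Real.exp ((i - 1) * δ) with hU
    set V : ℝ := Real.exp (i * δ) with hV
    have hU0 : 0 < U := Real.exp_pos _
    have hV0 : 0 < V := Real.exp_pos _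
    have hVU : V - U ≤ δ * V := by
      have : U = V * Real.exp (-δ) := by rw [hU, hV, ← Real.exp_add]; ring_nf
      have := Real.add_one_le_exp (-δ)
      nlinarith
    have hUV : U ≤ V := Real.exp_le_exp.mpr (by linarith)
    rcases (B.filter fun n => logCell δ (id n) = i ∧ logCell δ (Nat.totient n) = j).eq_empty_or_nonempty
      with he | ⟨n₀, hn₀⟩
    · rw [he]; simpa using hW0
    have hmem : ∀ n ∈ B.filter (fun n => logCell δ (id n) = i ∧ logCell δ (Nat.totient n) = j),
        U < n ∧ (n : ℝ) ≤ V := by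
      intro n h
      obtain ⟨h1, h2, -⟩ := Finset.mem_filter.mp h
      have hn0 : (0 : ℝ) < n := by exact_mod_cast (hn n h1).1
      simp only [id] at h2
      constructor
      · rw [hU, ← Real.lt_log_iff_exp_lt hn0, ← h2]
        exact logCell_sub_one_mul_lt hδ n
      · rw [hV, ← Real.log_le_iff_le_exp hn0, ← h2]
        exact log_le_logCell_mul hδ n
    have hVx : V ≤ 3 * x := by
      have h1 := (hmem n₀ hn₀).1
      have h2 := (hn n₀ (Finset.mem_filter.mp hn₀).1).2.1
      have : V = U * Real.exp δ := by rw [hU, hV, ← Real.exp_add]; ring_nf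
      have h3 : Real.exp δ ≤ 3 := by
        have := Real.exp_le_exp.mpr hδ1
        linarith [Real.exp_one_lt_d9]
      rw [this]
      nlinarith
    set t : ℕ → ℝ := fun a => (j - 1 - i) * δ - Real.log (Nat.totient a / a) with ht
    set Sa : ℕ → Finset ℕ := fun a => S.filter fun e => t a < Real.log (Nat.totient e / e) ∧
      Real.log (Nat.totient e / e) ≤ t a + 3 * δ with hSa
    set Q : ℕ → ℕ → Finset ℕ := fun a e =>
      (Finset.Ioc ⌊U / (a * e)⌋₊ ⌊V / (a * e)⌋₊).filter fun q => 2 / δ ≤ (q : ℝ) with hQ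
    have hsub : B.filter (fun n => logCell δ (id n) = i ∧ logCell δ (Nat.totient n) = j) ⊆
        (Finset.Icc 1 ⌊x⌋₊).biUnion fun a => (Sa a).biUnion fun e => (Q a e).image fun q => a * e * q := by
      intro n h
      obtain ⟨hU', hV'⟩ := hmem n h
      obtain ⟨hnB, hi, hj⟩ := Finset.mem_filter.mp h
      simp only [id] at hi
      obtain ⟨hn1, hnx, a, e, q, rfl, hq, hqδ, he, hφ⟩ := hn n hnB
      have hq0 : 0 < q := hq.pos
      have ha0 : 0 < a := by
        rcases Nat.eq_zero_or_pos a with h0 | h0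
        · simp [h0] at hn1
        · exact h0
      have he0 : 0 < e := by
        rcases Nat.eq_zero_or_pos e with h0 | h0
        · simp [h0] at hn1
        · exact h0
      have haR : (0 : ℝ) < a := by exact_mod_cast ha0
      have heR : (0 : ℝ) < e := by exact_mod_cast he0
      have hqR : (0 : ℝ) < q := by exact_mod_cast hq0
      have hφa : (0 : ℝ) < Nat.totient a := by exact_mod_cast Nat.totient_pos.mpr ha0
      have hφe : (0 : ℝ) < Nat.totient e := by exact_mod_cast Nat.totient_pos.mpr he0
      have hφq : (0 : ℝ) < Nat.totient q := by exact_mod_cast Nat.totient_pos.mpr hq0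
      simp only [Finset.mem_biUnion, Finset.mem_image]
      refine ⟨a, ?_, e, ?_, q, ?_, rfl⟩
      · rw [Finset.mem_Icc]
        refine ⟨ha0, le_trans ?_ (Nat.le_floor hnx)⟩
        rw [mul_assoc]
        exact Nat.le_mul_of_pos_right a (Nat.mul_pos he0 hq0)
      · rw [hSa, Finset.mem_filter]
        have e1 : Real.log ((a * e * q : ℕ) : ℝ) = Real.log a + Real.log e + Real.log q := by
          push_cast
          rw [Real.log_mul (by positivity) (by positivity), Real.log_mul (by positivity) (by positivity)]
        have e2 : Real.log (Nat.totient (a * e * q) : ℝ)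
            = Real.log (Nat.totient a) + Real.log (Nat.totient e) + Real.log (Nat.totient q) := by
          rw [hφ]
          push_cast
          rw [Real.log_mul (by positivity) (by positivity), Real.log_mul (by positivity) (by positivity)]
        have e3 : Real.log (Nat.totient q) - Real.log q = Real.log (1 - (q : ℝ)⁻¹) := by
          rw [← Real.log_div (by positivity) (by positivity), Nat.totient_prime hq,
            Nat.cast_sub hq.one_le]
          congr 1
          field_simp
          simp
        have e4 : -Real.log (1 - (q : ℝ)⁻¹) ≤ δ := by
          refine (neg_log_one_sub_inv_le (by exact_mod_cast hq.two_le)).trans ?_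
          rw [div_le_iff₀ hδ] at hqδ
          rw [div_le_iff₀ hqR]; linarith
        have e5 : Real.log (1 - (q : ℝ)⁻¹) ≤ 0 := by
          refine Real.log_nonpos ?_ ?_
          · have : (q : ℝ)⁻¹ ≤ 1 := inv_le_one_of_one_le₀ (by exact_mod_cast hq.one_le)
            linarith
          · have : 0 < (q : ℝ)⁻¹ := by positivity
            linarith
        have h1 := log_le_logCell_mul hδ (a * e * q)
        have h2 := logCell_sub_one_mul_lt hδ (a * e * q)
        have h3 := log_le_logCell_mul hδ (Nat.totient (a * e * q))
        have h4 := logCell_sub_one_mul_lt hδ (Nat.totient (a * e * q))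
        rw [hi, e1] at h1 h2
        rw [hj, e2] at h3 h4
        simp only [ht]
        rw [Real.log_div hφe.ne' heR.ne', Real.log_div hφa.ne' haR.ne']
        exact ⟨he, by linarith, by linarith⟩
      · rw [hQ, Finset.mem_filter, Finset.mem_Ioc, Nat.floor_lt (by positivity),
          Nat.le_floor_iff (by positivity), div_lt_iff₀ (by positivity), le_div_iff₀ (by positivity)]
        push_cast at hU' hV'
        exact ⟨⟨by linarith, by linarith⟩, hqδ⟩
    have hQcard : ∀ a ∈ Finset.Icc 1 ⌊x⌋₊, ∀ e ∈ Sa a,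
        ((Q a e).card : ℝ) ≤ 5 * δ * (x / E) * (a : ℝ)⁻¹ := by
      intro a ha e he
      have haR : (0 : ℝ) < a := by exact_mod_cast (Finset.mem_Icc.mp ha).1
      have hEe : E ≤ e := hS e (Finset.mem_filter.mp he).1
      have heR : (0 : ℝ) < e := by linarith
      rcases (Q a e).eq_empty_or_nonempty with hem | ⟨q, hq⟩
      · rw [hem]; simp only [Finset.card_empty, Nat.cast_zero]; positivity
      rw [hQ, Finset.mem_filter, Finset.mem_Ioc, Nat.le_floor_iff (by positivity)] at hq
      have h1 : 2 ≤ V / (a * e) * δ := by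
        have := hq.2.trans hq.1.2
        rwa [div_le_iff₀ hδ] at this
      have h2 : ((Q a e).card : ℝ) ≤ V / (a * e) - U / (a * e) + 1 :=
        le_trans (Nat.cast_le.mpr (Finset.card_filter_le _ _))
          (card_Ioc_floor_le (by positivity) (by gcongr))
      have h3 : V / (a * e) - U / (a * e) ≤ δ * V / (a * e) := by
        rw [← sub_div]; gcongr
      calc ((Q a e).card : ℝ) ≤ 3 / 2 * (δ * V / (a * e)) := by
            have : δ * V / (a * e) = V / (a * e) * δ := by ring
            linarith
        _ ≤ 3 / 2 * (δ * (3 * x) / (a * E)) := by gcongr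
        _ = 9 / 2 * (δ * (x / E) * (a : ℝ)⁻¹) := by field_simp; ring
        _ ≤ 5 * (δ * (x / E) * (a : ℝ)⁻¹) := by
            have : 0 ≤ δ * (x / E) * (a : ℝ)⁻¹ := by positivity
            linarith
        _ = _ := by ring
    have hcount : ((B.filter fun n => logCell δ (id n) = i ∧ logCell δ (Nat.totient n) = j).card : ℝ)
        ≤ ∑ a ∈ Finset.Icc 1 ⌊x⌋₊, ∑ e ∈ Sa a, ((Q a e).card : ℝ) := by
      have h1 := (Finset.card_le_card hsub).trans Finset.card_biUnion_le
      have h2 : ∑ a ∈ Finset.Icc 1 ⌊x⌋₊,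
          ((Sa a).biUnion fun e => (Q a e).image fun q => a * e * q).card
          ≤ ∑ a ∈ Finset.Icc 1 ⌊x⌋₊, ∑ e ∈ Sa a, (Q a e).card :=
        Finset.sum_le_sum fun a _ => Finset.card_biUnion_le.trans
          (Finset.sum_le_sum fun e _ => Finset.card_image_le)
      exact_mod_cast h1.trans h2
    refine hcount.trans ?_
    calc ∑ a ∈ Finset.Icc 1 ⌊x⌋₊, ∑ e ∈ Sa a, ((Q a e).card : ℝ)
        ≤ ∑ a ∈ Finset.Icc 1 ⌊x⌋₊, T * (5 * δ * (x / E) * (a : ℝ)⁻¹) := by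
          refine Finset.sum_le_sum fun a ha => ?_
          refine (Finset.sum_le_card_nsmul _ _ _ (hQcard a ha)).trans ?_
          rw [nsmul_eq_mul]
          have := hT (t a)
          gcongr
      _ = 5 * δ * (x * (T / E)) * ∑ a ∈ Finset.Icc 1 ⌊x⌋₊, (a : ℝ)⁻¹ := by
          rw [Finset.mul_sum]
          exact Finset.sum_congr rfl fun a _ => by ring
      _ ≤ W := by
          rw [hWdef]
          gcongr
          have := harmonic_floor_le_one_add_log x hx1
          rw [harmonic_eq_sum_Icc] at this
          push_cast at this
          exact this
  have hmain := card_le_sum_of_monotone_cells (B := B) (f := fun n => logCell δ (id n))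
    (h := fun n => logCell δ (Nat.totient n)) (w := fun _ => W) (W := W)
    (fun m hm n _ hmn => logCell_mono hδ (hn m hm).1 hmn)
    (fun m hm n hn' hmn => logCell_mono hδ (hBφ m hm).1 (hB m hm n hn' hmn))
    (fun _ => hW0) (fun _ _ => le_rfl) hcell
  rw [Finset.sum_const, nsmul_eq_mul] at hmain
  have h1 := card_image_logCell_le hδ hx1 hBx
  have h2 := card_image_logCell_le hδ hx1 hBφ
  have h3 : Real.log x / δ + 2 ≤ 3 * (Real.log x / δ) := by
    have : 1 ≤ Real.log x / δ := by rw [le_div_iff₀ hδ]; linarith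
    linarith
  calc (B.card : ℝ) ≤ 3 * (Real.log x / δ) * W + 3 * (Real.log x / δ) * W := by
        refine hmain.trans (add_le_add ?_ ?_) <;> gcongr <;> linarith
    _ = 30 * (Real.log x * (1 + Real.log x) * (x * (T / E))) := by
        rw [hWdef]; field_simp; ring
    _ ≤ 30 * (Real.log x * (Real.log x + Real.log x) * (x * (T / E))) := by gcongr
    _ = _ := by ring

lemma eq_empty_of_prod_primes_eq {S T : Finset ℕ} (hS : ∀ p ∈ S, p.Prime) (hT : ∀ p ∈ T, p.Prime)
    (hST : Disjoint S T)
    (h : (∏ p ∈ S, (p - 1)) * ∏ p ∈ T, p = (∏ p ∈ T, (p - 1)) * ∏ p ∈ S, p) : S ∪ T = ∅ := by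
  by_contra hne
  have hne' : (S ∪ T).Nonempty := Finset.nonempty_iff_ne_empty.mpr hne
  have key : ∀ S T : Finset ℕ, (∀ p ∈ S, p.Prime) → (∀ p ∈ T, p.Prime) → Disjoint S T →
      (∏ p ∈ S, (p - 1)) * ∏ p ∈ T, p = (∏ p ∈ T, (p - 1)) * ∏ p ∈ S, p →
      ∀ m ∈ S, (∀ p ∈ S, p ≤ m) → False := by
    intro S T hS hT hST h m hm hmax
    have hmp := hS m hm
    have hd : m ∣ (∏ p ∈ S, (p - 1)) * ∏ p ∈ T, p :=
      h ▸ Dvd.dvd.mul_left (Finset.dvd_prod_of_mem _ hm) _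
    rcases hmp.dvd_mul.mp hd with hd | hd
    · obtain ⟨p, hp, hpm⟩ := (hmp.prime.dvd_finsetProd_iff _).mp hd
      have h1 := (hS p hp).two_le
      have := Nat.le_of_dvd (by omega) hpm
      have := hmax p hp
      omega
    · obtain ⟨p, hp, hpm⟩ := (hmp.prime.dvd_finsetProd_iff _).mp hd
      have := (Nat.prime_dvd_prime_iff_eq hmp (hT p hp)).mp hpm
      exact Finset.disjoint_left.mp hST hm (this ▸ hp)
  have hmax : ∀ p ∈ S ∪ T, p ≤ (S ∪ T).max' hne' := fun p hp => Finset.le_max' _ p hp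
  rcases Finset.mem_union.mp (Finset.max'_mem _ hne') with hm | hm
  · exact key S T hS hT hST h _ hm fun p hp => hmax p (Finset.mem_union_left _ hp)
  · exact key T S hT hS hST.symm h.symm _ hm fun p hp => hmax p (Finset.mem_union_right _ hp)

/-- The ratio `φ d / d` determines the set of prime factors of `d`. -/
lemma primeFactors_eq_of_totient_mul_eq {d e : ℕ} (hd : d ≠ 0) (he : e ≠ 0)
    (h : Nat.totient d * e = Nat.totient e * d) : d.primeFactors = e.primeFactors := by
  set S := d.primeFactors
  set T := e.primeFactors
  have hprime : ∀ U : Finset ℕ, (∀ p ∈ U, p.Prime) → (∏ p ∈ U, p) ≠ 0 ∧ (∏ p ∈ U, (p - 1)) ≠ 0 :=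
    fun U hU => ⟨Finset.prod_ne_zero_iff.mpr fun p hp => (hU p hp).ne_zero,
      Finset.prod_ne_zero_iff.mpr fun p hp => by have := (hU p hp).two_le; omega⟩
  have hSp : ∀ p ∈ S, p.Prime := fun p hp => Nat.prime_of_mem_primeFactors hp
  have hTp : ∀ p ∈ T, p.Prime := fun p hp => Nat.prime_of_mem_primeFactors hp
  have h1 : (∏ p ∈ S, (p - 1)) * ∏ p ∈ T, p = (∏ p ∈ T, (p - 1)) * ∏ p ∈ S, p := by
    have h2 := Nat.totient_mul_prod_primeFactors d
    have h3 := Nat.totient_mul_prod_primeFactors e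
    have hde : d * e ≠ 0 := mul_ne_zero hd he
    refine Nat.eq_of_mul_eq_mul_left (Nat.pos_of_ne_zero hde) ?_
    calc d * e * ((∏ p ∈ S, (p - 1)) * ∏ p ∈ T, p)
        = (d * ∏ p ∈ S, (p - 1)) * (e * ∏ p ∈ T, p) := by ring
      _ = (Nat.totient d * ∏ p ∈ S, p) * (e * ∏ p ∈ T, p) := by rw [h2]
      _ = (Nat.totient d * e) * (∏ p ∈ S, p) * ∏ p ∈ T, p := by ring
      _ = (Nat.totient e * ∏ p ∈ T, p) * (d * ∏ p ∈ S, p) := by rw [h]; ring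
      _ = (e * ∏ p ∈ T, (p - 1)) * (d * ∏ p ∈ S, p) := by rw [h3]
      _ = _ := by ring
  have hI := hprime (S ∩ T) fun p hp => hSp p (Finset.mem_inter.mp hp).1
  have e1 : ∀ g : ℕ → ℕ, ∏ p ∈ S, g p = (∏ p ∈ S \ T, g p) * ∏ p ∈ S ∩ T, g p := fun g => by
    rw [mul_comm]; exact (Finset.prod_inter_mul_prod_sdiff S T g).symm
  have e2 : ∀ g : ℕ → ℕ, ∏ p ∈ T, g p = (∏ p ∈ T \ S, g p) * ∏ p ∈ S ∩ T, g p := fun g => by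
    rw [mul_comm, Finset.inter_comm]; exact (Finset.prod_inter_mul_prod_sdiff T S g).symm
  rw [e1, e2, e1, e2] at h1
  have h4 : (∏ p ∈ S \ T, (p - 1)) * ∏ p ∈ T \ S, p = (∏ p ∈ T \ S, (p - 1)) * ∏ p ∈ S \ T, p := by
    refine Nat.eq_of_mul_eq_mul_left (Nat.pos_of_ne_zero (mul_ne_zero hI.1 hI.2)) ?_
    linarith
  have h5 := eq_empty_of_prod_primes_eq (fun p hp => hSp p (Finset.mem_sdiff.mp hp).1)
    (fun p hp => hTp p (Finset.mem_sdiff.mp hp).1)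
    (Finset.disjoint_left.mpr fun p hp hp' =>
      (Finset.mem_sdiff.mp hp').2 (Finset.mem_sdiff.mp hp).1) h4
  rw [Finset.union_eq_empty, Finset.sdiff_eq_empty_iff_subset, Finset.sdiff_eq_empty_iff_subset] at h5
  exact h5.1.antisymm h5.2

lemma sub_le_log_sub_log {a b : ℝ} (ha : 0 < a) (hab : a ≤ b) (hb : b ≤ 1) :
    b - a ≤ Real.log b - Real.log a := by
  have hb0 : 0 < b := by linarith
  have h1 := Real.log_le_sub_one_of_pos (div_pos ha hb0)
  rw [Real.log_div ha.ne' hb0.ne'] at h1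
  have h2 : b - a ≤ 1 - a / b := by
    rw [le_sub_iff_add_le, ← le_sub_iff_add_le', div_le_iff₀ hb0]
    nlinarith
  linarith

lemma totient_div_self_pos {d : ℕ} (hd : 1 ≤ d) : (0 : ℝ) < Nat.totient d / d :=
  div_pos (by exact_mod_cast Nat.totient_pos.mpr hd) (by exact_mod_cast hd)

lemma totient_div_self_le_one (d : ℕ) : (Nat.totient d : ℝ) / d ≤ 1 :=
  div_le_one_of_le₀ (by exact_mod_cast Nat.totient_le d) (Nat.cast_nonneg d)

/-- Distinct values of `φ d / d` with `d ≤ D` are well spaced. -/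
lemma primeFactors_eq_of_abs_log_totient_div_lt {D : ℝ} {d e : ℕ} (hd : 1 ≤ d) (he : 1 ≤ e)
    (hdD : d ≤ D) (heD : e ≤ D)
    (h : |Real.log (Nat.totient d / d) - Real.log (Nat.totient e / e)| < 1 / D ^ 2) :
    d.primeFactors = e.primeFactors := by
  have key : ∀ d e : ℕ, 1 ≤ d → 1 ≤ e → (d : ℝ) ≤ D → (e : ℝ) ≤ D →
      (Nat.totient d : ℝ) / d ≤ Nat.totient e / e →
      |Real.log (Nat.totient d / d) - Real.log (Nat.totient e / e)| < 1 / D ^ 2 →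
      d.primeFactors = e.primeFactors := by
    intro d e hd he hdD heD hle h
    have hd0 : (0 : ℝ) < d := by exact_mod_cast hd
    have he0 : (0 : ℝ) < e := by exact_mod_cast he
    have hD0 : 0 < D := hd0.trans_le hdD
    have h1 := sub_le_log_sub_log (totient_div_self_pos hd) hle (totient_div_self_le_one e)
    rw [abs_sub_comm] at h
    have h2 := (h1.trans (le_abs_self _)).trans_lt h
    have h3 : (Nat.totient e : ℝ) * d - Nat.totient d * e < 1 := by
      have h4 : (Nat.totient e : ℝ) / e - Nat.totient d / d
          = (Nat.totient e * d - Nat.totient d * e) / (e * d) := by field_simp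
      have h5 : 1 / D ^ 2 ≤ 1 / (e * d) := by
        apply one_div_le_one_div_of_le (by positivity)
        rw [sq]; gcongr
      rw [h4] at h2
      have h6 := h2.trans_le h5
      rwa [div_lt_div_iff_of_pos_right (by positivity)] at h6
    have h7 : (Nat.totient d : ℝ) * e ≤ Nat.totient e * d := by
      rwa [div_le_div_iff₀ hd0 he0] at hle
    have h8 : Nat.totient d * e = Nat.totient e * d := by
      have h9 : Nat.totient d * e ≤ Nat.totient e * d := by exact_mod_cast h7
      have h10 : (Nat.totient e : ℝ) * d < Nat.totient d * e + 1 := by linarith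
      have h11 : Nat.totient e * d < Nat.totient d * e + 1 := by exact_mod_cast h10
      omega
    exact primeFactors_eq_of_totient_mul_eq (by omega) (by omega) h8
  rcases le_total ((Nat.totient d : ℝ) / d) (Nat.totient e / e) with hle | hle
  · exact key d e hd he hdD heD hle h
  · exact (key e d he hd heD hdD hle (by rwa [abs_sub_comm])).symm

lemma card_le_of_forall_sub_le {S : Finset ℕ} {R : ℝ} (hR : 0 ≤ R)
    (h : ∀ a ∈ S, ∀ b ∈ S, a ≤ b → (b : ℝ) - a ≤ R) : (S.card : ℝ) ≤ R + 1 := by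
  rcases S.eq_empty_or_nonempty with he | hne
  · rw [he]; simp; linarith
  have hsub : S ⊆ Finset.Icc (S.min' hne) (S.min' hne + ⌊R⌋₊) := by
    intro b hb
    have h1 := S.min'_le b hb
    rw [Finset.mem_Icc]
    refine ⟨h1, ?_⟩
    have h2 := h _ (S.min'_mem hne) b hb h1
    rw [← Nat.cast_sub h1] at h2
    have := Nat.le_floor h2
    omega
  have h1 := Finset.card_le_card hsub
  rw [Nat.card_Icc] at h1
  have h2 : (S.card : ℝ) ≤ ⌊R⌋₊ + 1 := by exact_mod_cast (by omega : S.card ≤ ⌊R⌋₊ + 1)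
  linarith [Nat.floor_le hR]

/-- Integers with two prime factors that are far apart, the smaller of them in a dyadic
interval. -/
lemma card_le_of_gap_dyadic {B : Finset ℕ}
    (hB : ∀ m ∈ B, ∀ n ∈ B, m ≤ n → Nat.totient m ≤ Nat.totient n)
    {x L : ℝ} (hx : 1 ≤ Real.log x) (hx1 : 1 ≤ x) (hL : 2 ≤ L) (k : ℕ)
    (hn : ∀ n ∈ B, 1 ≤ n ∧ (n : ℝ) ≤ x ∧ ∃ a p q : ℕ, n = a * p * q ∧ p.Prime ∧ q.Prime ∧
      2 ^ k ≤ p ∧ p < 2 ^ (k + 1) ∧ L * p ≤ q ∧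
      Nat.totient n = Nat.totient a * Nat.totient p * Nat.totient q) :
    (B.card : ℝ) ≤ 60 * (Real.log x ^ 2 * (x * (24 / L + 1 / 2 ^ k))) := by
  set P : ℝ := 2 ^ k with hP
  have hP1 : 1 ≤ P := one_le_pow₀ (by norm_num)
  have hL0 : 0 < L := by linarith
  have hP0 : 0 < P := by linarith
  have hδ1 : 2 / (L * P) ≤ 1 := by
    rw [div_le_one (by positivity)]; nlinarith
  have h := card_le_of_card_window_le hB hx hx1 (δ := 2 / (L * P)) (E := P) (T := 24 * P / L + 1)
    (by positivity) hδ1 hP0 ((Finset.Ico (2 ^ k) (2 ^ (k + 1))).filter Nat.Prime) ?_ ?_ ?_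
  · refine h.trans (le_of_eq ?_)
    field_simp
  · intro e he
    rw [Finset.mem_filter, Finset.mem_Ico] at he
    rw [hP]; exact_mod_cast he.1.1
  · intro t
    refine card_le_of_forall_sub_le (by positivity) fun a ha b hb hab => ?_
    simp only [Finset.mem_filter, Finset.mem_Ico] at ha hb
    obtain ⟨⟨⟨ha1, ha2⟩, hap⟩, ha3, ha4⟩ := ha
    obtain ⟨⟨⟨hb1, hb2⟩, hbp⟩, hb3, hb4⟩ := hb
    have ha0 : (0 : ℝ) < a := by exact_mod_cast hap.pos
    have hb0 : (0 : ℝ) < b := by exact_mod_cast hbp.pos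
    have hr : ∀ p : ℕ, p.Prime → (Nat.totient p : ℝ) / p = 1 - 1 / p := fun p hp => by
      have : (p : ℝ) ≠ 0 := by exact_mod_cast hp.ne_zero
      rw [Nat.totient_prime hp, Nat.cast_sub hp.one_le]
      field_simp
      simp
    have h1 : (Nat.totient a : ℝ) / a ≤ Nat.totient b / b := by
      rw [hr a hap, hr b hbp]
      have : (a : ℝ) ≤ b := by exact_mod_cast hab
      gcongr
    have h2 := sub_le_log_sub_log (totient_div_self_pos hap.one_le) h1 (totient_div_self_le_one b)
    have h3 : (Nat.totient b : ℝ) / b - Nat.totient a / a ≤ 3 * (2 / (L * P)) := by linarith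
    have h4 : (Nat.totient b : ℝ) / b - Nat.totient a / a = (b - a) / (a * b) := by
      rw [hr a hap, hr b hbp]; field_simp; ring
    rw [h4, div_le_iff₀ (by positivity)] at h3
    have ha5 : (a : ℝ) ≤ 2 * P := by
      have : (a : ℝ) < 2 ^ (k + 1) := by exact_mod_cast ha2
      rw [pow_succ] at this; linarith
    have hb5 : (b : ℝ) ≤ 2 * P := by
      have : (b : ℝ) < 2 ^ (k + 1) := by exact_mod_cast hb2
      rw [pow_succ] at this; linarith
    calc (b : ℝ) - a ≤ 3 * (2 / (L * P)) * (a * b) := h3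
      _ ≤ 3 * (2 / (L * P)) * (2 * P * (2 * P)) := by gcongr
      _ = _ := by field_simp; ring
  · intro n hnB
    obtain ⟨hn1, hnx, a, p, q, hnq, hp, hq, hpk, hpk', hpq, hφ⟩ := hn n hnB
    refine ⟨hn1, hnx, a, p, q, hnq, hq, ?_, ?_, hφ⟩
    · rw [div_div_eq_mul_div, mul_div_cancel_left₀ _ (two_ne_zero)]
      refine le_trans ?_ hpq
      have : P ≤ p := by rw [hP]; exact_mod_cast hpk
      gcongr
    · rw [Finset.mem_filter, Finset.mem_Ico]; exact ⟨⟨hpk, hpk'⟩, hp⟩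

lemma card_le_of_gap {B : Finset ℕ}
    (hB : ∀ m ∈ B, ∀ n ∈ B, m ≤ n → Nat.totient m ≤ Nat.totient n)
    {x : ℝ} (hx : 2 ≤ Real.log x) (hx1 : 1 ≤ x)
    (hn : ∀ n ∈ B, 1 ≤ n ∧ (n : ℝ) ≤ x ∧ ∃ a p q : ℕ, n = a * p * q ∧ p.Prime ∧ q.Prime ∧
      Real.log x ^ 5 ≤ p ∧ Real.log x ^ 5 * p ≤ q ∧
      Nat.totient n = Nat.totient a * Nat.totient p * Nat.totient q) :
    (B.card : ℝ) ≤ 5000 * (x / Real.log x ^ 2) := by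
  classical
  set l := Real.log x with hl
  have hx0 : 0 < x := by linarith
  have hl0 : 0 < l := by linarith
  have hl5 : 2 ≤ l ^ 5 := by
    have : (2 : ℝ) ^ 5 ≤ l ^ 5 := by gcongr
    linarith
  set R : ℕ → ℕ → Prop := fun k n => ∃ a p q : ℕ, n = a * p * q ∧ p.Prime ∧ q.Prime ∧
      2 ^ k ≤ p ∧ p < 2 ^ (k + 1) ∧ l ^ 5 * p ≤ q ∧ l ^ 5 ≤ p ∧
      Nat.totient n = Nat.totient a * Nat.totient p * Nat.totient q with hR
  have hcov : B ⊆ (Finset.range (⌊2 * l⌋₊ + 1)).biUnion fun k => B.filter (R k) := by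
    intro n h
    obtain ⟨hn1, hnx, a, p, q, rfl, hp, hq, hp5, hpq, hφ⟩ := hn n h
    simp only [Finset.mem_biUnion, Finset.mem_filter, Finset.mem_range]
    have h1 := Nat.pow_log_le_self 2 hp.ne_zero
    have h2 := Nat.lt_pow_succ_log_self (b := 2) one_lt_two p
    refine ⟨Nat.log 2 p, ?_, h, a, p, q, rfl, hp, hq, h1, h2, hpq, hp5, hφ⟩
    rw [Nat.lt_succ_iff]
    refine Nat.le_floor ?_
    have h3 : ((2 : ℝ) ^ Nat.log 2 p) ≤ x := by
      have ha : 0 < a := Nat.pos_of_ne_zero fun h0 => by simp [h0] at hn1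
      have h4 : p ≤ a * p * q := by
        rw [mul_comm a p, mul_assoc]
        exact Nat.le_mul_of_pos_right p (Nat.mul_pos ha hq.pos)
      exact le_trans (by exact_mod_cast h1.trans h4) hnx
    have h4 := Real.log_le_log (by positivity) h3
    rw [Real.log_pow, ← hl] at h4
    have h5 := Real.log_two_gt_d9
    have h6 : (0 : ℝ) ≤ (Nat.log 2 p : ℕ) := Nat.cast_nonneg _
    nlinarith
  have hk : ∀ k, ((B.filter (R k)).card : ℝ) ≤ 60 * (l ^ 2 * (x * (26 / l ^ 5))) := by
    intro k
    rcases (B.filter (R k)).eq_empty_or_nonempty with he | ⟨n₀, hn₀⟩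
    · rw [he]; simp only [Finset.card_empty, Nat.cast_zero]; positivity
    have h := card_le_of_gap_dyadic (B := B.filter (R k))
      (fun m hm n hn' => hB m (Finset.mem_filter.mp hm).1 n (Finset.mem_filter.mp hn').1)
      (x := x) (L := l ^ 5) (by linarith) hx1 hl5 k fun n hn' => by
        obtain ⟨hnB, a, p, q, h1, h2, h3, h4, h5, h6, -, h7⟩ := Finset.mem_filter.mp hn'
        exact ⟨(hn n hnB).1, (hn n hnB).2.1, a, p, q, h1, h2, h3, h4, h5, h6, h7⟩
    refine h.trans ?_
    obtain ⟨-, a, p, q, h1, h2, h3, h4, h5, h6, h8, h7⟩ := Finset.mem_filter.mp hn₀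
    have h9 : 1 / (2 : ℝ) ^ k ≤ 2 / l ^ 5 := by
      have h10 : (p : ℝ) < 2 ^ (k + 1) := by exact_mod_cast h5
      rw [pow_succ] at h10
      rw [div_le_div_iff₀ (by positivity) (by positivity)]
      linarith
    have h11 : 24 / l ^ 5 + 1 / 2 ^ k ≤ 26 / l ^ 5 := by
      calc _ ≤ 24 / l ^ 5 + 2 / l ^ 5 := by linarith
        _ = _ := by rw [← add_div]; norm_num
    gcongr
  have h1 := (Finset.card_le_card hcov).trans Finset.card_biUnion_le
  have h2 : (B.card : ℝ) ≤ ∑ k ∈ Finset.range (⌊2 * l⌋₊ + 1), ((B.filter (R k)).card : ℝ) := by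
    exact_mod_cast h1
  refine (h2.trans (Finset.sum_le_card_nsmul _ _ _ fun k _ => hk k)).trans ?_
  rw [Finset.card_range, nsmul_eq_mul]
  have h3 : ((⌊2 * l⌋₊ + 1 : ℕ) : ℝ) ≤ 3 * l := by
    push_cast
    linarith [Nat.floor_le (show 0 ≤ 2 * l by linarith)]
  calc _ ≤ 3 * l * (60 * (l ^ 2 * (x * (26 / l ^ 5)))) := by gcongr
    _ = 4680 * (x / l ^ 2) := by field_simp; ring
    _ ≤ _ := by gcongr; norm_num

lemma exists_dvd_coprime_squarefree {d : ℕ} (hd : d ≠ 0) {T : ℝ}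
    (hT : ∀ b : ℕ, b ^ 2 ∣ d → (b : ℝ) < T) :
    ∃ e f : ℕ, d = e * f ∧ e.Coprime f ∧ Squarefree e ∧ (d : ℝ) ≤ T ^ 3 * e := by
  obtain ⟨t, b, hbt, ht⟩ := Nat.sq_mul_squarefree d
  have hb := hT b ⟨t, hbt.symm⟩
  have hb0 : 0 < b := Nat.pos_of_ne_zero fun h => hd (by rw [← hbt, h]; simp)
  set g := Nat.gcd t b with hg
  obtain ⟨t', ht'⟩ : g ∣ t := Nat.gcd_dvd_left t b
  have hgt : g.Coprime t' := Nat.coprime_of_squarefree_mul (ht' ▸ ht)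
  have hbt' : t'.Coprime b := by
    refine Nat.Coprime.symm (Nat.coprime_of_dvd fun k hk hkb hkt => ?_)
    have h1 : k ∣ g := Nat.dvd_gcd (ht' ▸ Dvd.dvd.mul_left hkt g) hkb
    exact hk.one_lt.ne' (Nat.eq_one_of_dvd_coprimes hgt h1 hkt)
  refine ⟨t', b ^ 2 * g, ?_, ?_, ?_, ?_⟩
  · rw [← hbt, ht']; ring
  · exact Nat.Coprime.mul_right (hbt'.pow_right 2) hgt.symm
  · exact ht.squarefree_of_dvd ⟨g, by rw [ht']; ring⟩
  · have hgb : (g : ℝ) ≤ b := by exact_mod_cast Nat.le_of_dvd hb0 (Nat.gcd_dvd_right t b)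
    have h1 : (d : ℝ) = b ^ 2 * g * t' := by
      rw [← hbt, ht']; push_cast; ring
    rw [h1]
    have h2 : (b : ℝ) ^ 2 * g ≤ T ^ 3 := by
      calc (b : ℝ) ^ 2 * g ≤ T ^ 2 * T := by gcongr; exact hgb.trans hb.le
        _ = _ := by ring
    gcongr

lemma exists_dvd_le_mul {d : ℕ} (hd : d ≠ 0) {E P : ℝ} (hE : 1 < E) (hdE : E ≤ d)
    (hP : ∀ p : ℕ, p.Prime → p ∣ d → (p : ℝ) < P) : ∃ e : ℕ, e ∣ d ∧ E ≤ e ∧ (e : ℝ) ≤ E * P := by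
  classical
  have hex : ∃ e : ℕ, e ∣ d ∧ E ≤ e := ⟨d, dvd_rfl, hdE⟩
  set e := Nat.find hex with he
  obtain ⟨h1, h2⟩ := Nat.find_spec hex
  refine ⟨e, h1, h2, ?_⟩
  have he1 : e ≠ 1 := by
    intro h; rw [← he, h] at h2; norm_num at h2; linarith
  obtain ⟨p, hp, f, hf⟩ := Nat.exists_prime_and_dvd he1
  have he0 : 0 < e := Nat.pos_of_ne_zero fun h => by
    rw [← he, h] at h1; exact hd (zero_dvd_iff.mp h1)
  have hf0 : 0 < f := Nat.pos_of_ne_zero fun h => by rw [h] at hf; omega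
  have hfe : f < e := by rw [hf]; exact (Nat.lt_mul_iff_one_lt_left hf0).mpr hp.one_lt
  have hfE : (f : ℝ) < E := by
    have := Nat.find_min hex hfe
    by_contra hcon
    exact this ⟨(Dvd.intro_left p hf.symm).trans h1, not_lt.mp hcon⟩
  have hpP := hP p hp ((Dvd.intro f hf.symm).trans h1)
  rw [hf]
  push_cast
  rw [mul_comm]
  gcongr

/-- Integers with a large smooth part. -/
lemma card_le_of_smooth_part {B : Finset ℕ}
    (hB : ∀ m ∈ B, ∀ n ∈ B, m ≤ n → Nat.totient m ≤ Nat.totient n)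
    {x : ℝ} (hx : 2 ≤ Real.log x) (hx1 : 1 ≤ x)
    (hn : ∀ n ∈ B, 1 ≤ n ∧ (n : ℝ) ≤ x ∧ (∀ b : ℕ, b ^ 2 ∣ n → (b : ℝ) < Real.log x ^ 3) ∧
      ∃ c d q : ℕ, n = c * d * q ∧ c.Coprime d ∧ (c * d).Coprime q ∧ q.Prime ∧
      8 * Real.log x ^ 18 ≤ q ∧ Real.log x ^ 13 < d ∧
      ∀ p : ℕ, p.Prime → p ∣ d → (p : ℝ) < Real.log x ^ 5) :
    (B.card : ℝ) ≤ 60 * (x / Real.log x ^ 2) := by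
  classical
  set l := Real.log x with hl
  have hl0 : 0 < l := by linarith
  have hl1 : 1 ≤ l := by linarith
  have hpow : ∀ k : ℕ, 1 ≤ l ^ k := fun k => one_le_pow₀ hl1
  have hdel : 1 / (4 * (l ^ 9) ^ 2) ≤ 1 := by
    rw [div_le_one (by positivity)]
    have := hpow 18
    rw [← pow_mul]; norm_num; linarith
  have h := card_le_of_card_window_le hB (x := x) (by linarith) hx1 (δ := 1 / (4 * (l ^ 9) ^ 2))
    (E := l ^ 4) (T := 1) (by positivity) hdel (by positivity)
    ((Finset.Icc 1 ⌊l ^ 9⌋₊).filter fun e : ℕ => Squarefree e ∧ l ^ 4 ≤ (e : ℝ)) ?_ ?_ ?_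
  · rw [← hl] at h
    refine h.trans (le_of_eq ?_)
    field_simp
  · intro e he
    exact (Finset.mem_filter.mp he).2.2
  · intro t
    have : ((((Finset.Icc 1 ⌊l ^ 9⌋₊).filter fun e : ℕ => Squarefree e ∧ l ^ 4 ≤ (e : ℝ)).filter
        fun e => t < Real.log (Nat.totient e / e) ∧
        Real.log (Nat.totient e / e) ≤ t + 3 * (1 / (4 * (l ^ 9) ^ 2))).card) ≤ 1 := by
      refine Finset.card_le_one.mpr fun a ha b hb => ?_
      simp only [Finset.mem_filter, Finset.mem_Icc] at ha hb
      obtain ⟨⟨⟨ha1, ha2⟩, hasq, -⟩, ha3, ha4⟩ := ha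
      obtain ⟨⟨⟨hb1, hb2⟩, hbsq, -⟩, hb3, hb4⟩ := hb
      have hlt : 3 * (1 / (4 * (l ^ 9) ^ 2)) < 1 / (l ^ 9) ^ 2 := by
        rw [one_div, mul_inv]
        have : 0 < ((l ^ 9) ^ 2)⁻¹ := by positivity
        rw [one_div]
        linarith
      have h1 := primeFactors_eq_of_abs_log_totient_div_lt (D := l ^ 9) ha1 hb1
        ((Nat.le_floor_iff (by positivity)).mp ha2) ((Nat.le_floor_iff (by positivity)).mp hb2)
        (by rw [abs_lt]; constructor <;> linarith)
      rw [← Nat.prod_primeFactors_of_squarefree hasq, h1, Nat.prod_primeFactors_of_squarefree hbsq]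
    exact_mod_cast this
  · intro n hnB
    obtain ⟨hn1, hnx, hsq, c, d, q, rfl, hcd, hcdq, hq, hq18, hd13, hdP⟩ := hn n hnB
    have hd0 : d ≠ 0 := fun h => by simp [h] at hn1
    obtain ⟨s, f, hsf, hcop, hs, hds⟩ := exists_dvd_coprime_squarefree hd0 (T := l ^ 3)
      fun b hb => hsq b ((hb.mul_left c).mul_right q)
    have hs0 : s ≠ 0 := hs.ne_zero
    have hs4 : l ^ 4 ≤ s := by
      have : (l ^ 3) ^ 3 * l ^ 4 ≤ (l ^ 3) ^ 3 * s := by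
        calc (l ^ 3) ^ 3 * l ^ 4 = l ^ 13 := by ring
          _ ≤ _ := hd13.le.trans hds
      exact le_of_mul_le_mul_left this (by positivity)
    have hl4 : 1 < l ^ 4 := one_lt_pow₀ (by linarith) (by norm_num)
    obtain ⟨e, hes, he4, heP⟩ := exists_dvd_le_mul hs0 hl4 hs4 (P := l ^ 5)
      fun p hp hps => hdP p hp (hps.trans ⟨f, hsf⟩)
    obtain ⟨s', hs'⟩ := hes
    have hesq : Squarefree e := hs.squarefree_of_dvd ⟨s', hs'⟩
    have hes' : e.Coprime s' := Nat.coprime_of_squarefree_mul (hs' ▸ hs)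
    have hec : e.Coprime c := (hcd.coprime_dvd_right
      (show e ∣ d from ⟨s' * f, by rw [hsf, hs']; ring⟩)).symm
    have hef : e.Coprime f := hcop.coprime_dvd_left ⟨s', hs'⟩
    have hae : (c * s' * f).Coprime e :=
      (Nat.Coprime.mul_right (Nat.Coprime.mul_right hec hes') hef).symm
    refine ⟨hn1, hnx, c * s' * f, e, q, ?_, hq, ?_, ?_, ?_⟩
    · rw [hsf, hs']; ring
    · rw [div_div_eq_mul_div, div_one]
      refine le_trans (le_of_eq ?_) hq18
      ring
    · rw [Finset.mem_filter, Finset.mem_Icc]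
      refine ⟨⟨Nat.pos_of_ne_zero hesq.ne_zero, Nat.le_floor (heP.trans (le_of_eq (by ring)))⟩,
        hesq, he4⟩
    · have h1 : c * d = c * s' * f * e := by rw [hsf, hs']; ring
      rw [Nat.totient_mul hcdq, h1, Nat.totient_mul hae]

/-- The natural numbers in `[1, x]`. -/
noncomputable def natsUpTo (x : ℝ) : Finset ℕ := Finset.Icc 1 ⌊x⌋₊

lemma mem_natsUpTo {x : ℝ} (hx : 0 ≤ x) {n : ℕ} : n ∈ natsUpTo x ↔ 1 ≤ n ∧ (n : ℝ) ≤ x := by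
  rw [natsUpTo, Finset.mem_Icc, Nat.le_floor_iff hx]

lemma card_filter_dvd_natsUpTo_le {x : ℝ} (hx : 0 ≤ x) {d : ℕ} (hd : 0 < d) :
    (((natsUpTo x).filter fun n => d ∣ n).card : ℝ) ≤ x / d := by
  have h1 : ((natsUpTo x).filter fun n => d ∣ n) ⊆ (natsUpTo (x / d)).image fun m => d * m := by
    intro n hn
    obtain ⟨h1, m, rfl⟩ := Finset.mem_filter.mp hn
    rw [mem_natsUpTo hx] at h1
    have hd0 : (0 : ℝ) < d := by exact_mod_cast hd
    refine Finset.mem_image.mpr ⟨m, (mem_natsUpTo (by positivity)).mpr ⟨?_, ?_⟩, rfl⟩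
    · exact Nat.pos_of_ne_zero fun h => by simp [h] at h1
    · rw [le_div_iff₀ hd0, mul_comm]; exact_mod_cast h1.2
  have h2 := (Finset.card_le_card h1).trans Finset.card_image_le
  have h3 : ((natsUpTo (x / d)).card : ℝ) ≤ x / d := by
    rw [natsUpTo, Nat.card_Icc, Nat.add_sub_cancel]
    exact Nat.floor_le (by positivity)
  exact le_trans (by exact_mod_cast h2) h3

lemma sum_inv_sq_le (a b : ℕ) (ha : 1 ≤ a) :
    ∑ n ∈ Finset.Ioc a b, (1 / (n : ℝ) ^ 2) ≤ 1 / (a : ℝ) := by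
  rcases le_total b a with h | h
  · rw [Finset.Ioc_eq_empty (by omega)]; simp
  · have h1 : ∑ n ∈ Finset.Ioc a b, (1 / (n : ℝ) ^ 2) ≤ 1 / (a : ℝ) - 1 / b := by
      induction b, h using Nat.le_induction with
      | base => simp
      | succ b hb ih =>
        rw [Finset.sum_Ioc_succ_top (by omega)]
        have hb0 : (0 : ℝ) < b := by exact_mod_cast (by omega : 0 < b)
        have : 1 / ((b + 1 : ℕ) : ℝ) ^ 2 ≤ 1 / b - 1 / ((b + 1 : ℕ) : ℝ) := by
          push_cast
          rw [div_sub_div _ _ hb0.ne' (by positivity), div_le_div_iff₀ (by positivity) (by positivity)]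
          nlinarith
        linarith
    have : (0 : ℝ) ≤ 1 / b := by positivity
    linarith

/-- Few integers are divisible by a large square. -/
lemma card_le_of_sq_dvd {B : Finset ℕ} {x T : ℝ} (hx : 0 ≤ x) (hT : 2 ≤ T)
    (hn : ∀ n ∈ B, 1 ≤ n ∧ (n : ℝ) ≤ x ∧ ∃ b : ℕ, b ^ 2 ∣ n ∧ T ≤ b) :
    (B.card : ℝ) ≤ 2 * (x / (T - 1)) := by
  classical
  have hcov : B ⊆ (Finset.Ioc (⌈T⌉₊ - 1) ⌊x⌋₊).biUnion fun b =>
      (natsUpTo x).filter fun n => b ^ 2 ∣ n := by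
    intro n h
    obtain ⟨h1, h2, b, hb, hTb⟩ := hn n h
    simp only [Finset.mem_biUnion, Finset.mem_filter, Finset.mem_Ioc]
    have hb1 : ⌈T⌉₊ ≤ b := Nat.ceil_le.mpr hTb
    have hb2 : 0 < ⌈T⌉₊ := Nat.ceil_pos.mpr (by linarith)
    refine ⟨b, ⟨by omega, ?_⟩, (mem_natsUpTo hx).mpr ⟨h1, h2⟩, hb⟩
    exact ((Nat.le_self_pow two_ne_zero b).trans (Nat.le_of_dvd h1 hb)).trans (Nat.le_floor h2)
  have hc1 : 2 ≤ ⌈T⌉₊ := by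
    have : (2 : ℝ) ≤ ⌈T⌉₊ := hT.trans (Nat.le_ceil T)
    exact_mod_cast this
  have h1 : (B.card : ℝ) ≤ ∑ b ∈ Finset.Ioc (⌈T⌉₊ - 1) ⌊x⌋₊,
      (((natsUpTo x).filter fun n => b ^ 2 ∣ n).card : ℝ) := by
    exact_mod_cast (Finset.card_le_card hcov).trans Finset.card_biUnion_le
  have hT1 : T - 1 ≤ ((⌈T⌉₊ - 1 : ℕ) : ℝ) := by
    rw [Nat.cast_sub (by omega)]
    have := Nat.le_ceil T
    push_cast; linarith
  calc (B.card : ℝ) ≤ ∑ b ∈ Finset.Ioc (⌈T⌉₊ - 1) ⌊x⌋₊, x * (1 / (b : ℝ) ^ 2) := by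
        refine h1.trans (Finset.sum_le_sum fun b hb => ?_)
        have hb0 : 0 < b := by rw [Finset.mem_Ioc] at hb; omega
        refine (card_filter_dvd_natsUpTo_le hx (pow_pos hb0 2)).trans (le_of_eq ?_)
        push_cast; ring
    _ ≤ x * (1 / ((⌈T⌉₊ - 1 : ℕ) : ℝ)) := by
        rw [← Finset.mul_sum]
        exact mul_le_mul_of_nonneg_left (sum_inv_sq_le _ _ (by omega)) hx
    _ ≤ x * (1 / (T - 1)) := by
        have : 0 < T - 1 := by linarith
        gcongr
    _ ≤ _ := by
        have : 0 ≤ x / (T - 1) := div_nonneg hx (by linarith)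
        rw [mul_one_div]; linarith

lemma sum_card_divisors_natsUpTo_le {x : ℝ} (hx : 1 ≤ x) :
    ∑ n ∈ natsUpTo x, (n.divisors.card : ℝ) ≤ x * (1 + Real.log x) := by
  have h1 : ∀ n ∈ natsUpTo x, (n.divisors.card : ℝ)
      = ∑ d ∈ natsUpTo x, if d ∣ n then (1 : ℝ) else 0 := by
    intro n hn
    rw [Finset.sum_boole]
    congr 2
    rw [natsUpTo, Finset.mem_Icc] at hn
    ext d
    rw [Nat.mem_divisors, Finset.mem_filter, natsUpTo, Finset.mem_Icc]
    constructor
    · rintro ⟨hd, h0⟩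
      exact ⟨⟨Nat.pos_of_dvd_of_pos hd hn.1, (Nat.le_of_dvd hn.1 hd).trans hn.2⟩, hd⟩
    · rintro ⟨-, hd⟩
      exact ⟨hd, by omega⟩
  rw [Finset.sum_congr rfl h1, Finset.sum_comm]
  calc _ ≤ ∑ d ∈ natsUpTo x, x * (d : ℝ)⁻¹ := by
        refine Finset.sum_le_sum fun d hd => ?_
        rw [Finset.sum_boole, ← div_eq_mul_inv]
        exact card_filter_dvd_natsUpTo_le (by linarith) (Finset.mem_Icc.mp hd).1
    _ ≤ _ := by
        rw [← Finset.mul_sum]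
        refine mul_le_mul_of_nonneg_left ?_ (by linarith)
        have := harmonic_floor_le_one_add_log x hx
        rw [harmonic_eq_sum_Icc] at this
        push_cast at this
        exact this

lemma two_pow_card_primeFactors_le {t n : ℕ} (hn : n ≠ 0) (htn : t ∣ n) :
    2 ^ t.primeFactors.card ≤ n.divisors.card := by
  rw [← Finset.card_powerset]
  refine Finset.card_le_card_of_injOn (fun s => ∏ p ∈ s, p) ?_ ?_
  · intro s hs
    have hs' := Finset.mem_powerset.mp hs
    rw [Finset.mem_coe, Nat.mem_divisors]
    refine ⟨((Finset.prod_dvd_prod_of_subset _ _ _ hs').trans (Nat.prod_primeFactors_dvd t)).trans htn,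
      hn⟩
  · intro s hs s' hs' h
    have key : ∀ s ∈ t.primeFactors.powerset, (∏ p ∈ s, p).primeFactors = s := fun s hs =>
      Nat.primeFactors_prod fun p hp =>
        Nat.prime_of_mem_primeFactors (Finset.mem_powerset.mp hs hp)
    rw [← key s hs, ← key s' hs']
    exact congrArg Nat.primeFactors h

/-- Few integers without a large square divisor have only small prime factors. -/
lemma card_le_of_forall_prime_le {B : Finset ℕ} {x Y T u : ℝ} (hx : 1 ≤ x) {k : ℕ} (hY : 1 ≤ Y)
    (hT : 0 < T) (hu : T ^ 2 * Y ^ k ≤ u)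
    (hn : ∀ n ∈ B, 1 ≤ n ∧ (n : ℝ) ≤ x ∧ u < n ∧ (∀ b : ℕ, b ^ 2 ∣ n → (b : ℝ) < T) ∧
      ∀ p : ℕ, p.Prime → p ∣ n → (p : ℝ) ≤ Y) :
    (B.card : ℝ) * 2 ^ k ≤ x * (1 + Real.log x) := by
  refine le_trans ?_ (sum_card_divisors_natsUpTo_le hx)
  have hsub : B ⊆ natsUpTo x := fun n h =>
    (mem_natsUpTo (by linarith)).mpr ⟨(hn n h).1, (hn n h).2.1⟩
  rw [← nsmul_eq_mul, ← Finset.sum_const]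
  refine (Finset.sum_le_sum fun n h => ?_).trans
    (Finset.sum_le_sum_of_subset_of_nonneg hsub fun _ _ _ => Nat.cast_nonneg _)
  obtain ⟨hn1, hnx, hun, hsq, hp⟩ := hn n h
  obtain ⟨t, b, hbt, ht⟩ := Nat.sq_mul_squarefree n
  have hb := hsq b ⟨t, hbt.symm⟩
  have htn : t ∣ n := Dvd.intro_left _ hbt
  have hk : k ≤ t.primeFactors.card := by
    by_contra! hlt
    have h1 : (t : ℝ) ≤ Y ^ t.primeFactors.card := by
      conv_lhs => rw [← Nat.prod_primeFactors_of_squarefree ht]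
      push_cast
      rw [← Finset.prod_const]
      refine Finset.prod_le_prod (fun p _ => Nat.cast_nonneg p) fun p hp' => ?_
      exact hp p (Nat.prime_of_mem_primeFactors hp') ((Nat.dvd_of_mem_primeFactors hp').trans htn)
    have h2 : (n : ℝ) = b ^ 2 * t := by rw [← hbt]; push_cast; ring
    have h3 : (n : ℝ) ≤ T ^ 2 * Y ^ k := by
      rw [h2]
      have : Y ^ t.primeFactors.card ≤ Y ^ k := pow_le_pow_right₀ hY hlt.le
      gcongr
      exact h1.trans this
    linarith
  calc (2 : ℝ) ^ k ≤ 2 ^ t.primeFactors.card := pow_le_pow_right₀ (by norm_num) hk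
    _ ≤ _ := by exact_mod_cast two_pow_card_primeFactors_le (by omega) htn

lemma theta_le_three_halves_mul {u : ℝ} (hu : 0 ≤ u) : Chebyshev.theta u ≤ 3 / 2 * u := by
  refine (Chebyshev.theta_le_log4_mul_x hu).trans ?_
  have : Real.log 4 ≤ 3 / 2 := by
    rw [show (4 : ℝ) = 2 ^ 2 by norm_num, Real.log_pow]
    have := Real.log_two_lt_d9
    push_cast; linarith
  gcongr

lemma sum_log_primesIoc_le {z u : ℝ} (hu : 0 ≤ u) :
    ∑ p ∈ primesIoc z u, Real.log p ≤ 3 / 2 * u := by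
  refine le_trans ?_ (theta_le_three_halves_mul hu)
  refine Finset.sum_le_sum_of_subset_of_nonneg ?_ fun p _ _ => Real.log_natCast_nonneg p
  exact Finset.filter_subset_filter _ (Finset.Ioc_subset_Ioc_left (Nat.zero_le _))

lemma card_primesIoc_mul_log_le {z u : ℝ} (hz : 1 ≤ z) (hu : 0 ≤ u) :
    ((primesIoc z u).card : ℝ) * Real.log z ≤ 3 / 2 * u := by
  rw [← nsmul_eq_mul, ← Finset.sum_const]
  refine (Finset.sum_le_sum fun p hp => ?_).trans (sum_log_primesIoc_le (z := z) hu)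
  rw [mem_primesIoc (by linarith) hu] at hp
  exact Real.log_le_log (by linarith) hp.2.1.le

lemma sum_inv_primesIoc_two_mul_le {z : ℝ} (hz : 1 < z) :
    ∑ p ∈ primesIoc z (2 * z), (p : ℝ)⁻¹ ≤ 3 / Real.log z := by
  have hz0 : 0 < z := by linarith
  have hl : 0 < Real.log z := Real.log_pos hz
  calc ∑ p ∈ primesIoc z (2 * z), (p : ℝ)⁻¹
      ≤ ∑ p ∈ primesIoc z (2 * z), z⁻¹ := by
        refine Finset.sum_le_sum fun p hp => ?_
        rw [mem_primesIoc hz0.le (by linarith)] at hp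
        have := hp.2.1
        gcongr
    _ = (primesIoc z (2 * z)).card * z⁻¹ := by rw [Finset.sum_const, nsmul_eq_mul]
    _ ≤ _ := by
        have h := card_primesIoc_mul_log_le (z := z) (u := 2 * z) hz.le (by linarith)
        rw [← div_eq_mul_inv, div_le_div_iff₀ hz0 hl]
        linarith

lemma primesIoc_subset_union {u v w : ℝ} (hu : 0 ≤ u) (hv : 0 ≤ v) (hw : 0 ≤ w) :
    primesIoc u w ⊆ primesIoc u v ∪ primesIoc v w := by
  intro p hp
  rw [mem_primesIoc hu hw] at hp
  rw [Finset.mem_union, mem_primesIoc hu hv, mem_primesIoc hv hw]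
  rcases le_or_gt (p : ℝ) v with h | h
  · exact Or.inl ⟨hp.1, hp.2.1, h⟩
  · exact Or.inr ⟨hp.1, h, hp.2.2⟩

lemma sum_inv_primesIoc_two_pow_mul_le {z : ℝ} (hz : 1 < z) (k : ℕ) :
    ∑ p ∈ primesIoc z (2 ^ k * z), (p : ℝ)⁻¹ ≤ k * (3 / Real.log z) := by
  have hz0 : 0 < z := by linarith
  have hl : 0 < Real.log z := Real.log_pos hz
  induction k with
  | zero => simp [primesIoc]
  | succ k ih =>
    have h1 : (1 : ℝ) ≤ 2 ^ k := one_le_pow₀ (by norm_num)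
    have hzk : z ≤ 2 ^ k * z := le_mul_of_one_le_left hz0.le h1
    have h2 := sum_inv_primesIoc_two_mul_le (z := 2 ^ k * z) (by linarith)
    have h3 : 3 / Real.log (2 ^ k * z) ≤ 3 / Real.log z := by gcongr
    have h4 : ∑ p ∈ primesIoc z (2 ^ (k + 1) * z), (p : ℝ)⁻¹ ≤
        ∑ p ∈ primesIoc z (2 ^ k * z), (p : ℝ)⁻¹ +
        ∑ p ∈ primesIoc (2 ^ k * z) (2 * (2 ^ k * z)), (p : ℝ)⁻¹ := by
      rw [show 2 * (2 ^ k * z) = 2 ^ (k + 1) * z by ring, ← Finset.sum_union_inter]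
      refine le_trans (Finset.sum_le_sum_of_subset_of_nonneg
        (primesIoc_subset_union hz0.le (by linarith : 0 ≤ 2 ^ k * z) (by positivity))
        fun _ _ _ => by positivity) ?_
      exact le_add_of_nonneg_right (Finset.sum_nonneg fun _ _ => by positivity)
    push_cast
    linarith

/-- An upper bound for the sum of reciprocals of the primes in `(z, R z]`. -/
lemma sum_inv_primesIoc_mul_le {z R : ℝ} (hz : 1 < z) (hR : 1 ≤ Real.log R) (hR0 : 0 < R) :
    ∑ p ∈ primesIoc z (R * z), (p : ℝ)⁻¹ ≤ 8 * Real.log R / Real.log z := by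
  have hz0 : 0 < z := by linarith
  have hl : 0 < Real.log z := Real.log_pos hz
  have hl2 := Real.log_two_gt_d9
  set k := ⌈Real.log R / Real.log 2⌉₊ with hk
  have hk1 : Real.log R ≤ k * Real.log 2 := by
    rw [← div_le_iff₀ (by linarith)]; exact Nat.le_ceil _
  have hk2 : (k : ℝ) < Real.log R / Real.log 2 + 1 := Nat.ceil_lt_add_one (by positivity)
  have hRk : R ≤ 2 ^ k := by
    rw [← Real.log_le_log_iff hR0 (by positivity), Real.log_pow]; exact hk1
  have hk3 : (k : ℝ) * 3 ≤ 8 * Real.log R := by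
    have : Real.log R / Real.log 2 ≤ 3 / 2 * Real.log R := by
      rw [div_le_iff₀ (by linarith)]; nlinarith
    linarith
  calc ∑ p ∈ primesIoc z (R * z), (p : ℝ)⁻¹ ≤ ∑ p ∈ primesIoc z (2 ^ k * z), (p : ℝ)⁻¹ := by
        refine Finset.sum_le_sum_of_subset_of_nonneg ?_ fun _ _ _ => by positivity
        exact Finset.filter_subset_filter _ (Finset.Ioc_subset_Ioc_right (by gcongr))
    _ ≤ k * (3 / Real.log z) := sum_inv_primesIoc_two_pow_mul_le hz k
    _ = k * 3 / Real.log z := by ring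
    _ ≤ _ := by gcongr

/-- Few integers have three large prime factors that are close together. -/
lemma card_le_of_three_close_primes {B : Finset ℕ} {x z L : ℝ} (hx : 0 < x) (hz : 1 < z)
    (hL : 1 ≤ Real.log L) (hL0 : 0 < L) (hxz : 1 ≤ Real.log (x / z))
    (hn : ∀ n ∈ B, 1 ≤ n ∧ (n : ℝ) ≤ x ∧ ∃ p q r : ℕ, p.Prime ∧ q.Prime ∧ r.Prime ∧
      p * q * r ∣ n ∧ z < p ∧ p < q ∧ (q : ℝ) ≤ L * p ∧ q < r ∧ (r : ℝ) ≤ L * q) :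
    (B.card : ℝ) ≤ x * ((8 * Real.log (x / z) / Real.log z) * (8 * Real.log L / Real.log z) ^ 2) := by
  classical
  have hz0 : 0 < z := by linarith
  have hl : 0 < Real.log z := Real.log_pos hz
  have hxx : x / z * z = x := by field_simp
  have hcov : B ⊆ (primesIoc z (x / z * z)).biUnion fun p => (primesIoc p (L * p)).biUnion fun q =>
      (primesIoc q (L * q)).biUnion fun r => (natsUpTo x).filter fun n => p * q * r ∣ n := by
    intro n h
    obtain ⟨h1, h2, p, q, r, hp, hq, hr, hd, hzp, hpq, hqL, hqr, hrL⟩ := hn n h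
    simp only [Finset.mem_biUnion, Finset.mem_filter]
    refine ⟨p, ?_, q, ?_, r, ?_, (mem_natsUpTo hx.le).mpr ⟨h1, h2⟩, hd⟩
    · rw [mem_primesIoc hz0.le (by positivity), hxx]
      have : p ≤ n := Nat.le_of_dvd h1 (((Dvd.intro q rfl).mul_right r).trans hd)
      exact ⟨hp, hzp, le_trans (by exact_mod_cast this) h2⟩
    · rw [mem_primesIoc (by positivity) (by positivity)]
      exact ⟨hq, by exact_mod_cast hpq, hqL⟩
    · rw [mem_primesIoc (by positivity) (by positivity)]
      exact ⟨hr, by exact_mod_cast hqr, hrL⟩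
  have hcard : (B.card : ℝ) ≤ ∑ p ∈ primesIoc z (x / z * z), ∑ q ∈ primesIoc p (L * p),
      ∑ r ∈ primesIoc q (L * q), (((natsUpTo x).filter fun n => p * q * r ∣ n).card : ℝ) := by
    have h1 := (Finset.card_le_card hcov).trans Finset.card_biUnion_le
    have h2 : B.card ≤ ∑ p ∈ primesIoc z (x / z * z), ∑ q ∈ primesIoc p (L * p),
      ∑ r ∈ primesIoc q (L * q), ((natsUpTo x).filter fun n => p * q * r ∣ n).card :=
      h1.trans (Finset.sum_le_sum fun p _ => Finset.card_biUnion_le.trans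
        (Finset.sum_le_sum fun q _ => Finset.card_biUnion_le))
    exact_mod_cast h2
  have hstep : ∀ p : ℕ, z < p → ∑ q ∈ primesIoc p (L * p), (q : ℝ)⁻¹ ≤ 8 * Real.log L / Real.log z := by
    intro p hp
    refine (sum_inv_primesIoc_mul_le (hz.trans hp) hL hL0).trans ?_
    gcongr
  set s := 8 * Real.log L / Real.log z with hs
  have hs0 : 0 ≤ s := by positivity
  calc (B.card : ℝ) ≤ ∑ p ∈ primesIoc z (x / z * z), ∑ q ∈ primesIoc p (L * p),
      ∑ r ∈ primesIoc q (L * q), x * ((p : ℝ)⁻¹ * (q : ℝ)⁻¹) * (r : ℝ)⁻¹ := by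
        refine hcard.trans (Finset.sum_le_sum fun p hp => Finset.sum_le_sum fun q hq =>
          Finset.sum_le_sum fun r hr => ?_)
        have hp := (Finset.mem_filter.mp hp).2.pos
        have hq := (Finset.mem_filter.mp hq).2.pos
        have hr := (Finset.mem_filter.mp hr).2.pos
        refine (card_filter_dvd_natsUpTo_le hx.le (Nat.mul_pos (Nat.mul_pos hp hq) hr)).trans
          (le_of_eq ?_)
        push_cast
        rw [div_eq_mul_inv, mul_inv, mul_inv]; ring
    _ ≤ ∑ p ∈ primesIoc z (x / z * z), ∑ q ∈ primesIoc p (L * p), x * s * (p : ℝ)⁻¹ * (q : ℝ)⁻¹ := by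
        refine Finset.sum_le_sum fun p hp => Finset.sum_le_sum fun q hq => ?_
        rw [mem_primesIoc hz0.le (by positivity)] at hp
        rw [mem_primesIoc (by positivity) (by positivity)] at hq
        rw [← Finset.mul_sum]
        have := hstep q (hp.2.1.trans hq.2.1)
        calc _ ≤ x * ((p : ℝ)⁻¹ * (q : ℝ)⁻¹) * s := by gcongr
          _ = _ := by ring
    _ ≤ ∑ p ∈ primesIoc z (x / z * z), x * s * s * (p : ℝ)⁻¹ := by
        refine Finset.sum_le_sum fun p hp => ?_
        rw [mem_primesIoc hz0.le (by positivity)] at hp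
        rw [← Finset.mul_sum]
        have := hstep p hp.2.1
        calc _ ≤ x * s * (p : ℝ)⁻¹ * s := by gcongr
          _ = _ := by ring
    _ ≤ x * s * s * (8 * Real.log (x / z) / Real.log z) := by
        rw [← Finset.mul_sum]
        have := sum_inv_primesIoc_mul_le (R := x / z) hz hxz (by positivity)
        gcongr
    _ = _ := by ring

/-- Few integers are the product of a small integer and two primes that are close together. -/
lemma card_le_of_two_close_primes {B : Finset ℕ} {x z R D : ℝ} (hx : 0 < x) (hz : 1 < z)
    (hR : 1 ≤ Real.log R) (hR0 : 0 < R) (hD : 1 ≤ D)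
    (hn : ∀ n ∈ B, 1 ≤ n ∧ (n : ℝ) ≤ x ∧ ∃ d p q : ℕ, p.Prime ∧ q.Prime ∧ n = d * p * q ∧
      (d : ℝ) ≤ D ∧ z < p ∧ (p : ℝ) ≤ R * z ∧ p < q) :
    (B.card : ℝ) ≤ x * ((1 + Real.log D) * (16 * Real.log R / Real.log z ^ 2)) := by
  classical
  have hz0 : 0 < z := by linarith
  have hl : 0 < Real.log z := Real.log_pos hz
  have hcov : B ⊆ (natsUpTo D).biUnion fun d => (primesIoc z (R * z)).biUnion fun p =>
      (primesIoc z (x / (d * p))).image fun q => d * p * q := by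
    intro n h
    obtain ⟨h1, h2, d, p, q, hp, hq, rfl, hdD, hzp, hpR, hpq⟩ := hn n h
    simp only [Finset.mem_biUnion, Finset.mem_image]
    have hd0 : 0 < d := Nat.pos_of_ne_zero fun h => by simp [h] at h1
    have hdR : (0 : ℝ) < d := by exact_mod_cast hd0
    have hpR' : (0 : ℝ) < p := by exact_mod_cast hp.pos
    refine ⟨d, (mem_natsUpTo (by linarith)).mpr ⟨hd0, hdD⟩, p, ?_, q, ?_, rfl⟩
    · rw [mem_primesIoc hz0.le (by positivity)]
      exact ⟨hp, hzp, hpR⟩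
    · rw [mem_primesIoc hz0.le (by positivity), le_div_iff₀ (by positivity)]
      push_cast at h2
      exact ⟨hq, hzp.trans (by exact_mod_cast hpq), by linarith⟩
  have hcard : (B.card : ℝ) ≤ ∑ d ∈ natsUpTo D, ∑ p ∈ primesIoc z (R * z),
      ((primesIoc z (x / (d * p))).card : ℝ) := by
    have h1 := (Finset.card_le_card hcov).trans Finset.card_biUnion_le
    have h2 : B.card ≤ ∑ d ∈ natsUpTo D, ∑ p ∈ primesIoc z (R * z), (primesIoc z (x / (d * p))).card :=
      h1.trans (Finset.sum_le_sum fun d _ => Finset.card_biUnion_le.trans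
        (Finset.sum_le_sum fun p _ => Finset.card_image_le))
    exact_mod_cast h2
  calc (B.card : ℝ) ≤ ∑ d ∈ natsUpTo D, ∑ p ∈ primesIoc z (R * z),
        2 * x / Real.log z * (d : ℝ)⁻¹ * (p : ℝ)⁻¹ := by
        refine hcard.trans (Finset.sum_le_sum fun d hd => Finset.sum_le_sum fun p hp => ?_)
        have h1 := card_primesIoc_mul_log_le (z := z) (u := x / (d * p)) hz.le (by positivity)
        rw [← le_div_iff₀ hl] at h1
        refine h1.trans ?_
        have h2 : 2 * x / Real.log z * (d : ℝ)⁻¹ * (p : ℝ)⁻¹ = 2 * (x / (d * p)) / Real.log z := by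
          rw [div_eq_mul_inv x, mul_inv]; ring
        rw [h2]
        gcongr
        norm_num
    _ ≤ ∑ d ∈ natsUpTo D, 2 * x / Real.log z * (8 * Real.log R / Real.log z) * (d : ℝ)⁻¹ := by
        refine Finset.sum_le_sum fun d hd => ?_
        rw [← Finset.mul_sum]
        have := sum_inv_primesIoc_mul_le hz hR hR0
        calc _ ≤ 2 * x / Real.log z * (d : ℝ)⁻¹ * (8 * Real.log R / Real.log z) := by gcongr
          _ = _ := by ring
    _ ≤ 2 * x / Real.log z * (8 * Real.log R / Real.log z) * (1 + Real.log D) := by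
        rw [← Finset.mul_sum]
        have := harmonic_floor_le_one_add_log D hD
        rw [harmonic_eq_sum_Icc] at this
        push_cast at this
        refine mul_le_mul_of_nonneg_left this (by positivity)
    _ = _ := by ring

lemma prod_inv_mul_prod_one_sub_inv_le_one {S : Finset ℕ} (hS : ∀ p ∈ S, p.Prime) :
    (∏ p ∈ S, (p : ℝ)⁻¹) * ∏ p ∈ S, (1 - (p : ℝ)⁻¹)⁻¹ ≤ 1 := by
  rw [← Finset.prod_mul_distrib]
  refine Finset.prod_le_one (fun p hp => ?_) fun p hp => ?_
  · have : (p : ℝ)⁻¹ ≤ 1 := inv_le_one_of_one_le₀ (by exact_mod_cast (hS p hp).one_le)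
    exact mul_nonneg (by positivity) (inv_nonneg.mpr (by linarith))
  · have h2 : (2 : ℝ) ≤ p := by exact_mod_cast (hS p hp).two_le
    have h3 : (p : ℝ)⁻¹ ≤ 2⁻¹ := by gcongr
    rw [← mul_inv, mul_sub, mul_one, mul_inv_cancel₀ (by positivity)]
    exact inv_le_one_of_one_le₀ (by linarith)

/-- The reciprocals of the integers with a given set of prime factors sum to at most one. -/
lemma sum_inv_le_one_of_primeFactors_eq {S T : Finset ℕ} (hT : ∀ d ∈ T, d ≠ 0 ∧ d.primeFactors = S) :
    ∑ d ∈ T, (d : ℝ)⁻¹ ≤ 1 := by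
  classical
  rcases T.eq_empty_or_nonempty with he | ⟨d₀, hd₀⟩
  · simp [he]
  have hS : ∀ p ∈ S, p.Prime := fun p hp => by
    rw [← (hT d₀ hd₀).2] at hp; exact Nat.prime_of_mem_primeFactors hp
  set r := ∏ p ∈ S, p with hr
  have hr0 : 0 < r := Finset.prod_pos fun p hp => (hS p hp).pos
  have hdvd : ∀ d ∈ T, r ∣ d := fun d hd => by
    rw [hr, ← (hT d hd).2]; exact Nat.prod_primeFactors_dvd d
  let f : ℕ →*₀ ℝ := invMonoidWithZeroHom.comp (Nat.castRingHom ℝ).toMonoidWithZeroHom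
  have hf : ∀ n : ℕ, f n = (n : ℝ)⁻¹ := fun n => rfl
  have hf1 : ∀ {p : ℕ}, p.Prime → ‖f p‖ < 1 := fun {p} hp => by
    rw [hf, norm_inv, Real.norm_natCast]
    exact inv_lt_one_of_one_lt₀ (by exact_mod_cast hp.one_lt)
  have hE := (EulerProduct.summable_and_hasSum_factoredNumbers_prod_filter_prime_geometric
    (f := f.toMonoidHom) hf1 S).2
  rw [Finset.filter_true_of_mem hS] at hE
  have hmem : ∀ d ∈ T, d / r ∈ Nat.factoredNumbers S := fun d hd => by
    obtain ⟨h0, h1⟩ := hT d hd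
    obtain ⟨m, hm⟩ := hdvd d hd
    have hm0 : m ≠ 0 := fun h => h0 (by rw [hm, h, mul_zero])
    rw [hm, Nat.mul_div_cancel_left _ hr0, Nat.mem_factoredNumbers_iff_primeFactors_subset]
    refine ⟨hm0, ?_⟩
    rw [← h1]
    exact Nat.primeFactors_mono (Dvd.intro_left r hm.symm) h0
  set T' : Finset (Nat.factoredNumbers S) := T.attach.image fun d => ⟨d.1 / r, hmem d.1 d.2⟩
  have h1 : ∑ m ∈ T', f m ≤ ∏ p ∈ S, (1 - f p)⁻¹ :=
    sum_le_hasSum T' (fun m _ => by rw [hf]; positivity) hE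
  have h2 : ∑ d ∈ T, (d : ℝ)⁻¹ = (r : ℝ)⁻¹ * ∑ m ∈ T', f m := by
    rw [Finset.sum_image, ← Finset.sum_attach, Finset.mul_sum]
    · refine Finset.sum_congr rfl fun d _ => ?_
      rw [hf, ← mul_inv]
      congr 1
      exact_mod_cast (Nat.mul_div_cancel' (hdvd d.1 d.2)).symm
    · intro a _ b _ hab
      have h3 : a.1 / r = b.1 / r := congrArg Subtype.val hab
      refine Subtype.ext ?_
      rw [← Nat.mul_div_cancel' (hdvd a.1 a.2), h3, Nat.mul_div_cancel' (hdvd b.1 b.2)]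
  rw [h2]
  refine le_trans (mul_le_mul_of_nonneg_left h1 (by positivity)) ?_
  have h4 := prod_inv_mul_prod_one_sub_inv_le_one hS
  rw [Finset.prod_inv_distrib] at h4
  rw [hr]
  push_cast
  exact h4

lemma sum_exp_sub_exp_le {x δ : ℝ} (hx : 1 ≤ x) (hδ : 0 < δ) :
    ∑ i ∈ Finset.range (⌈Real.log x / δ⌉₊ + 1), (Real.exp (i * δ) - Real.exp ((i - 1) * δ))
      ≤ x * Real.exp δ := by
  have h := Finset.sum_range_sub (fun i : ℕ => Real.exp (((i : ℝ) - 1) * δ)) (⌈Real.log x / δ⌉₊ + 1)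
  have e : ∀ i : ℕ, (((i + 1 : ℕ) : ℝ) - 1) * δ = i * δ := fun i => by push_cast; ring
  simp only [e] at h
  rw [h]
  have h1 := Nat.ceil_lt_add_one (div_nonneg (Real.log_nonneg hx) hδ.le)
  have h2 : (⌈Real.log x / δ⌉₊ : ℝ) * δ ≤ Real.log x + δ := by
    have : (⌈Real.log x / δ⌉₊ : ℝ) * δ ≤ (Real.log x / δ + 1) * δ := by gcongr
    rwa [add_mul, div_mul_cancel₀ _ hδ.ne', one_mul] at this
  have h3 : Real.exp (⌈Real.log x / δ⌉₊ * δ) ≤ x * Real.exp δ := by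
    refine (Real.exp_le_exp.mpr h2).trans (le_of_eq ?_)
    rw [Real.exp_add, Real.exp_log (by linarith)]
  exact (sub_le_self _ (Real.exp_pos _).le).trans h3

/-- The number of primes `q` in a short interval `(u / d, v / d]`, summed over the integers `d`
with a given set of prime factors. -/
lemma exists_sum_card_primesIoc_div_le (K : ℕ) (hK : 2 ≤ K) : ∃ C : ℝ, 0 < C ∧
    ∀ (S T : Finset ℕ) (u δ ρ : ℝ), (∀ d ∈ T, d ≠ 0 ∧ d.primeFactors = S) → 0 < u →
    0 < δ → δ ≤ 1 / 2 → 2 ≤ ρ → (∀ d ∈ T, ρ ≤ Real.log (u / d)) →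
    (∑ d ∈ T, ((primesIoc (u / d) (u * Real.exp δ / d)).card : ℝ)) * ρ
      ≤ (u * Real.exp δ - u) * (1 + C * δ) + C * (u / ρ ^ K) := by
  obtain ⟨C, hC, h⟩ := exists_card_primesIoc_mul_log_le K hK
  refine ⟨2 * C, by positivity, fun S T u δ ρ hT hu hδ hδ1 hρ hlog => ?_⟩
  have hexp1 : 1 ≤ Real.exp δ := Real.one_le_exp hδ.le
  have hexp : Real.exp δ ≤ 1 + 2 * δ := by
    have h1 := Real.add_one_le_exp (-δ)
    have h2 : Real.exp δ * Real.exp (-δ) = 1 := by rw [← Real.exp_add]; simp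
    have h3 : Real.exp δ * (1 - δ) ≤ 1 := by
      rw [← h2]; gcongr; linarith
    nlinarith
  set A := (u * Real.exp δ - u) * (1 + 2 * C * δ) + 2 * C * (u / ρ ^ K) with hA
  have hdiff : 0 ≤ u * Real.exp δ - u := by nlinarith
  have hA0 : 0 ≤ A := by positivity
  have key : ∀ d ∈ T, ((primesIoc (u / d) (u * Real.exp δ / d)).card : ℝ) * ρ ≤ A * (d : ℝ)⁻¹ := by
    intro d hd
    have hd0 : (0 : ℝ) < d := by exact_mod_cast Nat.pos_of_ne_zero (hT d hd).1
    have hl := hlog d hd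
    have hu6 : 6 ≤ u / d := by
      by_contra! hlt
      have h1 : Real.log (u / d) < Real.log 6 := Real.log_lt_log (by positivity) hlt
      have h2 : Real.log 6 ≤ 2 := by
        rw [Real.log_le_iff_le_exp (by norm_num), show (2 : ℝ) = 1 + 1 by norm_num, Real.exp_add]
        have := Real.exp_one_gt_d9
        nlinarith
      linarith
    have hu0 : 0 < u / d := by linarith
    have hle : u / d ≤ u * Real.exp δ / d := by gcongr; linarith
    have hle2 : u * Real.exp δ / d ≤ 2 * (u / d) := by
      have : u * Real.exp δ ≤ 2 * u := by nlinarith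
      rw [← mul_div_assoc]; gcongr
    have h1 := h (u / d) (u * Real.exp δ / d) hu6 hle hle2
    have e1 : (u * Real.exp δ / d - u / d) / (u / d) = Real.exp δ - 1 := by field_simp
    rw [e1] at h1
    have hρ0 : 0 < ρ := by linarith
    calc ((primesIoc (u / d) (u * Real.exp δ / d)).card : ℝ) * ρ
        ≤ (primesIoc (u / d) (u * Real.exp δ / d)).card * Real.log (u / d) := by gcongr
      _ ≤ _ := h1
      _ ≤ (u * Real.exp δ / d - u / d) * (1 + C * (2 * δ)) + C * (u / d / ρ ^ K) := by
          have : 0 ≤ u * Real.exp δ / d - u / d := by linarith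
          gcongr
          linarith
      _ = ((u * Real.exp δ - u) * (1 + 2 * C * δ) + C * (u / ρ ^ K)) * (d : ℝ)⁻¹ := by
          field_simp
      _ ≤ A * (d : ℝ)⁻¹ := by
          rw [hA]
          have : 0 ≤ C * (u / ρ ^ K) := by positivity
          gcongr
          linarith
  rw [Finset.sum_mul]
  calc _ ≤ ∑ d ∈ T, A * (d : ℝ)⁻¹ := Finset.sum_le_sum key
    _ ≤ A * 1 := by
        rw [← Finset.mul_sum]
        exact mul_le_mul_of_nonneg_left (sum_inv_le_one_of_primeFactors_eq hT) hA0
    _ = A := mul_one A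

/-- A joint logarithmic cell for `n` and `φ n`, for integers `n = d * q` with `d` small and `q` a
large prime, only involves cofactors `d` with a common set of prime factors. -/
lemma exists_card_cell_le_sum {B : Finset ℕ} {δ δ' D : ℝ} (hδ : 0 < δ) (hδ' : 0 < δ')
    (hD : 0 < D) (hDδ : δ + 2 * δ' < 1 / D ^ 2)
    (hn : ∀ n ∈ B, 1 ≤ n ∧ ∃ d q : ℕ, n = d * q ∧ q.Prime ∧ (d : ℝ) ≤ D ∧ D < q ∧ 2 / δ' ≤ q)
    (i j : ℕ) :
    ∃ S T : Finset ℕ, (∀ d ∈ T, (d ≠ 0 ∧ d.primeFactors = S) ∧ (d : ℝ) ≤ D) ∧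
      ((B.filter fun n => logCell δ (id n) = i ∧ logCell δ' (Nat.totient n) = j).card : ℝ) ≤
      ∑ d ∈ T, ((primesIoc (Real.exp ((i - 1) * δ) / d)
        (Real.exp ((i - 1) * δ) * Real.exp δ / d)).card : ℝ) := by
  classical
  set U : ℝ := Real.exp ((i - 1) * δ) with hU
  set V : ℝ := U * Real.exp δ with hVU
  have hV : V = Real.exp (i * δ) := by rw [hVU, hU, ← Real.exp_add]; ring_nf
  have hU0 : 0 < U := Real.exp_pos _
  have hV0 : 0 < V := by rw [hV]; exact Real.exp_pos _
  set A := B.filter fun n => logCell δ (id n) = i ∧ logCell δ' (Nat.totient n) = j with hA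
  have hmem : ∀ n ∈ A, ∃ d q : ℕ, n = d * q ∧ q.Prime ∧ (1 ≤ d ∧ (d : ℝ) ≤ D) ∧
      U < (d : ℝ) * q ∧ (d : ℝ) * q ≤ V ∧
      (j - 1) * δ' - i * δ < Real.log (Nat.totient d / d) ∧
      Real.log (Nat.totient d / d) < (j - 1) * δ' - i * δ + (δ + 2 * δ') := by
    intro n h
    obtain ⟨hnB, hi, hj⟩ := Finset.mem_filter.mp h
    simp only [id] at hi
    obtain ⟨hn1, d, q, rfl, hq, hdD, hDq, hqδ⟩ := hn n hnB
    have hd0 : 0 < d := by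
      rcases Nat.eq_zero_or_pos d with h0 | h0
      · simp [h0] at hn1
      · exact h0
    have hdR : (0 : ℝ) < d := by exact_mod_cast hd0
    have hqR : (0 : ℝ) < q := by exact_mod_cast hq.pos
    have hφd : (0 : ℝ) < Nat.totient d := by exact_mod_cast Nat.totient_pos.mpr hd0
    have hφq : (0 : ℝ) < Nat.totient q := by exact_mod_cast Nat.totient_pos.mpr hq.pos
    have hcop : d.Coprime q := by
      refine (hq.coprime_iff_not_dvd.mpr fun hdvd => ?_).symm
      have h1 : (q : ℝ) ≤ d := by exact_mod_cast Nat.le_of_dvd hd0 hdvd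
      linarith
    have e1 : Real.log ((d * q : ℕ) : ℝ) = Real.log d + Real.log q := by
      push_cast
      rw [Real.log_mul (by positivity) (by positivity)]
    have e2 : Real.log (Nat.totient (d * q) : ℝ)
        = Real.log (Nat.totient d) + Real.log (Nat.totient q) := by
      rw [Nat.totient_mul hcop]
      push_cast
      rw [Real.log_mul (by positivity) (by positivity)]
    have e3 : Real.log (Nat.totient q) - Real.log q = Real.log (1 - (q : ℝ)⁻¹) := by
      rw [← Real.log_div (by positivity) (by positivity), Nat.totient_prime hq,
        Nat.cast_sub hq.one_le]
      congr 1
      field_simp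
      simp
    have e4 : -Real.log (1 - (q : ℝ)⁻¹) ≤ δ' := by
      refine (neg_log_one_sub_inv_le (by exact_mod_cast hq.two_le)).trans ?_
      rw [div_le_iff₀ hδ'] at hqδ
      rw [div_le_iff₀ hqR]; linarith
    have e5 : Real.log (1 - (q : ℝ)⁻¹) ≤ 0 := by
      refine Real.log_nonpos ?_ ?_
      · have : (q : ℝ)⁻¹ ≤ 1 := inv_le_one_of_one_le₀ (by exact_mod_cast hq.one_le)
        linarith
      · have : 0 < (q : ℝ)⁻¹ := by positivity
        linarith
    have h1 := log_le_logCell_mul hδ (d * q)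
    have h2 := logCell_sub_one_mul_lt hδ (d * q)
    have h3 := log_le_logCell_mul hδ' (Nat.totient (d * q))
    have h4 := logCell_sub_one_mul_lt hδ' (Nat.totient (d * q))
    rw [hi] at h1 h2
    rw [hj, e2] at h3 h4
    refine ⟨d, q, rfl, hq, ⟨hd0, hdD⟩, ?_, ?_, ?_, ?_⟩
    · rw [hU, ← Real.lt_log_iff_exp_lt (by positivity), ← Nat.cast_mul]
      exact h2
    · rw [hV, ← Real.log_le_iff_le_exp (by positivity), ← Nat.cast_mul]
      exact h1
    · rw [Real.log_div hφd.ne' hdR.ne']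
      rw [e1] at h1 h2
      linarith
    · rw [Real.log_div hφd.ne' hdR.ne']
      rw [e1] at h1 h2
      linarith
  rcases A.eq_empty_or_nonempty with he | ⟨n₀, hn₀⟩
  · exact ⟨∅, ∅, by simp, by rw [he]; simp⟩
  obtain ⟨d₀, q₀, -, -, hd₀, -, -, hl₀, hr₀⟩ := hmem n₀ hn₀
  refine ⟨d₀.primeFactors, (natsUpTo D).filter fun d => d.primeFactors = d₀.primeFactors,
    fun d hd => ?_, ?_⟩
  · rw [Finset.mem_filter, mem_natsUpTo hD.le] at hd
    exact ⟨⟨by omega, hd.2⟩, hd.1.2⟩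
  have hsub : A ⊆ ((natsUpTo D).filter fun d => d.primeFactors = d₀.primeFactors).biUnion
      fun d => (primesIoc (U / d) (V / d)).image fun q => d * q := by
    intro n h
    obtain ⟨d, q, rfl, hq, hd, hUq, hVq, hl, hr⟩ := hmem n h
    have hdR : (0 : ℝ) < d := by exact_mod_cast hd.1
    simp only [Finset.mem_biUnion, Finset.mem_image, Finset.mem_filter, mem_natsUpTo hD.le]
    refine ⟨d, ⟨hd, ?_⟩, q, ?_, rfl⟩
    · refine primeFactors_eq_of_abs_log_totient_div_lt hd.1 hd₀.1 hd.2 hd₀.2 ?_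
      rw [abs_lt]
      constructor <;> linarith
    · rw [mem_primesIoc (by positivity) (by positivity), div_lt_iff₀ hdR, le_div_iff₀ hdR]
      exact ⟨hq, by linarith, by linarith⟩
  have h1 := (Finset.card_le_card hsub).trans (Finset.card_biUnion_le.trans
    (Finset.sum_le_sum fun _ _ => Finset.card_image_le))
  exact_mod_cast h1

set_option maxHeartbeats 1000000 in
/-- A set of integers `d * q`, with `d` small and `q` prime, on which the totient function is
monotone, has at most about as many elements as there are primes. -/
lemma exists_card_le_of_prime_mul : ∃ C : ℝ, 0 < C ∧ ∀ (B : Finset ℕ) (x : ℝ),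
    (∀ m ∈ B, ∀ n ∈ B, m ≤ n → Nat.totient m ≤ Nat.totient n) →
    0 < x → 2 ≤ Real.log (Real.log x) → 50 * Real.log (Real.log x) ≤ Real.log x →
    (∀ n ∈ B, 1 ≤ n ∧ (n : ℝ) ≤ x ∧ x / Real.log x ^ 2 < n ∧
      ∃ d q : ℕ, n = d * q ∧ q.Prime ∧ (d : ℝ) ≤ Real.log x ^ 13) →
    (B.card : ℝ) ≤ x / Real.log x + C * (x * Real.log (Real.log x) / Real.log x ^ 2) := by
  obtain ⟨C, hC, hcells⟩ := exists_sum_card_primesIoc_div_le 40 (by norm_num)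
  set C' : ℝ := 6 + 7 * C + 4 * C * 2 ^ 40 with hC'
  refine ⟨32 + 2 * C', by positivity, fun B x hB hx0 hlam hell hn => ?_⟩
  set ℓ := Real.log x with hℓ
  set lam := Real.log ℓ with hlamdef
  have hℓ100 : 100 ≤ ℓ := by linarith
  have hℓ0 : 0 < ℓ := by linarith
  have hx1 : 1 ≤ x := by
    by_contra! h
    have := Real.log_nonpos hx0.le h.le
    linarith
  set δ : ℝ := (ℓ ^ 29)⁻¹ with hδdef
  set δ' : ℝ := (ℓ ^ 27)⁻¹ with hδ'def
  have hδ : 0 < δ := by positivity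
  have hδ' : 0 < δ' := by positivity
  have hδδ' : δ ≤ δ' := by
    rw [hδdef, hδ'def]
    gcongr <;> linarith
  have hδℓ : δ ≤ ℓ⁻¹ := by
    rw [hδdef]
    gcongr
    exact le_self_pow₀ (by linarith) (by norm_num)
  have hℓinv : ℓ⁻¹ ≤ 1 / 100 := by
    rw [one_div]; gcongr
  have hδ1 : δ ≤ 1 / 2 := by linarith
  set ρ : ℝ := ℓ - 16 * lam with hρ
  have hρℓ : ℓ / 2 ≤ ρ := by linarith
  have hρ2 : 2 ≤ ρ := by linarith
  have hρ0 : 0 < ρ := by linarith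
  have hexp1 : 1 ≤ Real.exp δ := Real.one_le_exp hδ.le
  have hexp : Real.exp δ ≤ 1 + 2 * δ := by
    have h1 := Real.add_one_le_exp (-δ)
    have h2 : Real.exp δ * Real.exp (-δ) = 1 := by rw [← Real.exp_add]; simp
    have h3 : Real.exp δ * (1 - δ) ≤ 1 := by
      rw [← h2]; gcongr; linarith
    nlinarith
  have hBx : ∀ n ∈ B, 1 ≤ id n ∧ ((id n : ℕ) : ℝ) ≤ x := fun n h => ⟨(hn n h).1, (hn n h).2.1⟩
  have hBφ : ∀ n ∈ B, 1 ≤ Nat.totient n ∧ (Nat.totient n : ℝ) ≤ x := fun n h =>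
    ⟨Nat.totient_pos.mpr (hn n h).1,
      le_trans (by exact_mod_cast Nat.totient_le n) (hn n h).2.1⟩
  have hn' : ∀ n ∈ B, 1 ≤ n ∧ ∃ d q : ℕ, n = d * q ∧ q.Prime ∧ (d : ℝ) ≤ ℓ ^ 13 ∧
      ℓ ^ 13 < q ∧ 2 / δ' ≤ q := by
    intro n h
    obtain ⟨hn1, hnx, hxn, d, q, hnd, hq, hd⟩ := hn n h
    have hq0 : (0 : ℝ) < q := by exact_mod_cast hq.pos
    have h1 : x < ℓ ^ 15 * q := by
      rw [div_lt_iff₀ (by positivity), hnd] at hxn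
      push_cast at hxn
      calc x < d * q * ℓ ^ 2 := hxn
        _ ≤ ℓ ^ 13 * q * ℓ ^ 2 := by gcongr
        _ = _ := by ring
    have h2 : ℓ ^ 50 ≤ x := by
      rw [← Real.exp_log hx0, ← hℓ]
      have : ℓ ^ 50 = Real.exp (50 * lam) := by
        rw [hlamdef, mul_comm, Real.exp_mul, Real.exp_log hℓ0]; norm_cast
      rw [this]
      exact Real.exp_le_exp.mpr hell
    have h3 : ℓ ^ 28 * ℓ ^ 7 < q := by
      have : ℓ ^ 15 * (ℓ ^ 28 * ℓ ^ 7) < ℓ ^ 15 * q := by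
        calc ℓ ^ 15 * (ℓ ^ 28 * ℓ ^ 7) = ℓ ^ 50 := by ring
          _ ≤ x := h2
          _ < _ := h1
      exact lt_of_mul_lt_mul_left this (by positivity)
    have h4 : ℓ ^ 28 < q := lt_of_le_of_lt
      (le_mul_of_one_le_right (by positivity) (one_le_pow₀ (by linarith))) h3
    refine ⟨hn1, d, q, hnd, hq, hd, lt_of_le_of_lt ?_ h4, ?_⟩
    · exact pow_le_pow_right₀ (by linarith) (by norm_num)
    · rw [hδ'def, div_inv_eq_mul]
      refine le_trans ?_ h4.le
      rw [show ℓ ^ 28 = ℓ * ℓ ^ 27 by ring]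
      gcongr
      linarith
  set w : ℕ → ℝ := fun i => ((Real.exp (i * δ) - Real.exp ((i - 1) * δ)) * (1 + C * δ)
    + C * (2 ^ 40 * (x / ℓ ^ 40))) / ρ with hw
  set W : ℝ := (2 * δ * x * (1 + C * δ) + C * (2 ^ 40 * (x / ℓ ^ 40))) / ρ with hWdef
  have hstep : ∀ i : ℕ, Real.exp (i * δ) = Real.exp ((i - 1) * δ) * Real.exp δ := fun i => by
    rw [← Real.exp_add]; ring_nf
  have hdiff : ∀ i : ℕ, 0 ≤ Real.exp (i * δ) - Real.exp ((i - 1) * δ) := fun i =>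
    sub_nonneg.mpr (Real.exp_le_exp.mpr (by linarith))
  have hw0 : ∀ i, 0 ≤ w i := fun i => by
    have := hdiff i
    simp only [hw]
    positivity
  have hcellmem : ∀ n ∈ B, ∀ i, logCell δ (id n) = i →
      Real.exp ((i - 1) * δ) < n ∧ (n : ℝ) ≤ Real.exp ((i - 1) * δ) * Real.exp δ := by
    intro n h i hi
    have hn0 : (0 : ℝ) < n := by exact_mod_cast (hn n h).1
    constructor
    · rw [← Real.lt_log_iff_exp_lt hn0, ← hi]
      exact logCell_sub_one_mul_lt hδ n
    · rw [← hstep, ← Real.log_le_iff_le_exp hn0, ← hi]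
      exact log_le_logCell_mul hδ n
  have hW : ∀ i ∈ B.image (fun n => logCell δ (id n)), w i ≤ W := by
    intro i hi
    obtain ⟨n, hnB, hni⟩ := Finset.mem_image.mp hi
    have h1 := (hcellmem n hnB i hni).1
    have h2 := (hn n hnB).2.1
    have h3 : Real.exp (i * δ) - Real.exp ((i - 1) * δ) ≤ 2 * δ * x := by
      rw [hstep]
      have := Real.exp_pos (((i : ℝ) - 1) * δ)
      nlinarith
    simp only [hw, hWdef]
    gcongr
  have hcell : ∀ i j, ((B.filter fun n => logCell δ (id n) = i ∧
      logCell δ' (Nat.totient n) = j).card : ℝ) ≤ w i := by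
    intro i j
    rcases (B.filter fun n => logCell δ (id n) = i ∧ logCell δ' (Nat.totient n) = j).eq_empty_or_nonempty
      with he | ⟨n₀, hn₀⟩
    · rw [he]; simpa using hw0 i
    obtain ⟨hn₀B, hn₀i, -⟩ := Finset.mem_filter.mp hn₀
    obtain ⟨hU, hV⟩ := hcellmem n₀ hn₀B i hn₀i
    have hDδ : δ + 2 * δ' < 1 / (ℓ ^ 13) ^ 2 := by
      have : δ' = ℓ⁻¹ * (1 / (ℓ ^ 13) ^ 2) := by rw [hδ'def]; field_simp
      have h0 : 0 < 1 / (ℓ ^ 13) ^ 2 := by positivity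
      nlinarith
    obtain ⟨S, T, hT, hcard⟩ := exists_card_cell_le_sum hδ hδ' (by positivity : 0 < ℓ ^ 13) hDδ hn' i j
    refine hcard.trans ?_
    set U := Real.exp (((i : ℝ) - 1) * δ) with hUdef
    have hU0 : 0 < U := Real.exp_pos _
    have hUx : U ≤ x := (hU.trans_le (hn n₀ hn₀B).2.1).le
    have hlogU : ∀ d ∈ T, ρ ≤ Real.log (U / d) := by
      intro d hd
      obtain ⟨⟨hd0, -⟩, hdD⟩ := hT d hd
      have hdR : (0 : ℝ) < d := by exact_mod_cast Nat.pos_of_ne_zero hd0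
      have h1 : x / ℓ ^ 2 < 2 * U := by
        refine (hn n₀ hn₀B).2.2.1.trans_le (hV.trans ?_)
        nlinarith
      have h2 : Real.log (x / ℓ ^ 2) ≤ Real.log (2 * U) := Real.log_le_log (by positivity) h1.le
      rw [Real.log_div (by positivity) (by positivity), Real.log_mul (by norm_num) hU0.ne',
        Real.log_pow] at h2
      have h3 : Real.log d ≤ Real.log (ℓ ^ 13) := Real.log_le_log hdR hdD
      rw [Real.log_pow] at h3
      push_cast at h2 h3
      rw [Real.log_div hU0.ne' hdR.ne']
      have := Real.log_two_lt_d9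
      linarith
    have h1 := hcells S T U δ ρ (fun d hd => (hT d hd).1) hU0 hδ hδ1 hρ2 hlogU
    rw [← le_div_iff₀ hρ0] at h1
    refine h1.trans ?_
    simp only [hw]
    rw [hstep]
    have h2 : U / ρ ^ 40 ≤ 2 ^ 40 * (x / ℓ ^ 40) := by
      calc U / ρ ^ 40 ≤ x / (ℓ / 2) ^ 40 := by gcongr
        _ = _ := by rw [div_pow]; field_simp
    gcongr
  have hmain := card_le_sum_of_monotone_cells (B := B) (f := fun n => logCell δ (id n))
    (h := fun n => logCell δ' (Nat.totient n)) (w := w) (W := W)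
    (fun m hm n _ hmn => logCell_mono hδ (hn m hm).1 hmn)
    (fun m hm n hn' hmn => logCell_mono hδ' (hBφ m hm).1 (hB m hm n hn' hmn))
    hw0 hW hcell
  have hcols := card_image_logCell_le hδ' hx1 hBφ
  set R : ℝ := C * (2 ^ 40 * (x / ℓ ^ 40)) with hR
  have hR0 : 0 ≤ R := by positivity
  have hrows : ∑ i ∈ B.image (fun n => logCell δ (id n)), w i
      ≤ (x * Real.exp δ * (1 + C * δ) + 2 * ℓ ^ 30 * R) / ρ := by
    refine (Finset.sum_le_sum_of_subset_of_nonneg (image_logCell_subset hδ hBx)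
      fun i _ _ => hw0 i).trans ?_
    simp only [hw]
    rw [← Finset.sum_div, Finset.sum_add_distrib, ← Finset.sum_mul, Finset.sum_const,
      Finset.card_range, nsmul_eq_mul]
    have h1 := sum_exp_sub_exp_le hx1 hδ
    have h2 : ((⌈Real.log x / δ⌉₊ + 1 : ℕ) : ℝ) ≤ 2 * ℓ ^ 30 := by
      have h3 := Nat.ceil_lt_add_one (div_nonneg (Real.log_nonneg hx1) hδ.le)
      have h4 : Real.log x / δ = ℓ ^ 30 := by rw [hδdef, ← hℓ]; field_simp
      have h5 : (100 : ℝ) ≤ ℓ ^ 30 := hℓ100.trans (le_self_pow₀ (by linarith) (by norm_num))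
      rw [h4] at h3 ⊢
      push_cast
      linarith
    gcongr
  have hcols' : ((B.image fun n => logCell δ' (Nat.totient n)).card : ℝ) ≤ 2 * ℓ ^ 28 := by
    have h4 : Real.log x / δ' = ℓ ^ 28 := by rw [hδ'def, ← hℓ]; field_simp
    have h5 : (100 : ℝ) ≤ ℓ ^ 28 := hℓ100.trans (le_self_pow₀ (by linarith) (by norm_num))
    rw [h4] at hcols
    linarith
  have hW0 : 0 ≤ W := by positivity
  have hRℓ : 2 * ℓ ^ 30 * R ≤ x * (2 * C * 2 ^ 40 * ℓ⁻¹) := by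
    have e : 2 * ℓ ^ 30 * R = x * (2 * C * 2 ^ 40 * (ℓ ^ 10)⁻¹) := by rw [hR]; field_simp
    rw [e]
    gcongr
    exact le_self_pow₀ (by linarith) (by norm_num)
  have hWℓ : 2 * ℓ ^ 28 * W ≤ x * (4 * (1 + C) * ℓ⁻¹ + 2 * C * 2 ^ 40 * ℓ⁻¹) / ρ := by
    rw [hWdef, ← mul_div_assoc]
    refine div_le_div_of_nonneg_right ?_ hρ0.le
    have e1 : 2 * ℓ ^ 28 * (2 * δ * x * (1 + C * δ)) = x * (4 * (1 + C * δ) * ℓ⁻¹) := by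
      rw [hδdef]; field_simp; norm_num
    have e2 : 2 * ℓ ^ 28 * R ≤ 2 * ℓ ^ 30 * R := by
      gcongr <;> linarith
    have e3 : x * (4 * (1 + C * δ) * ℓ⁻¹) ≤ x * (4 * (1 + C) * ℓ⁻¹) := by
      gcongr
      nlinarith
    rw [mul_add (2 * ℓ ^ 28), e1, mul_add x]
    exact add_le_add e3 (e2.trans hRℓ)
  have hfirst : Real.exp δ * (1 + C * δ) ≤ 1 + (2 + 3 * C) * ℓ⁻¹ := by
    have h1 : Real.exp δ * (1 + C * δ) ≤ (1 + 2 * δ) * (1 + C * δ) := by gcongr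
    have h2 : 0 ≤ C * δ := by positivity
    nlinarith
  have htot : (B.card : ℝ) ≤ x * (1 + C' * ℓ⁻¹) / ρ := by
    have h1 : ((B.image fun n => logCell δ' (Nat.totient n)).card : ℝ) * W ≤ 2 * ℓ ^ 28 * W := by
      gcongr
    have h2 : (x * Real.exp δ * (1 + C * δ) + 2 * ℓ ^ 30 * R) / ρ
        ≤ x * (1 + (2 + 3 * C) * ℓ⁻¹ + 2 * C * 2 ^ 40 * ℓ⁻¹) / ρ := by
      gcongr
      have : x * Real.exp δ * (1 + C * δ) ≤ x * (1 + (2 + 3 * C) * ℓ⁻¹) := by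
        rw [mul_assoc]; gcongr
      linarith
    have e : x * (1 + (2 + 3 * C) * ℓ⁻¹ + 2 * C * 2 ^ 40 * ℓ⁻¹) / ρ
        + x * (4 * (1 + C) * ℓ⁻¹ + 2 * C * 2 ^ 40 * ℓ⁻¹) / ρ = x * (1 + C' * ℓ⁻¹) / ρ := by
      rw [hC']; ring
    linarith
  refine htot.trans ?_
  have hC'0 : 0 < C' := by positivity
  have hk : lam * ℓ⁻¹ ≤ 1 / 50 := by
    rw [← div_eq_mul_inv, div_le_iff₀ hℓ0]; linarith
  have hk0 : 0 ≤ lam * ℓ⁻¹ := by positivity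
  have hinv : ρ⁻¹ ≤ ℓ⁻¹ * (1 + 32 * (lam * ℓ⁻¹)) := by
    have e : ρ = ℓ * (1 - 16 * (lam * ℓ⁻¹)) := by rw [hρ]; field_simp
    rw [e, mul_inv]
    gcongr
    rw [inv_le_iff_one_le_mul₀ (by linarith)]
    nlinarith
  have hfin : (1 + C' * ℓ⁻¹) * (1 + 32 * (lam * ℓ⁻¹)) ≤ 1 + (32 + 2 * C') * (lam * ℓ⁻¹) := by
    have h1 : ℓ⁻¹ * 2 ≤ lam * ℓ⁻¹ := by rw [mul_comm]; gcongr
    have h2 : C' * ℓ⁻¹ * (32 * (lam * ℓ⁻¹)) ≤ C' * ℓ⁻¹ * 1 := by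
      gcongr; linarith
    nlinarith
  calc x * (1 + C' * ℓ⁻¹) / ρ = x * (1 + C' * ℓ⁻¹) * ρ⁻¹ := div_eq_mul_inv _ _
    _ ≤ x * (1 + C' * ℓ⁻¹) * (ℓ⁻¹ * (1 + 32 * (lam * ℓ⁻¹))) := by gcongr
    _ = x * ℓ⁻¹ * ((1 + C' * ℓ⁻¹) * (1 + 32 * (lam * ℓ⁻¹))) := by ring
    _ ≤ x * ℓ⁻¹ * (1 + (32 + 2 * C') * (lam * ℓ⁻¹)) := by gcongr
    _ = _ := by field_simp

lemma forall_prime_lt_or_exists_max_prime {m : ℕ} (hm : m ≠ 0) (P : ℝ) :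
    (∀ p : ℕ, p.Prime → p ∣ m → (p : ℝ) < P) ∨
    ∃ p : ℕ, p.Prime ∧ p ∣ m ∧ P ≤ p ∧ ∀ p' : ℕ, p'.Prime → p' ∣ m → p' ≤ p := by
  by_cases h : ∀ p : ℕ, p.Prime → p ∣ m → (p : ℝ) < P
  · exact Or.inl h
  right
  push Not at h
  obtain ⟨p, hp, hpm, hPp⟩ := h
  obtain ⟨q, hq, hmax⟩ := m.primeFactors.exists_max_image id
    ⟨p, Nat.mem_primeFactors.mpr ⟨hp, hpm, hm⟩⟩
  have key : ∀ p' : ℕ, p'.Prime → p' ∣ m → p' ≤ q := fun p' h1 h2 =>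
    hmax p' (Nat.mem_primeFactors.mpr ⟨h1, h2, hm⟩)
  have hq' := Nat.mem_primeFactors.mp hq
  exact ⟨q, hq'.1, hq'.2.1, hPp.trans (by exact_mod_cast key p hp hpm), key⟩

lemma coprime_of_sq_dvd_lt {n a b p : ℕ} {T : ℝ} (hp : p.Prime) (hTp : T ≤ p)
    (hsq : ∀ b : ℕ, b ^ 2 ∣ n → (b : ℝ) < T) (hn : n = a * p * b) : (a * b).Coprime p := by
  refine ((hp.coprime_iff_not_dvd).mpr fun hdvd => ?_).symm
  obtain ⟨c, hc⟩ := hdvd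
  have h1 : p ^ 2 ∣ n := ⟨c, by
    calc n = a * b * p := by rw [hn]; ring
      _ = p ^ 2 * c := by rw [hc]; ring⟩
  have := hsq p h1
  linarith

/-- The shapes, according to its largest three prime factors, of an integer without large square
factor but with a large prime factor. -/
lemma prime_factorization_cases {n : ℕ} {T P Y D : ℝ} (hn : n ≠ 0) (hTP : T ≤ P) (hPY : P ≤ Y)
    (hsq : ∀ b : ℕ, b ^ 2 ∣ n → (b : ℝ) < T) (hY : ∃ p : ℕ, p.Prime ∧ p ∣ n ∧ Y < p) :
    (∃ d q : ℕ, n = d * q ∧ q.Prime ∧ (d : ℝ) ≤ D) ∨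
    (∃ c d q : ℕ, n = c * d * q ∧ c.Coprime d ∧ (c * d).Coprime q ∧ q.Prime ∧ Y ≤ q ∧ D < d ∧
      ∀ p : ℕ, p.Prime → p ∣ d → (p : ℝ) < P) ∨
    (∃ a p q : ℕ, n = a * p * q ∧ p.Prime ∧ q.Prime ∧ P ≤ p ∧ P * p ≤ q ∧
      Nat.totient n = Nat.totient a * Nat.totient p * Nat.totient q) ∨
    (∃ d p q : ℕ, p.Prime ∧ q.Prime ∧ n = d * p * q ∧ (d : ℝ) ≤ D ∧ p < q ∧ (q : ℝ) ≤ P * p) ∨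
    (∃ p q r : ℕ, p.Prime ∧ q.Prime ∧ r.Prime ∧ p * q * r ∣ n ∧ p < q ∧ (q : ℝ) ≤ P * p ∧
      q < r ∧ (r : ℝ) ≤ P * q ∧ Y < r) := by
  obtain ⟨q, hq, hqn, hYq, hqmax⟩ : ∃ q : ℕ, q.Prime ∧ q ∣ n ∧ Y < q ∧
      ∀ p' : ℕ, p'.Prime → p' ∣ n → p' ≤ q := by
    obtain ⟨p, hp, hpn, hYp⟩ := hY
    rcases forall_prime_lt_or_exists_max_prime hn p with h | ⟨q, hq, hqn, hpq, hmax⟩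
    · exact absurd (h p hp hpn) (lt_irrefl _)
    · exact ⟨q, hq, hqn, hYp.trans_le hpq, hmax⟩
  have hPq : P ≤ q := hPY.trans hYq.le
  obtain ⟨m, hm⟩ := hqn
  have hm0 : m ≠ 0 := fun h => hn (by rw [hm, h, mul_zero])
  have hmq : m.Coprime q := by
    simpa using coprime_of_sq_dvd_lt (a := 1) (b := m) hq (hTP.trans hPq) hsq (by rw [hm]; ring)
  rcases forall_prime_lt_or_exists_max_prime hm0 P with hsm | ⟨p, hp, hpm, hPp, hpmax⟩
  · rcases le_or_gt (m : ℝ) D with hmD | hmD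
    · exact Or.inl ⟨m, q, by rw [hm]; ring, hq, hmD⟩
    · exact Or.inr (Or.inl ⟨1, m, q, by rw [hm]; ring, Nat.coprime_one_left m, by simpa using hmq,
        hq, hYq.le, hmD, hsm⟩)
  obtain ⟨k, hk⟩ := hpm
  have hk0 : k ≠ 0 := fun h => hm0 (by rw [hk, h, mul_zero])
  have hnk : n = k * p * q := by rw [hm, hk]; ring
  have hkp : k.Coprime p :=
    (Nat.coprime_mul_iff_left.mp (coprime_of_sq_dvd_lt hp (hTP.trans hPp) hsq hnk)).1
  have hkpq : (k * p).Coprime q := by rwa [mul_comm k p, ← hk]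
  rcases le_or_gt (P * p) q with hgap | hgap
  · refine Or.inr (Or.inr (Or.inl ⟨k, p, q, hnk, hp, hq, hPp, hgap, ?_⟩))
    rw [hnk, Nat.totient_mul hkpq, Nat.totient_mul hkp]
  have hpq : p < q := by
    refine lt_of_le_of_ne (hqmax p hp ⟨k * q, by rw [hnk]; ring⟩) fun h => ?_
    rw [h] at hkpq
    exact hq.one_lt.ne' (Nat.Coprime.eq_one_of_dvd hkpq.symm (Dvd.intro_left k rfl))
  rcases forall_prime_lt_or_exists_max_prime hk0 P with hsm | ⟨s, hs, hsk, hPs, hsmax⟩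
  · rcases le_or_gt (k : ℝ) D with hkD | hkD
    · exact Or.inr (Or.inr (Or.inr (Or.inl ⟨k, p, q, hp, hq, hnk, hkD, hpq, hgap.le⟩)))
    · exact Or.inr (Or.inl ⟨p, k, q, by rw [hnk]; ring, hkp.symm, by rwa [mul_comm p k], hq,
        hYq.le, hkD, hsm⟩)
  obtain ⟨j, hj⟩ := hsk
  have hns : n = j * s * (p * q) := by rw [hnk, hj]; ring
  have hjs := coprime_of_sq_dvd_lt hs (hTP.trans hPs) hsq hns
  have hsp : s < p := by
    refine lt_of_le_of_ne (hpmax s hs ⟨j * p, by rw [hk, hj]; ring⟩) fun h => ?_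
    rw [h] at hjs
    exact hp.one_lt.ne' (Nat.Coprime.eq_one_of_dvd hjs.symm ⟨j * q, by ring⟩)
  rcases le_or_gt (P * s) p with hgap' | hgap'
  · have hn' : n = j * p * s * q := by rw [hns]; ring
    have h1 : (j * p).Coprime s := by
      rw [← mul_assoc] at hjs
      exact (Nat.coprime_mul_iff_left.mp hjs).1
    have h2 : (j * p * s).Coprime q := by
      rwa [show j * p * s = k * p by rw [hj]; ring]
    refine Or.inr (Or.inr (Or.inl ⟨j * p, s, q, hn', hs, hq, hPs,
      hgap'.trans (by exact_mod_cast hpq.le), ?_⟩))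
    rw [hn', Nat.totient_mul h2, Nat.totient_mul h1]
  · exact Or.inr (Or.inr (Or.inr (Or.inr ⟨s, p, q, hs, hp, hq, ⟨j, by rw [hns]; ring⟩, hsp,
      hgap'.le, hpq, hgap.le, hYq⟩)))

lemma card_le_sum_card_filter {B : Finset ℕ} {p₁ p₂ p₃ p₄ p₅ p₆ p₇ p₈ : ℕ → Prop}
    [DecidablePred p₁] [DecidablePred p₂] [DecidablePred p₃] [DecidablePred p₄]
    [DecidablePred p₅] [DecidablePred p₆] [DecidablePred p₇] [DecidablePred p₈]
    (h : ∀ n ∈ B, p₁ n ∨ p₂ n ∨ p₃ n ∨ p₄ n ∨ p₅ n ∨ p₆ n ∨ p₇ n ∨ p₈ n) :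
    (B.card : ℝ) ≤ (B.filter p₁).card + (B.filter p₂).card + (B.filter p₃).card +
      (B.filter p₄).card + (B.filter p₅).card + (B.filter p₆).card + (B.filter p₇).card +
      (B.filter p₈).card := by
  have hcover : B ⊆ B.filter p₁ ∪ B.filter p₂ ∪ B.filter p₃ ∪ B.filter p₄ ∪ B.filter p₅ ∪
      B.filter p₆ ∪ B.filter p₇ ∪ B.filter p₈ := by
    intro n hn
    simp only [Finset.mem_union, Finset.mem_filter, hn, true_and, or_assoc]
    exact h n hn
  have h' : B.card ≤ (B.filter p₁).card + (B.filter p₂).card + (B.filter p₃).card +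
      (B.filter p₄).card + (B.filter p₅).card + (B.filter p₆).card + (B.filter p₇).card +
      (B.filter p₈).card := by
    refine (Finset.card_le_card hcover).trans ?_
    iterate 7 refine (Finset.card_union_le _ _).trans (Nat.add_le_add_right ?_ _)
    exact le_rfl
  exact_mod_cast h'

set_option maxHeartbeats 1000000 in
/-- A set of positive integers up to `x` on which the totient function is monotone has at most
about as many elements as there are primes up to `x`. -/
lemma exists_card_le_of_monotone : ∃ C : ℝ, 0 < C ∧ ∀ (B : Finset ℕ) (x : ℝ),
    (∀ m ∈ B, ∀ n ∈ B, m ≤ n → Nat.totient m ≤ Nat.totient n) →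
    0 < x → 2 ≤ Real.log (Real.log x) → 400 * Real.log (Real.log x) ^ 2 ≤ Real.log x →
    (∀ n ∈ B, 1 ≤ n ∧ (n : ℝ) ≤ x) →
    (B.card : ℝ) ≤ x / Real.log x + C * (x * Real.log (Real.log x) ^ 5 / Real.log x ^ 2) := by
  classical
  obtain ⟨C, hC, hprime⟩ := exists_card_le_of_prime_mul
  refine ⟨5067 + C + 35840 + 819200000, by positivity, fun B x hB hx0 hlam hell hn => ?_⟩
  set ℓ := Real.log x with hℓ
  set lam := Real.log ℓ with hlamdef
  have h50 : 50 * lam ≤ ℓ := by nlinarith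
  have hℓ1600 : 1600 ≤ ℓ := by nlinarith
  have hℓ0 : 0 < ℓ := by linarith
  have hlam0 : 0 < lam := by linarith
  have hx1 : 1 ≤ x := by
    by_contra! h
    have := Real.log_nonpos hx0.le h.le
    linarith
  have hexplam : Real.exp lam = ℓ := Real.exp_log hℓ0
  have hexpℓ : Real.exp ℓ = x := Real.exp_log hx0
  have hpow : ∀ k : ℕ, ℓ ^ k = Real.exp (k * lam) := fun k => by
    rw [← hexplam, ← Real.exp_nat_mul]
  set Y : ℝ := Real.exp (ℓ / (20 * lam)) with hYdef
  have hY0 : 0 < Y := Real.exp_pos _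
  have hlogY : Real.log Y = ℓ / (20 * lam) := Real.log_exp _
  have hYlow : 20 * lam ≤ ℓ / (20 * lam) := by
    rw [le_div_iff₀ (by positivity)]; nlinarith
  have hY20 : ℓ ^ 20 ≤ Y := by
    rw [hpow, hYdef]
    exact Real.exp_le_exp.mpr (by push_cast; linarith)
  have hY18 : 8 * ℓ ^ 18 ≤ Y := by
    refine le_trans ?_ hY20
    rw [show ℓ ^ 20 = ℓ ^ 2 * ℓ ^ 18 by ring]
    gcongr
    nlinarith
  have hPY : ℓ ^ 5 ≤ Y := (pow_le_pow_right₀ (by linarith) (by norm_num)).trans hY20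
  have hTP : ℓ ^ 3 ≤ ℓ ^ 5 := pow_le_pow_right₀ (by linarith) (by norm_num)
  have hT8 : 8 ≤ ℓ ^ 3 := by
    have : ℓ ≤ ℓ ^ 3 := le_self_pow₀ (by linarith) (by norm_num)
    linarith
  set E : ℝ := x / ℓ ^ 2 with hE
  have hE0 : 0 < E := by positivity
  have hsub : ∀ (p : ℕ → Prop) [DecidablePred p], (∀ m ∈ B.filter p, ∀ n ∈ B.filter p, m ≤ n →
      Nat.totient m ≤ Nat.totient n) := fun p _ m hm n hn =>
    hB m (Finset.mem_filter.mp hm).1 n (Finset.mem_filter.mp hn).1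
  set Good : ℕ → Prop := fun n => E < n ∧ ∀ b : ℕ, b ^ 2 ∣ n → (b : ℝ) < ℓ ^ 3 with hGood
  set p₁ : ℕ → Prop := fun n => (n : ℝ) ≤ E
  set p₂ : ℕ → Prop := fun n => ∃ b : ℕ, b ^ 2 ∣ n ∧ ℓ ^ 3 ≤ (b : ℝ)
  set p₃ : ℕ → Prop := fun n => Good n ∧ ∀ p : ℕ, p.Prime → p ∣ n → (p : ℝ) ≤ Y
  set p₄ : ℕ → Prop := fun n => Good n ∧ ∃ d q : ℕ, n = d * q ∧ q.Prime ∧ (d : ℝ) ≤ ℓ ^ 13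
  set p₅ : ℕ → Prop := fun n => Good n ∧ ∃ c d q : ℕ, n = c * d * q ∧ c.Coprime d ∧
    (c * d).Coprime q ∧ q.Prime ∧ Y ≤ q ∧ ℓ ^ 13 < d ∧
      ∀ p : ℕ, p.Prime → p ∣ d → (p : ℝ) < ℓ ^ 5
  set p₆ : ℕ → Prop := fun n => Good n ∧ ∃ a p q : ℕ, n = a * p * q ∧ p.Prime ∧ q.Prime ∧
    ℓ ^ 5 ≤ p ∧ ℓ ^ 5 * p ≤ q ∧ Nat.totient n = Nat.totient a * Nat.totient p * Nat.totient q
  set p₇ : ℕ → Prop := fun n => Good n ∧ ∃ d p q : ℕ, p.Prime ∧ q.Prime ∧ n = d * p * q ∧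
    (d : ℝ) ≤ ℓ ^ 13 ∧ p < q ∧ (q : ℝ) ≤ ℓ ^ 5 * p
  set p₈ : ℕ → Prop := fun n => Good n ∧ ∃ p q r : ℕ, p.Prime ∧ q.Prime ∧ r.Prime ∧
    p * q * r ∣ n ∧ p < q ∧ (q : ℝ) ≤ ℓ ^ 5 * p ∧ q < r ∧ (r : ℝ) ≤ ℓ ^ 5 * q ∧ Y < r
  have hcard := card_le_sum_card_filter (B := B) (p₁ := p₁) (p₂ := p₂) (p₃ := p₃) (p₄ := p₄)
    (p₅ := p₅) (p₆ := p₆) (p₇ := p₇) (p₈ := p₈) fun n hnB => by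
      by_cases h1 : p₁ n
      · exact Or.inl h1
      by_cases h2 : p₂ n
      · exact Or.inr (Or.inl h2)
      have hg : Good n := by
        refine ⟨not_le.mp h1, fun b hb => ?_⟩
        by_contra! h
        exact h2 ⟨b, hb, h⟩
      by_cases h3 : p₃ n
      · exact Or.inr (Or.inr (Or.inl h3))
      refine Or.inr (Or.inr (Or.inr ?_))
      have hYex : ∃ p : ℕ, p.Prime ∧ p ∣ n ∧ Y < p := by
        by_contra! h
        exact h3 ⟨hg, h⟩
      have hn0 : n ≠ 0 := by have := (hn n hnB).1; omega
      rcases prime_factorization_cases (D := ℓ ^ 13) hn0 hTP hPY hg.2 hYex with h | h | h | h | h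
      · exact Or.inl ⟨hg, h⟩
      · exact Or.inr (Or.inl ⟨hg, h⟩)
      · exact Or.inr (Or.inr (Or.inl ⟨hg, h⟩))
      · exact Or.inr (Or.inr (Or.inr (Or.inl ⟨hg, h⟩)))
      · exact Or.inr (Or.inr (Or.inr (Or.inr ⟨hg, h⟩)))
  have b₁ : ((B.filter p₁).card : ℝ) ≤ E := by
    have h : B.filter p₁ ⊆ natsUpTo E := fun n h => by
      obtain ⟨h1, h2⟩ := Finset.mem_filter.mp h
      exact (mem_natsUpTo hE0.le).mpr ⟨(hn n h1).1, h2⟩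
    have h1 : (natsUpTo E).card ≤ ⌊E⌋₊ := by
      refine (Finset.card_le_card (t := Finset.Icc 1 ⌊E⌋₊) fun n h => ?_).trans (by simp)
      rw [mem_natsUpTo hE0.le] at h
      exact Finset.mem_Icc.mpr ⟨h.1, Nat.le_floor h.2⟩
    calc ((B.filter p₁).card : ℝ) ≤ ⌊E⌋₊ := by exact_mod_cast (Finset.card_le_card h).trans h1
      _ ≤ E := Nat.floor_le hE0.le
  have b₂ : ((B.filter p₂).card : ℝ) ≤ 4 * E := by
    refine (card_le_of_sq_dvd (T := ℓ ^ 3) hx0.le (by linarith) fun n h => ?_).trans ?_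
    · obtain ⟨h1, h2⟩ := Finset.mem_filter.mp h
      exact ⟨(hn n h1).1, (hn n h1).2, h2⟩
    · have h1 : ℓ ^ 2 / 2 ≤ ℓ ^ 3 - 1 := by nlinarith
      calc 2 * (x / (ℓ ^ 3 - 1)) ≤ 2 * (x / (ℓ ^ 2 / 2)) := by gcongr
        _ = 4 * E := by rw [hE]; field_simp; norm_num
  have b₃ : ((B.filter p₃).card : ℝ) ≤ 2 * E := by
    set k := ⌈10 * lam⌉₊ with hk
    have hk1 : 10 * lam ≤ k := Nat.le_ceil _
    have hk2 : (k : ℝ) < 10 * lam + 1 := Nat.ceil_lt_add_one (by positivity)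
    have hY1 : 1 ≤ Y := Real.one_le_exp (by positivity)
    have hu : (ℓ ^ 3) ^ 2 * Y ^ k ≤ E := by
      have h1 : (ℓ ^ 3) ^ 2 * Y ^ k * ℓ ^ 2 ≤ x := by
        rw [show (ℓ ^ 3) ^ 2 * Y ^ k * ℓ ^ 2 = ℓ ^ 8 * Y ^ k by ring, hpow, hYdef,
          ← Real.exp_nat_mul, ← Real.exp_add, ← hexpℓ]
        refine Real.exp_le_exp.mpr ?_
        have h2 : (k : ℝ) * (ℓ / (20 * lam)) ≤ (11 * lam) * (ℓ / (20 * lam)) := by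
          gcongr; linarith
        have h3 : (11 * lam) * (ℓ / (20 * lam)) = 11 / 20 * ℓ := by field_simp
        push_cast
        linarith
      rw [hE, le_div_iff₀ (by positivity)]
      exact h1
    have h := card_le_of_forall_prime_le (B := B.filter p₃) (T := ℓ ^ 3) hx1 hY1 (by positivity) hu
      fun n h => by
        obtain ⟨h1, h2, h3⟩ := Finset.mem_filter.mp h
        exact ⟨(hn n h1).1, (hn n h1).2, h2.1, h2.2, h3⟩
    have h2k : ℓ ^ 3 ≤ 2 ^ k := by
      rw [hpow, ← Real.exp_log (by norm_num : (0 : ℝ) < 2), ← Real.exp_nat_mul]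
      refine Real.exp_le_exp.mpr ?_
      have := Real.log_two_gt_d9
      push_cast
      nlinarith
    have h3 : ((B.filter p₃).card : ℝ) * ℓ ^ 3 ≤ x * (2 * ℓ) := by
      calc ((B.filter p₃).card : ℝ) * ℓ ^ 3 ≤ (B.filter p₃).card * 2 ^ k := by gcongr
        _ ≤ x * (1 + ℓ) := h
        _ ≤ x * (2 * ℓ) := by gcongr; linarith
    calc ((B.filter p₃).card : ℝ) ≤ x * (2 * ℓ) / ℓ ^ 3 := by rwa [le_div_iff₀ (by positivity)]
      _ = 2 * E := by rw [hE]; field_simp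
  have b₄ : ((B.filter p₄).card : ℝ) ≤ x / ℓ + C * (x * lam / ℓ ^ 2) :=
    hprime _ x (hsub _) hx0 hlam h50 fun n h => by
      obtain ⟨h1, h2, h3⟩ := Finset.mem_filter.mp h
      exact ⟨(hn n h1).1, (hn n h1).2, h2.1, h3⟩
  have b₅ : ((B.filter p₅).card : ℝ) ≤ 60 * E :=
    card_le_of_smooth_part (hsub _) (by linarith) hx1 fun n h => by
      obtain ⟨h1, h2, c, d, q, h3, h4, h5, h6, h7, h8⟩ := Finset.mem_filter.mp h
      exact ⟨(hn n h1).1, (hn n h1).2, h2.2, c, d, q, h3, h4, h5, h6, hY18.trans h7, h8⟩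
  have b₆ : ((B.filter p₆).card : ℝ) ≤ 5000 * E :=
    card_le_of_gap (hsub _) (by linarith) hx1 fun n h => by
      obtain ⟨h1, h2, h3⟩ := Finset.mem_filter.mp h
      exact ⟨(hn n h1).1, (hn n h1).2, h3⟩
  have b₇ : ((B.filter p₇).card : ℝ) ≤ 35840 * (x * lam ^ 2 / ℓ ^ 2) := by
    set z : ℝ := Real.exp (ℓ / 2 - 10 * lam) with hz
    have hlogz : Real.log z = ℓ / 2 - 10 * lam := Real.log_exp _
    have hz1 : 1 < z := Real.one_lt_exp_iff.mpr (by linarith)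
    have hz0 : 0 < z := by linarith
    have hzz : z * z * ℓ ^ 20 = x := by
      rw [hz, hpow, ← Real.exp_add, ← Real.exp_add, ← hexpℓ]; congr 1; push_cast; ring
    have hlogR : Real.log (ℓ ^ 10) = 10 * lam := by rw [Real.log_pow, ← hlamdef]; norm_num
    have hlogD : Real.log (ℓ ^ 13) = 13 * lam := by rw [Real.log_pow, ← hlamdef]; norm_num
    have h := card_le_of_two_close_primes (B := B.filter p₇) (z := z) (R := ℓ ^ 10) (D := ℓ ^ 13)
      hx0 hz1 (by rw [hlogR]; linarith) (by positivity) (one_le_pow₀ (by linarith)) fun n h => by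
        obtain ⟨h1, h2, d, p, q, hp, hq, hnd, hd, hpq, hqp⟩ := Finset.mem_filter.mp h
        have hp0 : (0 : ℝ) < p := by exact_mod_cast hp.pos
        have hq0 : (0 : ℝ) < q := by exact_mod_cast hq.pos
        have hpq' : (p : ℝ) < q := by exact_mod_cast hpq
        have hnx := (hn n h1).2
        have hd1 : (1 : ℝ) ≤ d := by
          have : d ≠ 0 := fun h0 => by
            have := (hn n h1).1
            rw [hnd, h0] at this
            simp at this
          exact_mod_cast Nat.one_le_iff_ne_zero.mpr this
        refine ⟨(hn n h1).1, hnx, d, p, q, hp, hq, hnd, hd, ?_, ?_, hpq⟩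
        · have h3 : x < ℓ ^ 20 * (p * p) := by
            have h4 := h2.1
            rw [hE, div_lt_iff₀ (by positivity), hnd] at h4
            push_cast at h4
            calc x < d * p * q * ℓ ^ 2 := h4
              _ ≤ ℓ ^ 13 * p * (ℓ ^ 5 * p) * ℓ ^ 2 := by gcongr
              _ = _ := by ring
          rw [← hzz, mul_comm] at h3
          have h4 : z * z < p * p := lt_of_mul_lt_mul_left h3 (by positivity)
          exact lt_of_mul_self_lt_mul_self₀ hp0.le h4
        · have h3 : (p : ℝ) * p ≤ (ℓ ^ 10 * z) * (ℓ ^ 10 * z) := by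
            calc (p : ℝ) * p ≤ p * q := by gcongr
              _ ≤ d * (p * q) := le_mul_of_one_le_left (by positivity) hd1
              _ = n := by rw [hnd]; push_cast; ring
              _ ≤ x := hnx
              _ = _ := by rw [← hzz]; ring
          exact (mul_self_le_mul_self_iff hp0.le (by positivity)).mpr h3
    refine h.trans ?_
    rw [hlogR, hlogD, hlogz]
    calc x * ((1 + 13 * lam) * (16 * (10 * lam) / (ℓ / 2 - 10 * lam) ^ 2))
        ≤ x * ((14 * lam) * (16 * (10 * lam) / (ℓ / 4) ^ 2)) := by
          gcongr <;> linarith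
      _ = _ := by field_simp; norm_num
  have b₈ : ((B.filter p₈).card : ℝ) ≤ 819200000 * (x * lam ^ 5 / ℓ ^ 2) := by
    set z : ℝ := Real.exp (ℓ / (20 * lam) - 10 * lam) with hz
    have hlogz : Real.log z = ℓ / (20 * lam) - 10 * lam := Real.log_exp _
    have hzlow : ℓ / (40 * lam) ≤ Real.log z := by
      have : ℓ / (20 * lam) = 2 * (ℓ / (40 * lam)) := by field_simp; norm_num
      rw [hlogz]
      linarith
    have hz1 : 1 < z := Real.one_lt_exp_iff.mpr (by linarith)
    have hz0 : 0 < z := by linarith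
    have hYz : z * (ℓ ^ 5 * ℓ ^ 5) = Y := by
      rw [hz, hYdef, hpow, ← Real.exp_add, ← Real.exp_add]; congr 1; push_cast; ring
    have hlogL : Real.log (ℓ ^ 5) = 5 * lam := by rw [Real.log_pow, ← hlamdef]; norm_num
    have hlogxz : Real.log (x / z) = ℓ - Real.log z := Real.log_div hx0.ne' hz0.ne'
    have hzup : Real.log z ≤ ℓ / 40 := by
      have : ℓ / (20 * lam) ≤ ℓ / 40 := by gcongr; linarith
      rw [hlogz]; linarith
    have hlogz0 : 0 < Real.log z := Real.log_pos hz1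
    have h := card_le_of_three_close_primes (B := B.filter p₈) (z := z) (L := ℓ ^ 5)
      hx0 hz1 (by rw [hlogL]; linarith) (by positivity) (by rw [hlogxz]; linarith) fun n h => by
        obtain ⟨h1, -, p, q, r, hp, hq, hr, hd, hpq, hqp, hqr, hrq, hYr⟩ := Finset.mem_filter.mp h
        refine ⟨(hn n h1).1, (hn n h1).2, p, q, r, hp, hq, hr, hd, ?_, hpq, hqp, hqr, hrq⟩
        have h3 : (ℓ ^ 5 * ℓ ^ 5) * z < (ℓ ^ 5 * ℓ ^ 5) * p := by
          calc (ℓ ^ 5 * ℓ ^ 5) * z = Y := by rw [← hYz]; ring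
            _ < r := hYr
            _ ≤ ℓ ^ 5 * q := hrq
            _ ≤ ℓ ^ 5 * (ℓ ^ 5 * p) := by gcongr
            _ = _ := by ring
        exact lt_of_mul_lt_mul_left h3 (by positivity)
    refine h.trans ?_
    rw [hlogL, hlogxz]
    calc x * (8 * (ℓ - Real.log z) / Real.log z * (8 * (5 * lam) / Real.log z) ^ 2)
        ≤ x * (8 * ℓ / (ℓ / (40 * lam)) * (8 * (5 * lam) / (ℓ / (40 * lam))) ^ 2) := by
          gcongr; linarith
      _ = _ := by field_simp; norm_num
  have hone : 1 ≤ lam ^ 5 := one_le_pow₀ (by linarith)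
  have e0 : x * lam ^ 5 / ℓ ^ 2 = E * lam ^ 5 := by rw [hE]; ring
  have e1 : E ≤ x * lam ^ 5 / ℓ ^ 2 := by rw [e0]; exact le_mul_of_one_le_right hE0.le hone
  have e2 : x * lam / ℓ ^ 2 ≤ x * lam ^ 5 / ℓ ^ 2 := by
    gcongr; exact le_self_pow₀ (by linarith) (by norm_num)
  have e3 : x * lam ^ 2 / ℓ ^ 2 ≤ x * lam ^ 5 / ℓ ^ 2 := by
    gcongr <;> linarith
  have e4 : C * (x * lam / ℓ ^ 2) ≤ C * (x * lam ^ 5 / ℓ ^ 2) := by gcongr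
  linarith

lemma coe_filter_prime_range_floor {x : ℝ} (hx : 0 ≤ x) :
    (((Finset.range (⌊x⌋₊ + 1)).filter Nat.Prime : Finset ℕ) : Set ℕ)
      = {p : ℕ | p.Prime ∧ (p : ℝ) ≤ x} := by
  ext p
  simp only [Finset.coe_filter, Finset.mem_range, Nat.lt_succ_iff, Nat.le_floor_iff hx,
    Set.mem_ofPred_eq, and_comm]

lemma primePi_eq_card {x : ℝ} (hx : 0 ≤ x) :
    primePi x = ((Finset.range (⌊x⌋₊ + 1)).filter Nat.Prime).card := by
  rw [primePi, ← coe_filter_prime_range_floor hx, Set.ncard_coe_finset]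

lemma primePi_eq_primeCounting {x : ℝ} (hx : 0 ≤ x) : primePi x = Nat.primeCounting ⌊x⌋₊ := by
  rw [primePi_eq_card hx, Nat.primeCounting, Nat.primeCounting', Nat.count_eq_card_filter_range]

lemma card_le_floor_of_forall_le {x : ℝ} {B : Finset ℕ}
    (hB : (B : Set ℕ) ⊆ {n : ℕ | 1 ≤ n ∧ (n : ℝ) ≤ x}) : B.card ≤ ⌊x⌋₊ := by
  refine (Finset.card_le_card (t := Finset.Icc 1 ⌊x⌋₊) fun n hn => ?_).trans (by simp)
  have h := hB hn
  exact Finset.mem_Icc.mpr ⟨h.1, Nat.le_floor h.2⟩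

lemma bddAbove_card_monotone (x : ℝ) : BddAbove {k : ℕ | ∃ B : Finset ℕ,
    ↑B ⊆ {n : ℕ | 1 ≤ n ∧ (n : ℝ) ≤ x} ∧
    (∀ m ∈ B, ∀ n ∈ B, m ≤ n → Nat.totient m ≤ Nat.totient n) ∧ B.card = k} := by
  refine ⟨⌊x⌋₊, ?_⟩
  rintro k ⟨B, hB, -, rfl⟩
  exact card_le_floor_of_forall_le hB

lemma exists_card_eq_Mx (x : ℝ) : ∃ B : Finset ℕ, ↑B ⊆ {n : ℕ | 1 ≤ n ∧ (n : ℝ) ≤ x} ∧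
    (∀ m ∈ B, ∀ n ∈ B, m ≤ n → Nat.totient m ≤ Nat.totient n) ∧ B.card = Mx x := by
  refine Nat.sSup_mem ?_ (bddAbove_card_monotone x)
  exact ⟨0, ∅, by simp⟩

lemma primePi_le_Mx {x : ℝ} (hx : 0 ≤ x) : primePi x ≤ Mx x := by
  rw [primePi_eq_card hx]
  refine le_csSup (bddAbove_card_monotone x) ⟨_, ?_, ?_, rfl⟩
  · rw [coe_filter_prime_range_floor hx]
    exact fun p hp => ⟨hp.1.one_le, hp.2⟩
  · intro p hp q hq hpq
    rw [Nat.totient_prime (Finset.mem_filter.mp hp).2, Nat.totient_prime (Finset.mem_filter.mp hq).2]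
    omega

lemma exists_eventually_Mx_le : ∃ C : ℝ, 0 < C ∧ ∀ᶠ x : ℝ in Filter.atTop,
    (Mx x : ℝ) ≤ (1 + C * Real.log (Real.log x) ^ 5 / Real.log x) * primePi x := by
  obtain ⟨C₁, hC₁, h₁⟩ := exists_le_primeCounting_mul_log
  obtain ⟨C₂, hC₂, h₂⟩ := exists_card_le_of_monotone
  refine ⟨2 * C₁ + 2 * C₂, by positivity, ?_⟩
  have hlog := Real.tendsto_log_atTop
  have hloglog := hlog.comp hlog
  have hb : ∀ᶠ x : ℝ in Filter.atTop,
      (400 + 2 * C₁) * Real.log (Real.log x) ^ 2 ≤ Real.log x := by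
    have h := hlog.eventually ((Real.isLittleO_pow_log_id_atTop (n := 2)).bound
      (inv_pos.mpr (by positivity : 0 < 400 + 2 * C₁)))
    filter_upwards [h, hlog.eventually_ge_atTop 0] with x hx h0
    rw [Real.norm_of_nonneg (by positivity), id, Real.norm_of_nonneg h0, inv_mul_eq_div,
      le_div_iff₀ (by positivity)] at hx
    linarith
  filter_upwards [h₁, hb, hloglog.eventually_ge_atTop 2, Filter.eventually_gt_atTop 0]
    with x hπ hell hlam hx0
  simp only [Function.comp] at hlam
  set ℓ := Real.log x with hℓ
  set lam := Real.log ℓ with hlamdef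
  have hlam2 : lam ≤ lam ^ 2 := le_self_pow₀ (by linarith) (by norm_num)
  have hlam5 : lam ≤ lam ^ 5 := le_self_pow₀ (by linarith) (by norm_num)
  have hlam0 : 0 < lam := by linarith
  have hC1l : 0 ≤ 2 * C₁ * lam ^ 2 := by positivity
  have hell4 : 400 * lam ^ 2 ≤ ℓ := by linarith
  have hℓ0 : 0 < ℓ := by nlinarith
  obtain ⟨B, hB, hmono, hcard⟩ := exists_card_eq_Mx x
  have hM := h₂ B x hmono hx0 hlam hell4 fun n hn => hB hn
  rw [hcard] at hM
  rw [primePi_eq_primeCounting hx0.le]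
  set π : ℝ := (Nat.primeCounting ⌊x⌋₊ : ℝ) with hπdef
  have hπ0 : 0 ≤ π := Nat.cast_nonneg _
  set t : ℝ := lam / ℓ with ht
  have ht0 : 0 ≤ t := by positivity
  have htC : C₁ * t ≤ 1 / 2 := by
    rw [ht, ← mul_div_assoc, div_le_iff₀ hℓ0]
    nlinarith
  set s : ℝ := lam ^ 5 / ℓ with hs
  have hts : t ≤ s := by rw [ht, hs]; gcongr
  have h3 : x / ℓ * (1 - C₁ * t) ≤ π := by
    rw [div_mul_eq_mul_div, div_le_iff₀ hℓ0]; exact hπ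
  have hy0 : 0 < x / ℓ := by positivity
  have h4 : x / ℓ ≤ 2 * π := by nlinarith
  have h5 : x / ℓ ≤ π + 2 * C₁ * s * π := by
    have h6 : x / ℓ ≤ π + C₁ * t * (x / ℓ) := by linarith
    have h7 : C₁ * t * (x / ℓ) ≤ C₁ * s * (2 * π) := by gcongr
    linarith
  have h8 : C₂ * (x * lam ^ 5 / ℓ ^ 2) ≤ C₂ * (s * (2 * π)) := by
    have : x * lam ^ 5 / ℓ ^ 2 = s * (x / ℓ) := by rw [hs]; field_simp
    rw [this]
    gcongr
  calc (Mx x : ℝ) ≤ (π + 2 * C₁ * s * π) + C₂ * (s * (2 * π)) := by linarith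
    _ = _ := by rw [hs]; ring

theorem stmt0 : ∃ C : ℝ, 0 < C ∧ ∀ x : ℝ, 10 ≤ x →
    primePi x ≤ Mx x ∧
    (Mx x : ℝ) ≤ (1 + C * (Real.log (Real.log x)) ^ 5 / Real.log x) * primePi x := by
  obtain ⟨C, hC, h⟩ := exists_eventually_Mx_le
  obtain ⟨x₀, hx₀⟩ := Filter.eventually_atTop.mp h
  have hlog10 : 1 < Real.log 10 := by
    rw [Real.lt_log_iff_exp_lt (by norm_num)]
    linarith [Real.exp_one_lt_d9]
  have hloglog10 : 0 < Real.log (Real.log 10) := Real.log_pos hlog10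
  set X := max x₀ 10 with hX
  have hX10 : 10 ≤ X := le_max_right _ _
  have hlogX : 1 < Real.log X := hlog10.trans_le (Real.log_le_log (by norm_num) hX10)
  set C' := X * Real.log X / Real.log (Real.log 10) ^ 5 with hC'
  have hC'0 : 0 < C' := by positivity
  refine ⟨C + C', by positivity, fun x hx => ⟨primePi_le_Mx (by linarith), ?_⟩⟩
  have hlogx : Real.log 10 ≤ Real.log x := Real.log_le_log (by norm_num) hx
  have hloglogx : Real.log (Real.log 10) ≤ Real.log (Real.log x) :=
    Real.log_le_log (by linarith) hlogx
  have hlogx0 : 0 < Real.log x := by linarith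
  have hs0 : 0 ≤ Real.log (Real.log x) ^ 5 / Real.log x := by
    have : 0 ≤ Real.log (Real.log x) := by linarith
    positivity
  rw [mul_div_assoc]
  rcases le_total x₀ x with hxx | hxx
  · have h1 := hx₀ x hxx
    rw [mul_div_assoc] at h1
    refine h1.trans ?_
    gcongr
    linarith
  · have hxX : x ≤ X := hxx.trans (le_max_left _ _)
    obtain ⟨B, hB, -, hcard⟩ := exists_card_eq_Mx x
    have hMX : (Mx x : ℝ) ≤ X := by
      rw [← hcard]
      calc (B.card : ℝ) ≤ ⌊x⌋₊ := by exact_mod_cast card_le_floor_of_forall_le hB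
        _ ≤ x := Nat.floor_le (by linarith)
        _ ≤ X := hxX
    have hπ1 : (1 : ℝ) ≤ primePi x := by
      have : 0 < primePi x := by
        rw [primePi_eq_card (by linarith), Finset.card_pos]
        refine ⟨2, Finset.mem_filter.mpr ⟨?_, Nat.prime_two⟩⟩
        rw [Finset.mem_range, Nat.lt_succ_iff]
        exact Nat.le_floor (by push_cast; linarith)
      exact_mod_cast this
    have hs : Real.log (Real.log 10) ^ 5 / Real.log X ≤ Real.log (Real.log x) ^ 5 / Real.log x := by
      have : Real.log x ≤ Real.log X := Real.log_le_log (by linarith) hxX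
      have : 0 ≤ Real.log (Real.log x) := by linarith
      gcongr
    calc (Mx x : ℝ) ≤ X := hMX
      _ = C' * (Real.log (Real.log 10) ^ 5 / Real.log X) := by rw [hC']; field_simp
      _ ≤ C' * (Real.log (Real.log x) ^ 5 / Real.log x) := by gcongr
      _ ≤ (1 + (C + C') * (Real.log (Real.log x) ^ 5 / Real.log x)) * 1 := by
          have := mul_nonneg hC.le hs0
          linarith
      _ ≤ _ := by gcongr
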